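/- Let p ∈ (1, p_N) and λ > 0, and let Ω ⊂ ℝ^N, N ≥ 2, be either a ball B_R(0) centered at the origin, or (with N = 2) a bounded C³ domain that is symmetric under each coordinate reflection x_i ↦ −x_i (i = 1, 2) and convex in each coordinate direction (any segment parallel to a coordinate axis with endpoints in Ω lies in Ω). Let (α, ψ) be a solution of problem (P)_λ on Ω, and suppose φ ∈ C²(Ω̄) is a nontrivial eigenfunction of the linearized operator L_λ with eigenvalue σ = 0, i.e. φ = 0 on ∂Ω and −Δφ = pλ V [φ] in Ω. Then ⟨φ⟩ ≠ 0, i.e. ∫_Ω V φ ≠ 0. -/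

import Mathlib

open MeasureTheory Metric Set

noncomputable section

/-- The Laplacian of a function on Euclidean space. -/
def lapl {N : ℕ} (f : EuclideanSpace ℝ (Fin N) → ℝ) (x : EuclideanSpace ℝ (Fin N)) : ℝ :=
  ∑ i : Fin N,
    fderiv ℝ (fun y => fderiv ℝ f y (EuclideanSpace.single i (1 : ℝ))) x
      (EuclideanSpace.single i (1 : ℝ))

/-- `(α, ψ)` is a solution of problem `(P)_λ` on `Ω`:
`ψ ∈ C²`, `-Δψ = (max (α + λψ) 0)^p` in `Ω`, `ψ = 0` on `∂Ω`, and
`∫_Ω (max (α + λψ) 0)^p = 1`. -/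
def IsSol {N : ℕ} (Ω : Set (EuclideanSpace ℝ (Fin N))) (p lam α : ℝ)
    (ψ : EuclideanSpace ℝ (Fin N) → ℝ) : Prop :=
  ContDiff ℝ 2 ψ ∧
  (∀ x ∈ Ω, -lapl ψ x = (max (α + lam * ψ x) 0) ^ p) ∧
  (∀ x ∈ frontier Ω, ψ x = 0) ∧
  (∫ x in Ω, (max (α + lam * ψ x) 0) ^ p) = 1

/-- The weight `V = (max (α + λψ) 0)^(p-1)`. -/
def Vfun {N : ℕ} (p lam α : ℝ) (ψ : EuclideanSpace ℝ (Fin N) → ℝ)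
    (x : EuclideanSpace ℝ (Fin N)) : ℝ :=
  (max (α + lam * ψ x) 0) ^ (p - 1)

/-- `m = ∫_Ω V`. -/
def mV {N : ℕ} (Ω : Set (EuclideanSpace ℝ (Fin N))) (p lam α : ℝ)
    (ψ : EuclideanSpace ℝ (Fin N) → ℝ) : ℝ :=
  ∫ x in Ω, Vfun p lam α ψ x

/-- The weighted average `⟨φ⟩ = (∫_Ω V φ) / m`. -/
def avgV {N : ℕ} (Ω : Set (EuclideanSpace ℝ (Fin N))) (p lam α : ℝ)
    (ψ φ : EuclideanSpace ℝ (Fin N) → ℝ) : ℝ :=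
  (∫ x in Ω, Vfun p lam α ψ x * φ x) / mV Ω p lam α ψ

/-- `σ` is an eigenvalue of the linearized operator `L_λ` at the solution `(α, ψ)`:
there is a nontrivial `φ ∈ C²(Ω̄)` vanishing on `∂Ω` with `-Δφ = (pλ + σ) V [φ]` in `Ω`. -/
def IsEigen {N : ℕ} (Ω : Set (EuclideanSpace ℝ (Fin N))) (p lam α : ℝ)
    (ψ : EuclideanSpace ℝ (Fin N) → ℝ) (σ : ℝ) : Prop :=
  ∃ φ : EuclideanSpace ℝ (Fin N) → ℝ, ContDiff ℝ 2 φ ∧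
    (∃ x ∈ closure Ω, φ x ≠ 0) ∧ (∀ x ∈ frontier Ω, φ x = 0) ∧
    ∀ x ∈ Ω, -lapl φ x = (p * lam + σ) * (Vfun p lam α ψ x * (φ x - avgV Ω p lam α ψ φ))

/-- `Ω` is a bounded domain of class `C³`: open, connected, bounded, and near every
boundary point `Ω` is the sublevel set of a `C³` function with nonvanishing gradient. -/
def IsC3Domain {N : ℕ} (Ω : Set (EuclideanSpace ℝ (Fin N))) : Prop :=
  IsOpen Ω ∧ IsConnected Ω ∧ Bornology.IsBounded Ω ∧
  ∀ x ∈ frontier Ω, ∃ (U : Set (EuclideanSpace ℝ (Fin N)))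
      (f : EuclideanSpace ℝ (Fin N) → ℝ),
    IsOpen U ∧ x ∈ U ∧ ContDiff ℝ 3 f ∧ (∀ y ∈ U, fderiv ℝ f y ≠ 0) ∧
    Ω ∩ U = {y ∈ U | f y < 0}

/-- Reflection of `x ∈ ℝ^N` in the `i`-th coordinate: `x_i ↦ -x_i`. -/
def reflect {N : ℕ} (i : Fin N) (x : EuclideanSpace ℝ (Fin N)) :
    EuclideanSpace ℝ (Fin N) :=
  (EuclideanSpace.equiv (Fin N) ℝ).symm
    (Function.update ((EuclideanSpace.equiv (Fin N) ℝ) x) i (-(x i)))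

open Filter Topology
open scoped RealInnerProductSpace

/-- Euclidean space of dimension `N`. -/
abbrev Euc (N : ℕ) := EuclideanSpace ℝ (Fin N)

/-- The `i`-th partial derivative. -/
def pd {N : ℕ} (i : Fin N) (f : Euc N → ℝ) (x : Euc N) : ℝ :=
  fderiv ℝ f x (EuclideanSpace.single i (1 : ℝ))

section Basics

variable {N : ℕ}

lemma lapl_eq_sum_pd (f : Euc N → ℝ) (x : Euc N) : lapl f x = ∑ i, pd i (pd i f) x := rfl

lemma fderiv_apply_eq_sum_pd (f : Euc N → ℝ) (x v : Euc N) :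
    fderiv ℝ f x v = ∑ i, v i * pd i f x := by
  have h : v = ∑ i, v i • EuclideanSpace.single i (1 : ℝ) := by
    ext j
    simp [Finset.sum_apply, Pi.single_apply]
  conv_lhs => rw [h]
  simp [map_sum, pd]

lemma differentiableAt_fderiv {f : Euc N → ℝ} {x : Euc N} (hf : ContDiffAt ℝ 2 f x) :
    DifferentiableAt ℝ (fderiv ℝ f) x :=
  (hf.fderiv_right (m := 1) (by norm_num)).differentiableAt (by norm_num)

lemma fderiv_fderiv_apply {f : Euc N → ℝ} {x : Euc N} (hf : ContDiffAt ℝ 2 f x) (v w : Euc N) :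
    fderiv ℝ (fun y => fderiv ℝ f y v) x w = fderiv ℝ (fderiv ℝ f) x w v := by
  rw [fderiv_clm_apply (differentiableAt_fderiv hf) (differentiableAt_const v)]
  simp

lemma lapl_eq_laplacian {f : Euc N → ℝ} {x : Euc N} (hf : ContDiffAt ℝ 2 f x) :
    lapl f x = Laplacian.laplacian f x := by
  rw [InnerProductSpace.laplacian_eq_iteratedFDeriv_orthonormalBasis f
    (EuclideanSpace.basisFun (Fin N) ℝ)]
  simp only [lapl, iteratedFDeriv_two_apply]
  refine Finset.sum_congr rfl fun i _ => ?_
  rw [fderiv_fderiv_apply hf]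
  simp

lemma lapl_eq_sum_orthonormalBasis {f : Euc N → ℝ} {x : Euc N} (hf : ContDiffAt ℝ 2 f x)
    (b : OrthonormalBasis (Fin N) ℝ (Euc N)) :
    lapl f x = ∑ i, fderiv ℝ (fderiv ℝ f) x (b i) (b i) := by
  rw [lapl_eq_laplacian hf, InnerProductSpace.laplacian_eq_iteratedFDeriv_orthonormalBasis f b]
  simp [iteratedFDeriv_two_apply]

lemma lapl_eq_sum_single {f : Euc N → ℝ} {x : Euc N} (hf : ContDiffAt ℝ 2 f x) :
    lapl f x = ∑ i, fderiv ℝ (fderiv ℝ f) x (EuclideanSpace.single i (1 : ℝ))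
      (EuclideanSpace.single i (1 : ℝ)) := by
  simp only [lapl, fderiv_fderiv_apply hf]

lemma lapl_add {f g : Euc N → ℝ} {x : Euc N} (hf : ContDiffAt ℝ 2 f x) (hg : ContDiffAt ℝ 2 g x) :
    lapl (fun y => f y + g y) x = lapl f x + lapl g x := by
  rw [lapl_eq_laplacian (hf.add hg), lapl_eq_laplacian hf, lapl_eq_laplacian hg]
  exact hf.laplacian_add hg

lemma lapl_const_mul {f : Euc N → ℝ} {x : Euc N} (c : ℝ) (hf : ContDiffAt ℝ 2 f x) :
    lapl (fun y => c * f y) x = c * lapl f x := by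
  rw [lapl_eq_laplacian (contDiffAt_const.mul hf), lapl_eq_laplacian hf]
  exact InnerProductSpace.laplacian_smul c hf

lemma lapl_neg {f : Euc N → ℝ} {x : Euc N} (hf : ContDiffAt ℝ 2 f x) :
    lapl (fun y => -f y) x = -lapl f x := by
  simpa using lapl_const_mul (-1) hf

lemma lapl_sub {f g : Euc N → ℝ} {x : Euc N} (hf : ContDiffAt ℝ 2 f x) (hg : ContDiffAt ℝ 2 g x) :
    lapl (fun y => f y - g y) x = lapl f x - lapl g x := by
  simp only [sub_eq_add_neg]
  rw [lapl_add hf hg.neg, lapl_neg hg]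

lemma lapl_congr {f g : Euc N → ℝ} {x : Euc N} (h : f =ᶠ[𝓝 x] g) : lapl f x = lapl g x := by
  refine Finset.sum_congr rfl fun i _ => ?_
  have : (fun y => fderiv ℝ f y (EuclideanSpace.single i (1 : ℝ))) =ᶠ[𝓝 x]
      (fun y => fderiv ℝ g y (EuclideanSpace.single i (1 : ℝ))) := by
    filter_upwards [h.eventuallyEq_nhds] with y hy
    rw [hy.fderiv_eq]
  rw [this.fderiv_eq]

/-- Computing a Laplacian from explicit first and second derivatives. -/
lemma lapl_of_hasFDerivAt {f : Euc N → ℝ} {x : Euc N} {f' : Euc N → Euc N →L[ℝ] ℝ}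
    {L : Fin N → Euc N →L[ℝ] ℝ} (h1 : ∀ᶠ y in 𝓝 x, HasFDerivAt f (f' y) y)
    (h2 : ∀ i, HasFDerivAt (fun y => f' y (EuclideanSpace.single i (1 : ℝ))) (L i) x) :
    lapl f x = ∑ i, L i (EuclideanSpace.single i (1 : ℝ)) := by
  refine Finset.sum_congr rfl fun i _ => ?_
  have : (fun y => fderiv ℝ f y (EuclideanSpace.single i (1 : ℝ))) =ᶠ[𝓝 x]
      (fun y => f' y (EuclideanSpace.single i (1 : ℝ))) := by
    filter_upwards [h1] with y hy
    rw [hy.fderiv]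
  rw [this.fderiv_eq, (h2 i).fderiv]

/-- The Laplacian commutes with rigid motions. -/
lemma lapl_comp_isometry {f : Euc N → ℝ} (ρ : Euc N ≃ₗᵢ[ℝ] Euc N) (a x : Euc N)
    (hf : ContDiffAt ℝ 2 f (ρ x + a)) :
    lapl (fun y => f (ρ y + a)) x = lapl f (ρ x + a) := by
  have hA : ∀ y, HasFDerivAt (fun y => ρ y + a) (ρ.toContinuousLinearEquiv : Euc N →L[ℝ] Euc N) y :=
    fun y => (ρ.toContinuousLinearEquiv.hasFDerivAt (x := y)).add_const a
  have hAs : ContDiffAt ℝ 2 (fun y => ρ y + a) x :=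
    (ρ.toContinuousLinearEquiv.contDiff.add contDiff_const).contDiffAt
  have hev : ∀ᶠ y in 𝓝 x, DifferentiableAt ℝ f (ρ y + a) := by
    have h1 : ∀ᶠ z in 𝓝 (ρ x + a), DifferentiableAt ℝ f z :=
      (hf.eventually (by simp)).mono fun z hz => hz.differentiableAt (by norm_num)
    exact (hAs.continuousAt).eventually h1
  rw [lapl_of_hasFDerivAt (x := x) (f' := fun y => (fderiv ℝ f (ρ y + a)).comp
    (ρ.toContinuousLinearEquiv : Euc N →L[ℝ] Euc N))
    (L := fun i => ((fderiv ℝ (fderiv ℝ f) (ρ x + a)).comp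
      (ρ.toContinuousLinearEquiv : Euc N →L[ℝ] Euc N)).flip (ρ (EuclideanSpace.single i (1 : ℝ))))]
  · rw [lapl_eq_sum_orthonormalBasis hf ((EuclideanSpace.basisFun (Fin N) ℝ).map ρ)]
    simp
  · filter_upwards [hev] with y hy
    exact hy.hasFDerivAt.comp y (hA y)
  · intro i
    have h2 := (differentiableAt_fderiv hf).hasFDerivAt.comp x (hA x)
    have h3 := h2.clm_apply (hasFDerivAt_const (ρ (EuclideanSpace.single i (1 : ℝ))) x)
    simpa using h3

/-- Second derivative test for the Laplacian. -/
lemma lapl_nonneg_of_isLocalMin {f : Euc N → ℝ} {x : Euc N} (hf : ContDiffAt ℝ 2 f x)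
    (h : IsLocalMin f x) : 0 ≤ lapl f x := by
  rw [lapl_eq_sum_single hf]
  refine Finset.sum_nonneg fun i _ => ?_
  set v : Euc N := EuclideanSpace.single i (1 : ℝ)
  set g : ℝ → ℝ := fun t => f (x + t • v)
  have hl : ∀ t, HasDerivAt (fun t : ℝ => x + t • v) v t := fun t => by
    simpa using ((hasDerivAt_id t).smul_const v).const_add x
  have hl0 : ContinuousAt (fun t : ℝ => x + t • v) 0 := (hl 0).continuousAt
  have hx0 : x + (0 : ℝ) • v = x := by simp
  have hev : ∀ᶠ t in 𝓝 (0 : ℝ), DifferentiableAt ℝ f (x + t • v) := by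
    have h1 : ∀ᶠ z in 𝓝 (x + (0 : ℝ) • v), DifferentiableAt ℝ f z := by
      rw [hx0]
      exact (hf.eventually (by simp)).mono fun z hz => hz.differentiableAt (by norm_num)
    exact hl0.eventually h1
  have hd1 : deriv g =ᶠ[𝓝 0] fun t => fderiv ℝ f (x + t • v) v := by
    filter_upwards [hev] with t ht
    exact (ht.hasFDerivAt.comp_hasDerivAt t (hl t)).deriv
  have hd2 : deriv (deriv g) 0 = fderiv ℝ (fderiv ℝ f) x v v := by
    rw [hd1.deriv_eq]
    have h2 : HasDerivAt (fun t : ℝ => fderiv ℝ f (x + t • v))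
        (fderiv ℝ (fderiv ℝ f) x v) 0 := by
      have := (differentiableAt_fderiv hf).hasFDerivAt
      rw [← hx0] at this
      have h3 := this.comp_hasDerivAt (0 : ℝ) (hl 0)
      rw [hx0] at h3
      exact h3
    simpa using (h2.clm_apply (hasDerivAt_const (0 : ℝ) v)).deriv
  have hgmin : IsLocalMin g 0 := by
    have : ∀ᶠ z in 𝓝 (x + (0 : ℝ) • v), f x ≤ f z := by rw [hx0]; exact h
    have h4 := hl0.eventually this
    filter_upwards [h4] with t ht
    simpa [g] using ht
  have hg0 : deriv g 0 = 0 := hgmin.deriv_eq_zero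
  have hgc : ContinuousAt g 0 := by
    have h5 : ContinuousAt f (x + (0 : ℝ) • v) := by rw [hx0]; exact hf.continuousAt
    exact ContinuousAt.comp (f := fun t : ℝ => x + t • v) h5 hl0
  by_contra hneg
  push Not at hneg
  have hmax : IsLocalMax g 0 :=
    isLocalMax_of_deriv_deriv_neg (by rw [hd2]; exact hneg) hg0 hgc
  have hconst : g =ᶠ[𝓝 0] fun _ => g 0 := by
    filter_upwards [hgmin, hmax] with t h1 h2
    exact le_antisymm h2 h1
  have : deriv (deriv g) 0 = 0 := by
    have h6 : deriv g =ᶠ[𝓝 0] fun _ => 0 := by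
      filter_upwards [hconst.eventuallyEq_nhds] with t ht
      rw [ht.deriv_eq]; simp
    rw [h6.deriv_eq]; simp
  rw [hd2] at this
  linarith

lemma hasFDerivAt_norm_sq_sub (c y : Euc N) :
    HasFDerivAt (fun y => ‖y - c‖ ^ 2) ((2 : ℝ) • (innerSL ℝ (y - c))) y := by
  have h := (hasStrictFDerivAt_norm_sq (y - c)).hasFDerivAt.comp y
    ((hasFDerivAt_id y).sub_const c)
  refine HasFDerivAt.congr_fderiv h ?_
  ext v
  simp [two_smul]

lemma hasFDerivAt_sub_coord (c x : Euc N) (i : Fin N) :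
    HasFDerivAt (fun y : Euc N => (y - c) i) (EuclideanSpace.proj i : Euc N →L[ℝ] ℝ) x :=
  (EuclideanSpace.proj (𝕜 := ℝ) i : Euc N →L[ℝ] ℝ).hasFDerivAt.comp x
    ((hasFDerivAt_id x).sub_const c)

/-- The Laplacian of `exp (-γ |x - c|²)`. -/
lemma lapl_exp_neg_norm_sq (γ : ℝ) (c x : Euc N) :
    lapl (fun y => Real.exp (-γ * ‖y - c‖ ^ 2)) x =
      (4 * γ ^ 2 * ‖x - c‖ ^ 2 - 2 * γ * N) * Real.exp (-γ * ‖x - c‖ ^ 2) := by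
  have hn := hasFDerivAt_norm_sq_sub c
  have he : ∀ y : Euc N, HasFDerivAt (fun y => Real.exp (-γ * ‖y - c‖ ^ 2))
      (Real.exp (-γ * ‖y - c‖ ^ 2) • ((-γ) • ((2 : ℝ) • (innerSL ℝ (y - c))))) y :=
    fun y => ((hn y).const_mul (-γ)).exp
  have hin := hasFDerivAt_sub_coord c x
  rw [lapl_of_hasFDerivAt (x := x) (Eventually.of_forall he)
    (L := fun i =>
      Real.exp (-γ * ‖x - c‖ ^ 2) • ((-γ * 2) • (EuclideanSpace.proj i : Euc N →L[ℝ] ℝ)) +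
      ((-γ * 2) * (x - c) i) •
        (Real.exp (-γ * ‖x - c‖ ^ 2) • ((-γ) • ((2 : ℝ) • (innerSL ℝ (x - c))))))]
  · have hs : ‖x - c‖ ^ 2 = ∑ i, (x - c) i ^ 2 := EuclideanSpace.real_norm_sq_eq _
    have : ∀ i : Fin N, (Real.exp (-γ * ‖x - c‖ ^ 2) •
          ((-γ * 2) • (EuclideanSpace.proj i : Euc N →L[ℝ] ℝ)) + ((-γ * 2) * (x - c) i) •
          (Real.exp (-γ * ‖x - c‖ ^ 2) • ((-γ) • ((2 : ℝ) • (innerSL ℝ (x - c))))))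
          (EuclideanSpace.single i (1 : ℝ)) =
        -2 * γ * Real.exp (-γ * ‖x - c‖ ^ 2) +
        (4 * γ ^ 2 * Real.exp (-γ * ‖x - c‖ ^ 2)) * (x - c) i ^ 2 := by
      intro i
      simp [EuclideanSpace.inner_single_right]
      ring
    rw [Finset.sum_congr rfl fun i _ => this i, Finset.sum_add_distrib,
      ← Finset.mul_sum (a := 4 * γ ^ 2 * Real.exp (-γ * ‖x - c‖ ^ 2)), ← hs]
    simp
    ring
  · intro i
    have h := (he x).mul ((hin i).const_mul (-γ * 2))
    refine (h.congr_of_eventuallyEq ?_).congr_fderiv ?_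
    · refine Eventually.of_forall fun y => ?_
      simp [EuclideanSpace.inner_single_right]
      ring
    · ext v
      simp
lemma contDiff_exp_neg_norm_sq (γ : ℝ) (c : Euc N) {n : WithTop ℕ∞} :
    ContDiff ℝ n (fun y : Euc N => Real.exp (-γ * ‖y - c‖ ^ 2)) :=
  (contDiff_const.mul ((contDiff_id.sub contDiff_const).norm_sq ℝ)).exp

/-- The Laplacian of `|x - c|²`. -/
lemma lapl_norm_sq (c x : Euc N) : lapl (fun y => ‖y - c‖ ^ 2) x = 2 * N := by
  have hn := hasFDerivAt_norm_sq_sub c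
  rw [lapl_of_hasFDerivAt (x := x) (Eventually.of_forall hn)
    (L := fun i => (2 : ℝ) • (EuclideanSpace.proj i : Euc N →L[ℝ] ℝ))]
  · simp
    ring
  · intro i
    have := (EuclideanSpace.proj (𝕜 := ℝ) i : Euc N →L[ℝ] ℝ).hasFDerivAt.comp x
      ((hasFDerivAt_id x).sub_const c)
    refine ((this.const_mul 2).congr_of_eventuallyEq ?_).congr_fderiv ?_
    · refine Eventually.of_forall fun y => ?_
      simp [EuclideanSpace.inner_single_right]
    · ext v
      simp

lemma contDiff_norm_sq_sub (c : Euc N) {n : WithTop ℕ∞} :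
    ContDiff ℝ n (fun y : Euc N => ‖y - c‖ ^ 2) :=
  (contDiff_id.sub contDiff_const).norm_sq ℝ

end Basics

section Viscosity

variable {N : ℕ}

lemma continuousAt_fderiv_fderiv {f : Euc N → ℝ} {x : Euc N} (hf : ContDiffAt ℝ 2 f x) :
    ContinuousAt (fderiv ℝ (fderiv ℝ f)) x :=
  ((hf.fderiv_right (m := 1) (by norm_num)).fderiv_right (m := 0) (by norm_num)).continuousAt

lemma continuousAt_lapl {f : Euc N → ℝ} {x : Euc N} (hf : ContDiffAt ℝ 2 f x) :
    ContinuousAt (lapl f) x := by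
  have h : lapl f =ᶠ[𝓝 x] fun y => ∑ i, fderiv ℝ (fderiv ℝ f) y
      (EuclideanSpace.single i (1 : ℝ)) (EuclideanSpace.single i (1 : ℝ)) :=
    (hf.eventually (by simp)).mono fun y hy => lapl_eq_sum_single hy
  refine ContinuousAt.congr ?_ h.symm
  refine tendsto_finsetSum _ fun i _ => ?_
  exact ((continuousAt_fderiv_fderiv hf).clm_apply continuousAt_const).clm_apply
    continuousAt_const

/-- `z` is differentiable and satisfies `Δz + c z ≤ 0` in the viscosity sense on `U`. -/
def VSup (U : Set (Euc N)) (c z : Euc N → ℝ) : Prop :=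
  ∀ x ∈ U, DifferentiableAt ℝ z x ∧ ∀ q : Euc N → ℝ, ContDiffAt ℝ 2 q x →
    IsLocalMin (fun y => z y - q y) x → lapl q x ≤ -c x * z x

lemma VSup.mono {U U' : Set (Euc N)} {c z : Euc N → ℝ} (h : VSup U c z) (hU : U' ⊆ U) :
    VSup U' c z := fun x hx => h x (hU hx)

lemma VSup.continuousAt {U : Set (Euc N)} {c z : Euc N → ℝ} (h : VSup U c z) {x : Euc N}
    (hx : x ∈ U) : ContinuousAt z x := (h x hx).1.continuousAt

lemma VSup.of_lapl_le {U : Set (Euc N)} {c z : Euc N → ℝ} (hz : ∀ x ∈ U, ContDiffAt ℝ 2 z x)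
    (h : ∀ x ∈ U, lapl z x ≤ -c x * z x) : VSup U c z := by
  intro x hx
  refine ⟨(hz x hx).differentiableAt (by norm_num), fun q hq hmin => ?_⟩
  have h1 := lapl_nonneg_of_isLocalMin ((hz x hx).sub hq) hmin
  have h2 := lapl_sub (hz x hx) hq
  have h3 := h x hx
  change 0 ≤ lapl (fun y => z y - q y) x at h1
  linarith

lemma VSup.const_mul_sub {U : Set (Euc N)} {c z v : Euc N → ℝ} (hz : VSup U c z) {C : ℝ}
    (hC : 0 < C) (hv : ∀ x ∈ U, ContDiffAt ℝ 2 v x) (hveq : ∀ x ∈ U, lapl v x = -c x * v x) :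
    VSup U c (fun x => C * z x - v x) := by
  intro x hx
  refine ⟨((hz x hx).1.const_mul C).sub ((hv x hx).differentiableAt (by norm_num)),
    fun q hq hmin => ?_⟩
  have hs : ContDiffAt ℝ 2 (fun y => v y + q y) x := (hv x hx).add hq
  have h1 := (hz x hx).2 (fun y => C⁻¹ * (v y + q y)) (contDiffAt_const.mul hs) (by
    filter_upwards [hmin] with y hy
    have := mul_le_mul_of_nonneg_left hy (inv_pos.2 hC).le
    have e1 : ∀ w, C⁻¹ * (C * z w - v w - q w) = z w - C⁻¹ * (v w + q w) := fun w => by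
      field_simp; ring
    rwa [e1, e1] at this)
  rw [lapl_const_mul _ hs, lapl_add (hv x hx) hq, hveq x hx] at h1
  have h2 := mul_le_mul_of_nonneg_left h1 hC.le
  have e2 : C * (C⁻¹ * (-c x * v x + lapl q x)) = -c x * v x + lapl q x := by field_simp
  rw [e2] at h2
  linarith

/-- Stability of viscosity supersolutions under locally uniform limits. -/
lemma VSup.of_tendsto {U : Set (Euc N)} {c z : Euc N → ℝ} {zn : ℕ → Euc N → ℝ}
    (hz : ∀ x ∈ U, DifferentiableAt ℝ z x) (hc : ∀ x ∈ U, ContinuousAt c x)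
    (h : ∀ x ∈ U, ∃ r > 0, TendstoUniformlyOn zn z atTop (closedBall x r) ∧
      ∀ᶠ n in atTop, ∀ y ∈ closedBall x r, ContDiffAt ℝ 2 (zn n) y ∧
        lapl (zn n) y ≤ -c y * zn n y) : VSup U c z := by
  intro x hx
  refine ⟨hz x hx, fun q hq hmin => ?_⟩
  by_contra! hlt
  obtain ⟨r, hr, hunif, hev⟩ := h x hx
  obtain ⟨ε, hε, hεlt⟩ : ∃ ε > 0, 0 < lapl q x - ε * (2 * N) + c x * z x := by
    refine ⟨(lapl q x + c x * z x) / (2 * N + 1) / 2, ?_, ?_⟩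
    · have : 0 < lapl q x + c x * z x := by linarith
      positivity
    · have h0 : 0 < lapl q x + c x * z x := by linarith
      have : (lapl q x + c x * z x) / (2 * N + 1) / 2 * (2 * N) ≤
          (lapl q x + c x * z x) / 2 := by
        rw [div_div, div_mul_eq_mul_div, div_le_div_iff₀ (by positivity) (by positivity)]
        nlinarith [h0]
      linarith
  set qe : Euc N → ℝ := fun y => q y - ε * ‖y - x‖ ^ 2 with hqe
  have hsq : ∀ y, ContDiffAt ℝ 2 (fun y : Euc N => ε * ‖y - x‖ ^ 2) y := fun y =>
    (contDiff_const.mul (contDiff_norm_sq_sub x)).contDiffAt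
  have hqe2 : ContDiffAt ℝ 2 qe x := hq.sub (hsq x)
  have hqex : lapl qe x = lapl q x - ε * (2 * N) := by
    rw [hqe, lapl_sub hq (hsq x), lapl_const_mul _ (contDiff_norm_sq_sub x).contDiffAt,
      lapl_norm_sq]
  have hpos : ∀ᶠ ya in 𝓝 (x, z x), 0 < lapl qe ya.1 + c ya.1 * ya.2 := by
    have hcont : ContinuousAt (fun ya : Euc N × ℝ => lapl qe ya.1 + c ya.1 * ya.2) (x, z x) :=
      (ContinuousAt.comp (x := (x, z x)) (continuousAt_lapl hqe2) continuousAt_fst).add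
        ((ContinuousAt.comp (x := (x, z x)) (hc x hx) continuousAt_fst).mul continuousAt_snd)
    exact hcont.eventually (lt_mem_nhds (by simpa [hqex] using hεlt))
  rw [nhds_prod_eq] at hpos
  obtain ⟨pa, hpa, pb, hpb, hpab⟩ := eventually_prod_iff.1 hpos
  obtain ⟨η, hη, hηb⟩ := Metric.eventually_nhds_iff.1 hpb
  have hall : ∀ᶠ y in 𝓝 x, pa y ∧ ContDiffAt ℝ 2 qe y ∧ z x - q x ≤ z y - q y ∧
      dist (z y) (z x) < η / 2 :=
    hpa.and ((hqe2.eventually (by simp)).and (Filter.Eventually.and hmin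
      ((hz x hx).continuousAt.eventually (ball_mem_nhds _ (half_pos hη)))))
  obtain ⟨ρ, hρ, hρb⟩ := Metric.eventually_nhds_iff.1 hall
  set s := min r (ρ / 2) with hs
  have hspos : 0 < s := lt_min hr (half_pos hρ)
  have hsball : ∀ y ∈ closedBall x s, dist y x < ρ := fun y hy =>
    lt_of_le_of_lt ((mem_closedBall.1 hy).trans (min_le_right _ _)) (half_lt_self hρ)
  have hsr : closedBall x s ⊆ closedBall x r := closedBall_subset_closedBall (min_le_left _ _)
  set θ := min (η / 2) (ε * s ^ 2 / 4) with hθ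
  have hθpos : 0 < θ := lt_min (half_pos hη) (by positivity)
  obtain ⟨n, hn1, hn2⟩ := ((Metric.tendstoUniformlyOn_iff.1 hunif θ hθpos).and hev).exists
  have hcn : ContinuousOn (fun y => zn n y - qe y) (closedBall x s) := fun y hy =>
    ((hn2 y (hsr hy)).1.continuousAt.sub (hρb (hsball y hy)).2.1.continuousAt).continuousWithinAt
  obtain ⟨y, hy, hymin⟩ := (isCompact_closedBall x s).exists_isMinOn
    ⟨x, mem_closedBall_self hspos.le⟩ hcn
  have hxm := hymin (mem_closedBall_self hspos.le : x ∈ closedBall x s)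
  have hxm' : zn n y - qe y ≤ zn n x - qe x := hxm
  have hy1 := hn1 y (hsr hy)
  have hx1 := hn1 x (mem_closedBall_self hr.le)
  rw [Real.dist_eq, abs_lt] at hy1 hx1
  obtain ⟨hpy, hqy, hzy, hdy⟩ := hρb (hsball y hy)
  have hyint : dist y x < s := by
    have hθ2 : θ ≤ ε * s ^ 2 / 4 := min_le_right _ _
    have : ε * ‖y - x‖ ^ 2 < ε * s ^ 2 := by
      simp only [hqe, sub_self, norm_zero] at hxm'
      nlinarith
    have h2 := lt_of_mul_lt_mul_left this hε.le
    rw [dist_eq_norm]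
    exact lt_of_pow_lt_pow_left₀ 2 hspos.le h2
  have hloc : IsLocalMin (fun y => zn n y - qe y) y := by
    refine hymin.isLocalMin ?_
    exact Filter.mem_of_superset (isOpen_ball.mem_nhds (mem_ball.2 hyint)) ball_subset_closedBall
  have hzn := hn2 y (hsr hy)
  have h1 := lapl_nonneg_of_isLocalMin (hzn.1.sub hqy) hloc
  have h2 := lapl_sub hzn.1 hqy
  change 0 ≤ lapl (fun y => zn n y - qe y) y at h1
  have hb : pb (zn n y) := hηb (by
    rw [Real.dist_eq] at hdy ⊢
    rw [abs_lt] at hdy ⊢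
    have : θ ≤ η / 2 := min_le_left _ _
    constructor <;> linarith)
  have := hpab hpy hb
  simp only at this
  linarith [hzn.2]

/-- Hopf's boundary point lemma, quantitative form. -/
lemma VSup.hopf {U : Set (Euc N)} {c z : Euc N → ℝ} (hz : VSup U c z) {x₀ b : Euc N} {R : ℝ}
    (hR : 0 < R) (hU : ball x₀ R ⊆ U) (hc : ∀ x ∈ ball x₀ R, 0 ≤ c x)
    (hpos : ∀ x ∈ ball x₀ R, 0 < z x) (hcont : ContinuousOn z (closedBall x₀ R))
    (hb : ‖b - x₀‖ = R) (hnn : ∀ x ∈ closedBall x₀ R, 0 ≤ z x) :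
    ∃ k > 0, ∀ t ∈ Icc 0 (R / 2), k * t ≤ z (b + (t / R) • (x₀ - b)) := by
  set γ : ℝ := (2 * N + 1) / R ^ 2 with hγ
  have hγpos : 0 < γ := by positivity
  have hγR : γ * R ^ 2 = 2 * N + 1 := by rw [hγ]; field_simp
  set h : Euc N → ℝ := fun y => Real.exp (-γ * ‖y - x₀‖ ^ 2) - Real.exp (-γ * R ^ 2) with hh
  have hh2 : ∀ y, ContDiffAt ℝ 2 h y := fun y =>
    ((contDiff_exp_neg_norm_sq γ x₀).sub contDiff_const).contDiffAt
  have hlap : ∀ y, R / 2 < ‖y - x₀‖ → 0 < lapl h y := by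
    intro y hy
    rw [hh, lapl_sub (contDiff_exp_neg_norm_sq γ x₀).contDiffAt contDiffAt_const,
      lapl_exp_neg_norm_sq]
    have h0 : lapl (fun _ : Euc N => Real.exp (-γ * R ^ 2)) y = 0 := by simp [lapl]
    rw [h0, sub_zero]
    refine mul_pos ?_ (Real.exp_pos _)
    have : (R / 2) ^ 2 < ‖y - x₀‖ ^ 2 := by gcongr
    have h3 : 4 * γ ^ 2 * (R / 2) ^ 2 = γ * (γ * R ^ 2) := by ring
    have h4 : 4 * γ ^ 2 * (R / 2) ^ 2 < 4 * γ ^ 2 * ‖y - x₀‖ ^ 2 := by gcongr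
    rw [h3, hγR] at h4
    linarith
  have hcomp : IsCompact (sphere x₀ (R / 2)) := isCompact_sphere _ _
  have hsub : sphere x₀ (R / 2) ⊆ ball x₀ R := fun y hy => by
    rw [mem_ball, mem_sphere.1 hy]; linarith
  obtain ⟨m, hm, hmz⟩ : ∃ m > 0, ∀ y ∈ sphere x₀ (R / 2), m ≤ z y := by
    rcases (sphere x₀ (R / 2)).eq_empty_or_nonempty with he | hne
    · exact ⟨1, one_pos, by simp [he]⟩
    · obtain ⟨y, hy, hmin⟩ := hcomp.exists_isMinOn hne
        (hcont.mono (hsub.trans ball_subset_closedBall))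
      exact ⟨z y, hpos y (hsub hy), fun w hw => hmin hw⟩
  have hh1 : ∀ y, h y ≤ 1 := fun y => by
    have h1 : Real.exp (-γ * ‖y - x₀‖ ^ 2) ≤ 1 := by
      rw [Real.exp_le_one_iff]
      have := mul_nonneg hγpos.le (sq_nonneg ‖y - x₀‖)
      linarith
    have := Real.exp_pos (-γ * R ^ 2)
    simp only [hh]; linarith
  set A := closedBall x₀ R \ ball x₀ (R / 2) with hA
  have hAcomp : IsCompact A := (isCompact_closedBall _ _).diff isOpen_ball
  have hbA : b ∈ A := by
    refine ⟨by rw [mem_closedBall, dist_eq_norm, hb], ?_⟩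
    rw [mem_ball, dist_eq_norm, hb]; linarith
  have key : ∀ y ∈ A, m * h y ≤ z y := by
    obtain ⟨y, hy, hmin⟩ := hAcomp.exists_isMinOn ⟨b, hbA⟩ (f := fun y => z y - m * h y)
      ((hcont.mono sdiff_subset).sub (fun y _ =>
        (continuousAt_const.mul (hh2 y).continuousAt).continuousWithinAt))
    by_contra! hcon
    obtain ⟨w, hw, hwlt⟩ := hcon
    have hyneg : z y - m * h y < 0 := lt_of_le_of_lt (hmin hw) (by linarith)
    have hy1 : ‖y - x₀‖ ≤ R := by simpa [dist_eq_norm] using hy.1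
    have hy2 : R / 2 ≤ ‖y - x₀‖ := by simpa [dist_eq_norm] using hy.2
    have hy1' : ‖y - x₀‖ < R := by
      refine lt_of_le_of_ne hy1 fun he => ?_
      have : h y = 0 := by simp [hh, he]
      have h2 := hnn y hy.1
      rw [this] at hyneg; linarith
    have hy2' : R / 2 < ‖y - x₀‖ := by
      refine lt_of_le_of_ne hy2 fun he => ?_
      have h1 := hmz y (by rw [mem_sphere, dist_eq_norm, he])
      have h2 := hh1 y
      nlinarith
    have hyb : y ∈ ball x₀ R := by rw [mem_ball, dist_eq_norm]; exact hy1'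
    have hloc : IsLocalMin (fun y => z y - m * h y) y := by
      refine hmin.isLocalMin ?_
      have ho : IsOpen (ball x₀ R \ closedBall x₀ (R / 2)) :=
        isOpen_ball.sdiff isClosed_closedBall
      refine Filter.mem_of_superset (ho.mem_nhds ⟨hyb, ?_⟩)
        (sdiff_subset_sdiff ball_subset_closedBall ball_subset_closedBall)
      rw [mem_closedBall, dist_eq_norm]; exact not_le.2 hy2'
    have h1 := (hz y (hU hyb)).2 (fun y => m * h y) (contDiffAt_const.mul (hh2 y)) hloc
    rw [lapl_const_mul _ (hh2 y)] at h1
    have h2 := mul_pos hm (hlap y hy2')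
    have h3 := mul_nonneg (hc y hyb) (hpos y hyb).le
    linarith
  refine ⟨m * (Real.exp (-γ * R ^ 2) * (γ * R)), by positivity, fun t ht => ?_⟩
  have hdist : ‖b + (t / R) • (x₀ - b) - x₀‖ = R - t := by
    have : b + (t / R) • (x₀ - b) - x₀ = (1 - t / R) • (b - x₀) := by
      simp only [smul_sub, sub_smul, one_smul]; abel
    rw [this, norm_smul, hb, Real.norm_of_nonneg]
    · field_simp
    · rw [sub_nonneg, div_le_one hR]; linarith [ht.2]
  have hmem : b + (t / R) • (x₀ - b) ∈ A := by
    refine ⟨?_, ?_⟩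
    · rw [mem_closedBall, dist_eq_norm, hdist]; linarith [ht.1]
    · rw [mem_ball, dist_eq_norm, hdist]; linarith [ht.2]
  refine le_trans ?_ (key _ hmem)
  have e1 : Real.exp (-γ * (R - t) ^ 2) = Real.exp (-γ * R ^ 2) *
      Real.exp (γ * (2 * R * t - t ^ 2)) := by
    rw [← Real.exp_add]; congr 1; ring
  simp only [hh, hdist, e1]
  have h5 := Real.add_one_le_exp (γ * (2 * R * t - t ^ 2))
  have h6 : γ * (R * t) ≤ γ * (2 * R * t - t ^ 2) := by
    refine mul_le_mul_of_nonneg_left ?_ hγpos.le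
    nlinarith [ht.1, ht.2]
  have h7 : Real.exp (-γ * R ^ 2) * (γ * R * t) ≤ Real.exp (-γ * R ^ 2) *
      (Real.exp (γ * (2 * R * t - t ^ 2)) - 1) := by
    refine mul_le_mul_of_nonneg_left ?_ (Real.exp_pos _).le
    linarith
  have h8 := mul_le_mul_of_nonneg_left h7 hm.le
  linarith

/-- A function growing linearly along a ray from a zero has derivative bounded below there. -/
lemma le_fderiv_of_linear_growth {z : Euc N → ℝ} {b v : Euc N} {k δ : ℝ}
    (hz : DifferentiableAt ℝ z b) (hzb : z b = 0) (hδ : 0 < δ)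
    (h : ∀ t ∈ Icc 0 δ, k * t ≤ z (b + t • v)) : k ≤ fderiv ℝ z b v := by
  have hl : HasDerivAt (fun t : ℝ => b + t • v) v 0 := by
    simpa using ((hasDerivAt_id (0 : ℝ)).smul_const v).const_add b
  have hz' : HasFDerivAt z (fderiv ℝ z b) (b + (0 : ℝ) • v) := by simpa using hz.hasFDerivAt
  have hd := hz'.comp_hasDerivAt (0 : ℝ) hl
  have ht := (hasDerivAt_iff_tendsto_slope.1 hd).mono_left
    (nhdsWithin_mono (0 : ℝ) (fun x (hx : x ∈ Ioi (0 : ℝ)) => ne_of_gt hx))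
  refine ge_of_tendsto ht ?_
  filter_upwards [Ioo_mem_nhdsGT hδ] with t ht
  have := h t ⟨ht.1.le, ht.2.le⟩
  simp only [slope_def_field, Function.comp_apply, zero_smul, add_zero, hzb, sub_zero]
  rwa [le_div_iff₀ ht.1]

lemma VSup.hopf_fderiv {U : Set (Euc N)} {c z : Euc N → ℝ} (hz : VSup U c z) {x₀ b : Euc N}
    {R : ℝ} (hR : 0 < R) (hU : ball x₀ R ⊆ U) (hc : ∀ x ∈ ball x₀ R, 0 ≤ c x)
    (hpos : ∀ x ∈ ball x₀ R, 0 < z x) (hcont : ContinuousOn z (closedBall x₀ R))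
    (hb : ‖b - x₀‖ = R) (hnn : ∀ x ∈ closedBall x₀ R, 0 ≤ z x) (hzb : z b = 0)
    (hd : DifferentiableAt ℝ z b) : 0 < fderiv ℝ z b (x₀ - b) := by
  obtain ⟨k, hk, h⟩ := hz.hopf hR hU hc hpos hcont hb hnn
  refine lt_of_lt_of_le (mul_pos hk hR) (le_fderiv_of_linear_growth hd hzb
    (δ := 1 / 2) (by norm_num) fun t ht => ?_)
  have := h (t * R) ⟨mul_nonneg ht.1 hR.le, by nlinarith [ht.2]⟩
  rw [mul_div_cancel_right₀ _ hR.ne'] at this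
  linarith

/-- The zero set of a nonnegative supersolution is open. -/
lemma VSup.eventually_eq_zero {U : Set (Euc N)} {c z : Euc N → ℝ} (hz : VSup U c z)
    (hU : IsOpen U) (hc : ∀ x ∈ U, 0 ≤ c x) (hnn : ∀ x ∈ U, 0 ≤ z x) {x : Euc N} (hx : x ∈ U)
    (hzx : z x = 0) : ∀ᶠ y in 𝓝 x, z y = 0 := by
  obtain ⟨r, hr, hrU⟩ := Metric.isOpen_iff.1 hU x hx
  refine Metric.eventually_nhds_iff.2 ⟨r / 2, half_pos hr, fun y hy => ?_⟩
  by_contra hne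
  have hcb : closedBall y (dist x y) ⊆ U := fun w hw => hrU (by
    rw [mem_ball]
    have := dist_triangle w y x
    rw [mem_closedBall, dist_comm x y] at hw
    linarith)
  have hco : ContinuousOn z (closedBall y (dist x y)) := fun w hw =>
    (hz.continuousAt (hcb hw)).continuousWithinAt
  have hK : IsCompact (closedBall y (dist x y) ∩ z ⁻¹' {0}) :=
    (isCompact_closedBall _ _).of_isClosed_subset
      (hco.preimage_isClosed_of_isClosed isClosed_closedBall isClosed_singleton) inter_subset_left
  obtain ⟨b, hb, hbmin⟩ := hK.exists_isMinOn ⟨x, by simp, hzx⟩ (f := fun w => dist w y)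
    (by fun_prop)
  have hR : 0 < dist b y := dist_pos.2 fun h => hne (h ▸ hb.2)
  have hle : closedBall y (dist b y) ⊆ closedBall y (dist x y) :=
    closedBall_subset_closedBall hb.1
  have hposb : ∀ w ∈ ball y (dist b y), 0 < z w := fun w hw => by
    have hw' := hle (ball_subset_closedBall hw)
    refine lt_of_le_of_ne (hnn w (hcb hw')) fun h0 => ?_
    have := hbmin (show w ∈ closedBall y (dist x y) ∩ z ⁻¹' {0} from ⟨hw', h0.symm⟩)
    exact absurd (mem_ball.1 hw) (not_lt.2 this)
  have hbU := hcb hb.1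
  have := hz.hopf_fderiv hR (ball_subset_closedBall.trans (hle.trans hcb))
    (fun w hw => hc w (hcb (hle (ball_subset_closedBall hw)))) hposb (hco.mono hle)
    (by rw [dist_eq_norm]) (fun w hw => hnn w (hcb (hle hw))) hb.2 (hz b hbU).1
  have hmin : IsLocalMin z b := by
    filter_upwards [hU.mem_nhds hbU] with w hw
    rw [show z b = 0 from hb.2]; exact hnn w hw
  rw [hmin.fderiv_eq_zero] at this
  simp at this

/-- Strong minimum principle on a preconnected set. -/
lemma VSup.eq_zero_of_isPreconnected {U S : Set (Euc N)} {c z : Euc N → ℝ} (hz : VSup U c z)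
    (hU : IsOpen U) (hc : ∀ x ∈ U, 0 ≤ c x) (hnn : ∀ x ∈ U, 0 ≤ z x) (hS : IsPreconnected S)
    (hSU : S ⊆ U) {x : Euc N} (hx : x ∈ S) (hzx : z x = 0) : ∀ y ∈ S, z y = 0 := by
  have ho : IsOpen (U ∩ z ⁻¹' {0}ᶜ) :=
    ContinuousOn.isOpen_inter_preimage (fun w hw => (hz.continuousAt hw).continuousWithinAt) hU
      isOpen_compl_singleton
  by_contra! hcon
  obtain ⟨y, hy, hzy⟩ := hcon
  obtain ⟨w, hw, hw1, hw2⟩ := hS (interior (z ⁻¹' {0})) _ isOpen_interior ho (fun w hw => by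
      by_cases h0 : z w = 0
      · exact Or.inl (mem_interior_iff_mem_nhds.2
          (hz.eventually_eq_zero hU hc hnn (hSU hw) h0 : z ⁻¹' {0} ∈ 𝓝 w))
      · exact Or.inr ⟨hSU hw, h0⟩)
    ⟨x, hx, mem_interior_iff_mem_nhds.2
      (hz.eventually_eq_zero hU hc hnn (hSU hx) hzx : z ⁻¹' {0} ∈ 𝓝 x)⟩
    ⟨y, hy, hSU hy, hzy⟩
  exact hw2.2 (interior_subset hw1 : w ∈ z ⁻¹' {0})

end Viscosity

section SmallDistance

variable {N : ℕ}

/-- Around each point outside `S` there is a superharmonic barrier on `S`. -/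
def HasBarrier (S : Set (Euc N)) (r δ : ℝ) : Prop :=
  ∀ y ∉ S, ∃ b : Euc N → ℝ, ∀ x ∈ S, dist x y ≤ r → ContDiffAt ℝ 2 b x ∧ lapl b x ≤ 0 ∧
    0 ≤ b x ∧ (dist x y = r → 1 ≤ b x) ∧ (dist x y < δ → b x ≤ 1 / 2)

/-- A negative interior minimum of a supersolution stays away from the complement of a set
with barriers. -/
lemma VSup.ball_subset_of_isMin {S D : Set (Euc N)} {c z : Euc N → ℝ} {r δ M : ℝ}
    (hz : VSup D c z) (hδr : δ ≤ r) (hM : 0 ≤ M) (hcM : ∀ x ∈ D, c x ≤ M)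
    (hrM : 2 * ((M + 1) * r ^ 2) ≤ N) (hN : 0 < N) (hB : HasBarrier S r δ) (hDS : D ⊆ S)
    (hDo : IsOpen D) (hDb : Bornology.IsBounded D) (hcont : ContinuousOn z (closure D))
    (hbd : ∀ x ∈ closure D, x ∉ D → 0 ≤ z x) {x₀ : Euc N} (hx₀ : x₀ ∈ D) (hneg : z x₀ < 0)
    (hmin : ∀ x ∈ D, z x₀ ≤ z x) : ball x₀ δ ⊆ S := by
  intro y hy
  by_contra hyS
  obtain ⟨b, hb⟩ := hB y hyS
  rw [mem_ball, dist_comm] at hy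
  have hN' : (0 : ℝ) < N := by exact_mod_cast hN
  set m : ℝ := -z x₀ with hm
  have hmpos : 0 < m := by rw [hm]; linarith
  set κ : ℝ := (M + 1) * m / (2 * N) with hκ
  have hκpos : 0 < κ := by positivity
  have hκr : κ * r ^ 2 ≤ m / 4 := by
    rw [hκ, div_mul_eq_mul_div, div_le_div_iff₀ (by positivity) (by norm_num)]
    nlinarith
  set h : Euc N → ℝ := fun x => m * b x + κ * (r ^ 2 - ‖x - y‖ ^ 2) with hh
  have hclD : ∀ x ∈ closure D, m / 8 ≤ -z x → x ∈ D := fun x hx hx2 => by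
    by_contra hxD
    have := hbd x hx hxD
    linarith
  set A := (closure D ∩ closedBall y r) ∩ z ⁻¹' Iic (-(m / 8)) with hA
  have hAD : ∀ x ∈ A, x ∈ D := fun x hx => hclD x hx.1.1 (by
    have : z x ≤ -(m / 8) := hx.2
    linarith)
  have hAcl : IsClosed A := (hcont.mono inter_subset_left).preimage_isClosed_of_isClosed
    (isClosed_closure.inter isClosed_closedBall) isClosed_Iic
  have hAcomp : IsCompact A := hDb.isCompact_closure.of_isClosed_subset hAcl
    (inter_subset_left.trans inter_subset_left)
  have hx₀A : x₀ ∈ A := ⟨⟨subset_closure hx₀, mem_closedBall.2 (hy.le.trans hδr)⟩, by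
    change z x₀ ≤ -(m / 8); linarith⟩
  have hsm : ∀ x, ContDiffAt ℝ 2 (fun x : Euc N => κ * (r ^ 2 - ‖x - y‖ ^ 2)) x := fun x =>
    (contDiff_const.mul (contDiff_const.sub (contDiff_norm_sq_sub y))).contDiffAt
  have hh2 : ∀ x ∈ A, ContDiffAt ℝ 2 h x := fun x hx =>
    (contDiffAt_const.mul (hb x (hDS (hAD x hx)) hx.1.2).1).add (hsm x)
  obtain ⟨x, hx, hxmin⟩ := hAcomp.exists_isMinOn ⟨x₀, hx₀A⟩ (f := fun x => z x + h x)
    (fun w hw => (((hz.continuousAt (hAD w hw))).add (hh2 w hw).continuousAt).continuousWithinAt)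
  have hxx₀ : z x + h x ≤ z x₀ + h x₀ := hxmin hx₀A
  have hb₀ := hb x₀ (hDS hx₀) (hy.le.trans hδr)
  have hval : z x + h x ≤ -(m / 4) := by
    have h1 := hb₀.2.2.2.2 hy
    have h2 : h x₀ ≤ m * (1 / 2) + κ * r ^ 2 := by
      simp only [hh]
      have := mul_le_mul_of_nonneg_left h1 hmpos.le
      have h3 : 0 ≤ κ * ‖x₀ - y‖ ^ 2 := by positivity
      linarith
    linarith
  have hxD := hAD x hx
  obtain ⟨hb2, hbl, hbnn, hb1, -⟩ := hb x (hDS hxD) hx.1.2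
  have hdx : ‖x - y‖ ≤ r := by simpa [dist_eq_norm] using hx.1.2
  have hsq : 0 ≤ κ * (r ^ 2 - ‖x - y‖ ^ 2) := by
    refine mul_nonneg hκpos.le ?_
    have := pow_le_pow_left₀ (norm_nonneg _) hdx 2
    linarith
  have hzx : z x ≤ -(m / 4) := by
    have : 0 ≤ h x := add_nonneg (mul_nonneg hmpos.le hbnn) hsq
    linarith
  have hzm : -m ≤ z x := by have := hmin x hxD; linarith
  have hdx' : dist x y < r := by
    refine lt_of_le_of_ne hx.1.2 fun he => ?_
    have h1 := mul_le_mul_of_nonneg_left (hb1 he) hmpos.le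
    have : m ≤ h x := by simp only [hh]; linarith
    linarith
  have hloc : IsLocalMin (fun w => z w - (-1 * h w)) x := by
    have hev : ∀ᶠ w in 𝓝 x, w ∈ A := by
      filter_upwards [hDo.mem_nhds hxD, isOpen_ball.mem_nhds (mem_ball.2 hdx'),
        (hz.continuousAt hxD).eventually (gt_mem_nhds (show z x < -(m / 8) by linarith))]
        with w h1 h2 h3
      exact ⟨⟨subset_closure h1, ball_subset_closedBall h2⟩, h3.le⟩
    filter_upwards [hev] with w hw
    have : z x + h x ≤ z w + h w := hxmin hw
    linarith
  have h1 := (hz x hxD).2 (fun w => -1 * h w) (contDiffAt_const.mul (hh2 x hx)) hloc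
  have hl : lapl h x = m * lapl b x - (M + 1) * m := by
    have hs2 : ContDiffAt ℝ 2 (fun x : Euc N => r ^ 2 - ‖x - y‖ ^ 2) x :=
      (contDiff_const.sub (contDiff_norm_sq_sub y)).contDiffAt
    have h0 : lapl (fun _ : Euc N => r ^ 2) x = 0 := by simp [lapl]
    rw [hh, lapl_add (contDiffAt_const.mul hb2) (hsm x), lapl_const_mul _ hb2,
      lapl_const_mul _ hs2, lapl_sub contDiffAt_const (contDiff_norm_sq_sub y).contDiffAt,
      lapl_norm_sq, h0, hκ]
    field_simp
    ring
  rw [lapl_const_mul _ (hh2 x hx), hl] at h1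
  have h2 : c x * -z x ≤ M * m := by
    refine (mul_le_mul_of_nonneg_right (hcM x hxD) (by linarith)).trans ?_
    exact mul_le_mul_of_nonneg_left (by linarith) hM
  have h3 := mul_nonpos_of_nonneg_of_nonpos hmpos.le hbl
  linarith

lemma hasFDerivAt_inner_sub (y n x : Euc N) :
    HasFDerivAt (fun x => ⟪n, x - y⟫) (innerSL ℝ n) x :=
  (innerSL ℝ n).hasFDerivAt.comp x ((hasFDerivAt_id x).sub_const y)

lemma contDiff_inner_sub (y n : Euc N) {k : WithTop ℕ∞} :
    ContDiff ℝ k (fun x : Euc N => ⟪n, x - y⟫) :=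
  contDiff_const.inner ℝ (contDiff_id.sub contDiff_const)

lemma lapl_inner_sub (y n x : Euc N) : lapl (fun x => ⟪n, x - y⟫) x = 0 := by
  rw [lapl_of_hasFDerivAt (x := x) (Eventually.of_forall (hasFDerivAt_inner_sub y n))
    (L := fun i => 0) (fun i => hasFDerivAt_const _ _)]
  simp

lemma lapl_inner_sub_sq (y n x : Euc N) (hn : ‖n‖ = 1) :
    lapl (fun x => ⟪n, x - y⟫ ^ 2) x = 2 := by
  have h1 : ∀ x, HasFDerivAt (fun x => ⟪n, x - y⟫ ^ 2) ((2 * ⟪n, x - y⟫) • innerSL ℝ n) x := by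
    intro x
    have := (hasFDerivAt_inner_sub y n x).pow 2
    refine this.congr_fderiv ?_
    ext v; simp
  rw [lapl_of_hasFDerivAt (x := x) (Eventually.of_forall h1)
    (L := fun i => (2 * n i) • innerSL ℝ n)]
  · have : ∑ i, n i ^ 2 = 1 := by rw [← EuclideanSpace.real_norm_sq_eq, hn, one_pow]
    have h2 : ∀ i, ((2 * n i) • innerSL ℝ n) (EuclideanSpace.single i (1 : ℝ)) =
        2 * n i ^ 2 := fun i => by
      simp [EuclideanSpace.inner_single_right]; ring
    rw [Finset.sum_congr rfl fun i _ => h2 i, ← Finset.mul_sum, this, mul_one]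
  · intro i
    refine (((hasFDerivAt_inner_sub y n x).const_mul (2 * n i)).congr_of_eventuallyEq
      (Eventually.of_forall fun w => ?_))
    simp [EuclideanSpace.inner_single_right]; ring

/-- Open convex sets admit barriers. -/
lemma hasBarrier_of_convex {S : Set (Euc N)} (hS : Convex ℝ S) (ho : IsOpen S) {r : ℝ}
    (hr : 0 < r) : HasBarrier S r (r / (2 * N + 2)) := by
  intro y hy
  obtain ⟨f, hf⟩ := geometric_hahn_banach_open_point hS ho hy
  rcases S.eq_empty_or_nonempty with he | ⟨x₁, hx₁⟩
  · exact ⟨0, by simp [he]⟩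
  set a := (InnerProductSpace.toDual ℝ (Euc N)).symm f with ha
  have hfa : ∀ x, f x = ⟪a, x⟫ := fun x => by rw [ha, InnerProductSpace.toDual_symm_apply]
  have ha0 : a ≠ 0 := fun h0 => by
    have := hf x₁ hx₁
    simp [hfa, h0] at this
  set n : Euc N := (-‖a‖⁻¹) • a with hn
  have hapos : 0 < ‖a‖ := norm_pos_iff.2 ha0
  have hn1 : ‖n‖ = 1 := by
    rw [hn, norm_smul, norm_neg, norm_inv, norm_norm, inv_mul_cancel₀ hapos.ne']
  have hs : ∀ x ∈ S, 0 ≤ ⟪n, x - y⟫ := fun x hx => by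
    have := hf x hx
    rw [hfa, hfa] at this
    rw [hn, inner_smul_left, inner_sub_right]
    simp only [map_neg, map_inv₀, conj_trivial, neg_mul, neg_nonneg]
    exact mul_nonpos_of_nonneg_of_nonpos (by positivity) (by linarith)
  have hN0 : (0 : ℝ) ≤ N := Nat.cast_nonneg N
  refine ⟨fun x => (r ^ 2)⁻¹ * (‖x - y‖ ^ 2 - N * ⟪n, x - y⟫ ^ 2) + N / r * ⟪n, x - y⟫,
    fun x hx hxr => ?_⟩
  have c1 := (contDiff_norm_sq_sub (N := N) y (n := 2)).contDiffAt (x := x)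
  have c2 := ((contDiff_inner_sub y n (k := 2)).pow 2).contDiffAt (x := x)
  have c3 := (contDiff_inner_sub y n (k := 2)).contDiffAt (x := x)
  have c4 : ContDiffAt ℝ 2 (fun x => ‖x - y‖ ^ 2 - N * ⟪n, x - y⟫ ^ 2) x :=
    c1.sub (contDiffAt_const.mul c2)
  have hsx := hs x hx
  have hsd : ⟪n, x - y⟫ ≤ dist x y := by
    have := real_inner_le_norm n (x - y)
    rwa [hn1, one_mul, ← dist_eq_norm] at this
  have hkey : dist x y ^ 2 / r ^ 2 ≤ (r ^ 2)⁻¹ * (‖x - y‖ ^ 2 - N * ⟪n, x - y⟫ ^ 2) +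
      N / r * ⟪n, x - y⟫ := by
    have e : (r ^ 2)⁻¹ * (‖x - y‖ ^ 2 - N * ⟪n, x - y⟫ ^ 2) + N / r * ⟪n, x - y⟫ =
        dist x y ^ 2 / r ^ 2 + N * ⟪n, x - y⟫ * (r - ⟪n, x - y⟫) / r ^ 2 := by
      rw [dist_eq_norm]; field_simp; ring
    rw [e, le_add_iff_nonneg_right]
    exact div_nonneg (mul_nonneg (mul_nonneg hN0 hsx) (by linarith)) (by positivity)
  refine ⟨(contDiffAt_const.mul c4).add (contDiffAt_const.mul c3), ?_, ?_, ?_, ?_⟩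
  · rw [lapl_add (contDiffAt_const.mul c4) (contDiffAt_const.mul c3), lapl_const_mul _ c4,
      lapl_const_mul _ c3, lapl_sub c1 (contDiffAt_const.mul c2), lapl_const_mul _ c2,
      lapl_norm_sq, lapl_inner_sub, lapl_inner_sub_sq _ _ _ hn1]
    apply le_of_eq; ring
  · exact le_trans (by positivity) hkey
  · intro he
    rw [he, div_self (by positivity)] at hkey
    exact hkey
  · intro hd
    have h1 : (r ^ 2)⁻¹ * (‖x - y‖ ^ 2 - N * ⟪n, x - y⟫ ^ 2) + N / r * ⟪n, x - y⟫ ≤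
        dist x y ^ 2 / r ^ 2 + N * (dist x y / r) := by
      have e : dist x y ^ 2 / r ^ 2 + N * (dist x y / r) -
        ((r ^ 2)⁻¹ * (‖x - y‖ ^ 2 - N * ⟪n, x - y⟫ ^ 2) + N / r * ⟪n, x - y⟫) =
        N * ((⟪n, x - y⟫ / r) ^ 2 + (dist x y - ⟪n, x - y⟫) / r) := by
        rw [dist_eq_norm]; field_simp; ring
      have : 0 ≤ N * ((⟪n, x - y⟫ / r) ^ 2 + (dist x y - ⟪n, x - y⟫) / r) :=
        mul_nonneg hN0 (add_nonneg (sq_nonneg _) (div_nonneg (by linarith) hr.le))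
      linarith
    set q := dist x y / r with hq
    have hq0 : 0 ≤ q := by positivity
    have hq1 : q * (2 * N + 2) ≤ 1 := by
      rw [hq, div_mul_eq_mul_div, div_le_one hr]
      rw [lt_div_iff₀ (by positivity)] at hd
      exact hd.le
    rw [← div_pow] at h1
    refine h1.trans ?_
    nlinarith

lemma laplacian_comp_linearIsometryEquiv (ι : Euc 2 ≃ₗᵢ[ℝ] ℂ) (f : ℂ → ℝ) (x : Euc 2) :
    Laplacian.laplacian (f ∘ ι) x = Laplacian.laplacian f (ι x) := by
  rw [InnerProductSpace.laplacian_eq_iteratedFDeriv_orthonormalBasis (f ∘ ι)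
    (Complex.orthonormalBasisOneI.map ι.symm),
    InnerProductSpace.laplacian_eq_iteratedFDeriv_orthonormalBasis f Complex.orthonormalBasisOneI]
  refine Finset.sum_congr rfl fun i _ => ?_
  have h := ι.toContinuousLinearEquiv.iteratedFDerivWithin_comp_right f uniqueDiffOn_univ
    (mem_univ (ι.toContinuousLinearEquiv x)) 2
  rw [preimage_univ, iteratedFDerivWithin_univ, iteratedFDerivWithin_univ] at h
  change iteratedFDeriv ℝ 2 (f ∘ ι.toContinuousLinearEquiv) x _ = _
  rw [h, ContinuousMultilinearMap.compContinuousLinearMap_apply]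
  change iteratedFDeriv ℝ 2 f (ι x) _ = _
  congr 1
  ext j
  fin_cases j <;> simp

/-- Planar sets whose exterior points see a ray in the complement admit barriers. -/
lemma hasBarrier_of_ray {S : Set (Euc 2)}
    (hS : ∀ y ∉ S, ∃ u : Euc 2, ‖u‖ = 1 ∧ ∀ t : ℝ, 0 ≤ t → y + t • u ∉ S) {r : ℝ}
    (hr : 0 < r) : HasBarrier S r (r / 64) := by
  intro y hy
  obtain ⟨u, hu, hray⟩ := hS y hy
  set ι : Euc 2 ≃ₗᵢ[ℝ] ℂ := Complex.orthonormalBasisOneI.repr.symm with hι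
  set κ : ℂ := -(starRingEnd ℂ) (ι u) with hκ
  have hιu : ‖ι u‖ = 1 := by rw [ι.norm_map, hu]
  have hκ1 : ‖κ‖ = 1 := by rw [hκ, norm_neg, RCLike.norm_conj, hιu]
  set K : ℝ := Real.sqrt 2 / r ^ (1 / 4 : ℝ) with hK
  have hrp : 0 < r ^ (1 / 4 : ℝ) := Real.rpow_pos_of_pos hr _
  have hKpos : 0 < K := by positivity
  set G : ℂ → ℂ := fun w => (κ * (w - ι y)) ^ ((1 / 4 : ℝ) : ℂ) with hG
  have hslit : ∀ x ∈ S, κ * (ι x - ι y) ∈ Complex.slitPlane := by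
    intro x hx
    rw [Complex.mem_slitPlane_iff]
    by_contra! hcon
    obtain ⟨h1, h2⟩ := hcon
    set t : ℝ := -(κ * (ι x - ι y)).re with ht
    have h3 : κ * (ι x - ι y) = -(t : ℂ) := by
      apply Complex.ext
      · simp [ht]
      · simpa using h2
    have h4 : ι u * (starRingEnd ℂ) (ι u) = 1 := by
      rw [Complex.mul_conj, Complex.normSq_eq_norm_sq, hιu]; simp
    have h5 : ι x = ι y + t * ι u := by
      have : ι u * (κ * (ι x - ι y)) = -(t : ℂ) * ι u := by rw [h3]; ring
      rw [hκ] at this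
      linear_combination (-(ι x - ι y)) * h4 - this
    refine hray t (by linarith) ?_
    have : y + t • u = x := by
      apply ι.injective
      rw [map_add, map_smul, h5]; simp
    rwa [this]
  refine ⟨fun x => K * (G (ι x)).re, fun x hx hxr => ?_⟩
  have hw := hslit x hx
  have hnorm : ‖κ * (ι x - ι y)‖ = dist x y := by
    rw [norm_mul, hκ1, one_mul, ← map_sub, ι.norm_map, dist_eq_norm]
  have hre : (G (ι x)).re = dist x y ^ (1 / 4 : ℝ) *
      Real.cos (Complex.arg (κ * (ι x - ι y)) * (1 / 4)) := by
    simp only [hG]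
    rw [Complex.cpow_ofReal_re, hnorm]
  have hcos : Real.sqrt 2 / 2 ≤ Real.cos (Complex.arg (κ * (ι x - ι y)) * (1 / 4)) := by
    rw [← Real.cos_pi_div_four, ← Real.cos_abs (Complex.arg (κ * (ι x - ι y)) * (1 / 4))]
    have h1 := Complex.abs_arg_le_pi (κ * (ι x - ι y))
    refine Real.cos_le_cos_of_nonneg_of_le_pi (abs_nonneg _) (by linarith [Real.pi_pos]) ?_
    rw [abs_mul, abs_of_pos (show (0 : ℝ) < 1 / 4 by norm_num)]
    linarith
  have hdnn : 0 ≤ dist x y ^ (1 / 4 : ℝ) := Real.rpow_nonneg dist_nonneg _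
  have hs2 : Real.sqrt 2 * Real.sqrt 2 = 2 := Real.mul_self_sqrt (by norm_num)
  have hs2pos : 0 < Real.sqrt 2 := by positivity
  have hGa : AnalyticAt ℂ G (ι x) := by
    have h1 : AnalyticAt ℂ (fun w : ℂ => κ * (w - ι y)) (ι x) := by fun_prop
    exact h1.cpow analyticAt_const hw
  have hharm : InnerProductSpace.HarmonicAt (fun w => (G w).re) (ι x) := hGa.harmonicAt_re
  have hc2 : ContDiffAt ℝ 2 (fun x => (G (ι x)).re) x :=
    hharm.1.comp x ι.contDiff.contDiffAt
  have hl : lapl (fun x => (G (ι x)).re) x = 0 := by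
    rw [lapl_eq_laplacian hc2]
    change Laplacian.laplacian ((fun w => (G w).re) ∘ ι) x = 0
    rw [laplacian_comp_linearIsometryEquiv]
    exact hharm.2.self_of_nhds
  refine ⟨contDiffAt_const.mul hc2, ?_, ?_, ?_, ?_⟩
  · rw [lapl_const_mul _ hc2, hl, mul_zero]
  · beta_reduce
    rw [hre]
    have : 0 ≤ Real.cos (Complex.arg (κ * (ι x - ι y)) * (1 / 4)) :=
      le_trans (by positivity) hcos
    positivity
  · intro he
    beta_reduce
    rw [hre, he, hK]
    have : Real.sqrt 2 / r ^ (1 / 4 : ℝ) * (r ^ (1 / 4 : ℝ) *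
      Real.cos (Complex.arg (κ * (ι x - ι y)) * (1 / 4))) =
      Real.sqrt 2 * Real.cos (Complex.arg (κ * (ι x - ι y)) * (1 / 4)) := by field_simp
    rw [this]
    nlinarith
  · intro hd
    have h64 : (64 : ℝ) ^ (1 / 4 : ℝ) = 2 * Real.sqrt 2 := by
      have : (64 : ℝ) = (2 * Real.sqrt 2) ^ (4 : ℝ) := by
        rw [show (4 : ℝ) = ((4 : ℕ) : ℝ) by norm_num, Real.rpow_natCast]
        calc (64 : ℝ) = 16 * (Real.sqrt 2 * Real.sqrt 2) ^ 2 := by rw [hs2]; norm_num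
          _ = _ := by ring
      rw [this, ← Real.rpow_mul (by positivity)]; norm_num
    have h1 : dist x y ^ (1 / 4 : ℝ) ≤ (r / 64) ^ (1 / 4 : ℝ) :=
      Real.rpow_le_rpow dist_nonneg hd.le (by norm_num)
    rw [Real.div_rpow hr.le (by norm_num), h64] at h1
    beta_reduce
    rw [hre]
    calc K * (dist x y ^ (1 / 4 : ℝ) * Real.cos (Complex.arg (κ * (ι x - ι y)) * (1 / 4)))
        ≤ K * (r ^ (1 / 4 : ℝ) / (2 * Real.sqrt 2) * 1) := by
          gcongr
          · exact le_trans (by positivity) hcos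
          · exact Real.cos_le_one _
      _ = 1 / 2 := by rw [hK]; field_simp

end SmallDistance

section MovingPlanes

variable {N : ℕ}

/-- The part of `Ω` below the hyperplane `⟪x, e⟫ = t`. -/
def cap (Ω : Set (Euc N)) (e : Euc N) (t : ℝ) : Set (Euc N) := {x | x ∈ Ω ∧ ⟪x, e⟫ < t}

/-- A bounded domain which is Steiner symmetric in the direction `e`, whose caps admit uniform
local barriers, and which satisfies the interior ball condition. -/
structure SymDomain (Ω : Set (Euc N)) (e : Euc N) : Prop where
  isOpen : IsOpen Ω
  isBounded : Bornology.IsBounded Ω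
  isConnected : IsConnected Ω
  norm_eq : ‖e‖ = 1
  steiner : ∀ x ∈ Ω, ∀ s : ℝ, |⟪x, e⟫ + s| ≤ |⟪x, e⟫| → x + s • e ∈ Ω
  barrier : ∀ r > 0, ∃ δ > 0, δ ≤ r ∧ ∀ t ≤ 0, HasBarrier (cap Ω e t) r δ
  interior_ball : ∀ b ∈ frontier Ω, ∃ x₀ R, 0 < R ∧ ball x₀ R ⊆ Ω ∧ ‖b - x₀‖ = R

/-- A solution of `-Δψ = g` with zero boundary values, where `g` is a convex function of `ψ`
with derivative `c`. -/
structure PosSol (Ω : Set (Euc N)) (ψ c g : Euc N → ℝ) : Prop where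
  contDiff : ContDiff ℝ 2 ψ
  eq : ∀ x ∈ Ω, -lapl ψ x = g x
  g_nonneg : ∀ x, 0 ≤ g x
  g_ne : ∃ x ∈ Ω, g x ≠ 0
  conv : ∀ x y, c x * (ψ y - ψ x) ≤ g y - g x
  c_cont : Continuous c
  c_nonneg : ∀ x, 0 ≤ c x
  zero : ∀ x ∈ frontier Ω, ψ x = 0

variable {Ω : Set (Euc N)} {e : Euc N} {ψ c g : Euc N → ℝ}

lemma mem_or_mem_frontier (hΩ : IsOpen Ω) {x : Euc N} (hx : x ∈ closure Ω) :
    x ∈ Ω ∨ x ∈ frontier Ω := by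
  rw [hΩ.frontier_eq]
  by_cases h : x ∈ Ω
  · exact Or.inl h
  · exact Or.inr ⟨hx, h⟩

lemma SymDomain.frontier_nonempty (hΩ : SymDomain Ω e) : (frontier Ω).Nonempty := by
  refine nonempty_frontier_iff.2 ⟨hΩ.isConnected.nonempty, fun h => ?_⟩
  have he : e ≠ 0 := fun h0 => by simpa [h0] using hΩ.norm_eq
  have : Nontrivial (Euc N) := ⟨⟨e, 0, he⟩⟩
  have hb := hΩ.isBounded
  rw [h] at hb
  exact NormedSpace.unbounded_univ ℝ (Euc N) hb

lemma PosSol.nonneg (hψ : PosSol Ω ψ c g) (hΩ : SymDomain Ω e) : ∀ x ∈ closure Ω, 0 ≤ ψ x := by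
  obtain ⟨x₀, hx₀, hmin⟩ := hΩ.isBounded.isCompact_closure.exists_isMinOn
    hΩ.isConnected.nonempty.closure hψ.contDiff.continuous.continuousOn
  suffices h : 0 ≤ ψ x₀ from fun x hx => h.trans (hmin hx)
  by_contra! hneg
  rcases mem_or_mem_frontier hΩ.isOpen hx₀ with hx | hx
  · have hsup : VSup Ω 0 (fun x => ψ x - ψ x₀) := by
      refine VSup.of_lapl_le (fun x _ => (hψ.contDiff.sub contDiff_const).contDiffAt)
        fun x hxΩ => ?_
      have h1 := hψ.eq x hxΩ
      have h2 := hψ.g_nonneg x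
      have h3 := lapl_sub (hψ.contDiff.contDiffAt (x := x))
        (contDiffAt_const (n := 2) (c := ψ x₀) (x := x))
      have h4 : lapl (fun _ : Euc N => ψ x₀) x = 0 := by simp [lapl]
      simp only [Pi.zero_apply, neg_zero, zero_mul]
      linarith
    have hz := hsup.eq_zero_of_isPreconnected hΩ.isOpen (fun _ _ => le_rfl)
      (fun x hx => sub_nonneg.2 (hmin (subset_closure hx))) hΩ.isConnected.isPreconnected
      Subset.rfl hx (sub_self _)
    obtain ⟨b, hb⟩ := hΩ.frontier_nonempty
    have hcl : IsClosed {x | ψ x = ψ x₀} := isClosed_eq hψ.contDiff.continuous continuous_const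
    have : ψ b = ψ x₀ := (closure_minimal (fun x hx => sub_eq_zero.1 (hz x hx)) hcl)
      (frontier_subset_closure hb)
    rw [hψ.zero b hb] at this
    exact hneg.ne this.symm
  · exact hneg.ne (hψ.zero _ hx)

lemma PosSol.pos (hψ : PosSol Ω ψ c g) (hΩ : SymDomain Ω e) : ∀ x ∈ Ω, 0 < ψ x := by
  intro x hx
  refine (hψ.nonneg hΩ x (subset_closure hx)).lt_of_ne' fun h => ?_
  have hsup : VSup Ω 0 ψ := VSup.of_lapl_le (fun x _ => hψ.contDiff.contDiffAt) fun x hxΩ => by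
    have h1 := hψ.eq x hxΩ
    have h2 := hψ.g_nonneg x
    simp only [Pi.zero_apply, neg_zero, zero_mul]
    linarith
  have hz := hsup.eq_zero_of_isPreconnected hΩ.isOpen (fun _ _ => le_rfl)
    (fun x hx => hψ.nonneg hΩ x (subset_closure hx)) hΩ.isConnected.isPreconnected
    Subset.rfl hx h
  obtain ⟨y, hy, hgy⟩ := hψ.g_ne
  refine hgy ?_
  rw [← hψ.eq y hy, lapl_congr (g := fun _ => (0 : ℝ))
    (Filter.mem_of_superset (hΩ.isOpen.mem_nhds hy) hz)]
  simp [lapl]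

lemma continuous_inner_right (e : Euc N) : Continuous fun x : Euc N => ⟪x, e⟫ :=
  continuous_id.inner continuous_const

lemma isOpen_cap (hΩ : IsOpen Ω) (t : ℝ) : IsOpen (cap Ω e t) :=
  hΩ.inter (isOpen_lt (continuous_inner_right e) continuous_const)

lemma cap_subset (t : ℝ) : cap Ω e t ⊆ Ω := fun _ hx => hx.1

/-- A negative minimum on a subset of a cap is attained at a uniform distance from the
complement of the cap. -/
lemma SymDomain.exists_ball_subset (hΩ : SymDomain Ω e) (hc : Continuous c) (hc0 : ∀ x, 0 ≤ c x) :
    ∃ δ > 0, ∀ t ≤ 0, ∀ D ⊆ cap Ω e t, IsOpen D → ∀ z, VSup D c z → ContinuousOn z (closure D) →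
      (∀ x ∈ closure D, x ∉ D → 0 ≤ z x) → (∃ x ∈ D, z x < 0) →
      ∃ x₀ ∈ D, z x₀ < 0 ∧ (∀ y ∈ D, z x₀ ≤ z y) ∧ ball x₀ δ ⊆ cap Ω e t := by
  obtain ⟨M, hM⟩ := hΩ.isBounded.isCompact_closure.exists_bound_of_continuousOn hc.continuousOn
  have hM0 : 0 ≤ M := (norm_nonneg _).trans (hM _ (subset_closure hΩ.isConnected.nonempty.some_mem))
  have hN : 0 < N := by
    rcases Nat.eq_zero_or_pos N with rfl | h
    · have : e = 0 := Subsingleton.elim _ _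
      simpa [this] using hΩ.norm_eq
    · exact h
  obtain ⟨δ, hδ, hδr, hB⟩ := hΩ.barrier (1 / (2 * (M + 1))) (by positivity)
  refine ⟨δ, hδ, fun t ht D hD hDo z hz hcont hbd hneg => ?_⟩
  have hDb : Bornology.IsBounded D := hΩ.isBounded.subset (hD.trans (cap_subset t))
  obtain ⟨x₁, hx₁, hx₁n⟩ := hneg
  obtain ⟨x₀, hx₀, hmin⟩ := hDb.isCompact_closure.exists_isMinOn ⟨x₁, subset_closure hx₁⟩ hcont
  have hz0 : z x₀ < 0 := (hmin (subset_closure hx₁)).trans_lt hx₁n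
  have hx₀D : x₀ ∈ D := by
    by_contra h
    exact absurd (hbd x₀ hx₀ h) (not_le.2 hz0)
  refine ⟨x₀, hx₀D, hz0, fun y hy => hmin (subset_closure hy), ?_⟩
  refine hz.ball_subset_of_isMin hδr hM0 (fun x hx => (le_abs_self _).trans
    (hM x (subset_closure (cap_subset t (hD hx))))) ?_ hN (hB t ht) hD hDo hDb hcont hbd hx₀D hz0
    fun y hy => hmin (subset_closure hy)
  have h1 : (1 : ℝ) ≤ N := by exact_mod_cast hN
  refine le_trans ?_ h1
  have : 2 * ((M + 1) * (1 / (2 * (M + 1))) ^ 2) = 1 / (2 * (M + 1)) := by field_simp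
  rw [this, div_le_one (by positivity)]
  linarith

end MovingPlanes

section MovingPlanesMonotone

variable {N : ℕ} {Ω : Set (Euc N)} {e : Euc N} {ψ c g : Euc N → ℝ}

/-- Following the ray `x - s • e`, one leaves a bounded open set through its boundary. -/
lemma exists_exit (hΩ : IsOpen Ω) (hb : Bornology.IsBounded Ω) (he : ‖e‖ = 1) {x : Euc N}
    (hx : x ∈ Ω) : ∃ s₀ : ℝ, 0 < s₀ ∧ x - s₀ • e ∈ frontier Ω ∧
      ∀ s ∈ Ico (0 : ℝ) s₀, x - s • e ∈ Ω := by
  set T : Set ℝ := {s | 0 ≤ s ∧ x - s • e ∉ Ω} with hT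
  have hcl : IsClosed T := isClosed_Ici.inter (hΩ.isClosed_compl.preimage
    (f := fun s : ℝ => x - s • e) (by fun_prop))
  have hne : T.Nonempty := by
    obtain ⟨M, hM⟩ := hb.subset_closedBall x
    refine ⟨|M| + 1, by positivity, fun h => ?_⟩
    have := hM h
    rw [mem_closedBall, dist_eq_norm, sub_sub_cancel_left, norm_neg, norm_smul, he, mul_one,
      Real.norm_of_nonneg (by positivity)] at this
    linarith [le_abs_self M]
  have hbd : BddBelow T := ⟨0, fun s hs => hs.1⟩
  have hmem := hcl.csInf_mem hne hbd
  have hlt : ∀ s ∈ Ico 0 (sInf T), x - s • e ∈ Ω := fun s hs => by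
    by_contra h
    exact absurd (csInf_le hbd ⟨hs.1, h⟩) (not_le.2 hs.2)
  have hpos : 0 < sInf T := hmem.1.lt_of_ne fun h => by
    have := hmem.2
    rw [← h] at this
    simp [hx] at this
  refine ⟨sInf T, hpos, ?_, hlt⟩
  rw [hΩ.frontier_eq]
  refine ⟨?_, hmem.2⟩
  have hc : ContinuousWithinAt (fun s : ℝ => x - s • e) (Ico 0 (sInf T)) (sInf T) := by fun_prop
  refine hc.mem_closure (by rw [closure_Ico hpos.ne]; exact right_mem_Icc.2 hpos.le) hlt

/-- Reflection across the hyperplane `⟪x, e⟫ = t`. -/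
def planeRefl (e : Euc N) (t : ℝ) (x : Euc N) : Euc N := x + (2 * (t - ⟪x, e⟫)) • e

lemma inner_add_smul_self (he : ‖e‖ = 1) (x : Euc N) (s : ℝ) : ⟪x + s • e, e⟫ = ⟪x, e⟫ + s := by
  rw [inner_add_left, real_inner_smul_left, real_inner_self_eq_norm_sq, he]
  ring

lemma inner_planeRefl (he : ‖e‖ = 1) (t : ℝ) (x : Euc N) :
    ⟪planeRefl e t x, e⟫ = 2 * t - ⟪x, e⟫ := by
  rw [planeRefl, inner_add_smul_self he]
  ring

lemma continuous_planeRefl (t : ℝ) : Continuous (planeRefl e t) := by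
  unfold planeRefl
  have := continuous_inner_right e
  fun_prop

lemma planeRefl_eq (he : ‖e‖ = 1) (t : ℝ) (x : Euc N) :
    planeRefl e t x = (ℝ ∙ e)ᗮ.reflection x + (2 * t) • e := by
  rw [Submodule.reflection_orthogonal_apply, Submodule.reflection_singleton_apply, he,
    real_inner_comm, planeRefl]
  simp only [RCLike.ofReal_real_eq_id, id]
  module

lemma lapl_comp_planeRefl (he : ‖e‖ = 1) {f : Euc N → ℝ} (hf : ContDiff ℝ 2 f) (t : ℝ)
    (x : Euc N) : lapl (fun y => f (planeRefl e t y)) x = lapl f (planeRefl e t x) := by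
  simp only [planeRefl_eq he]
  exact lapl_comp_isometry _ _ _ hf.contDiffAt

lemma contDiff_planeRefl (t : ℝ) : ContDiff ℝ 2 (planeRefl e t) := by
  unfold planeRefl
  exact contDiff_id.add ((contDiff_const.mul
    (contDiff_const.sub (contDiff_id.inner ℝ contDiff_const))).smul contDiff_const)

lemma planeRefl_planeRefl (he : ‖e‖ = 1) (t : ℝ) (x : Euc N) :
    planeRefl e t (planeRefl e t x) = x := by
  rw [planeRefl, inner_planeRefl he, planeRefl]
  module

lemma SymDomain.planeRefl_mem (hΩ : SymDomain Ω e) {t : ℝ} (ht : t ≤ 0) {x : Euc N}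
    (hx : x ∈ cap Ω e t) : planeRefl e t x ∈ Ω := by
  have h := hx.2
  refine hΩ.steiner x hx.1 _ ?_
  rw [abs_of_neg (h.trans_le ht), abs_le]
  constructor <;> linarith

lemma SymDomain.planeRefl_mem_closure (hΩ : SymDomain Ω e) {t : ℝ} (ht : t ≤ 0) {x : Euc N}
    (hx : x ∈ closure (cap Ω e t)) : planeRefl e t x ∈ closure Ω :=
  map_mem_closure (continuous_planeRefl t) hx fun _ h => hΩ.planeRefl_mem ht h

lemma inner_le_of_mem_closure_cap {t : ℝ} {x : Euc N} (hx : x ∈ closure (cap Ω e t)) :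
    ⟪x, e⟫ ≤ t :=
  closure_minimal (fun y (hy : y ∈ cap Ω e t) => hy.2.le)
    (isClosed_le (continuous_inner_right e) continuous_const) hx

lemma PosSol.vsup_planeRefl (hψ : PosSol Ω ψ c g) (hΩ : SymDomain Ω e) {t : ℝ} (ht : t ≤ 0) :
    VSup (cap Ω e t) c (fun x => ψ (planeRefl e t x) - ψ x) := by
  have hcomp : ContDiff ℝ 2 fun x => ψ (planeRefl e t x) := hψ.contDiff.comp (contDiff_planeRefl t)
  refine VSup.of_lapl_le (fun x _ => (hcomp.sub hψ.contDiff).contDiffAt) fun x hx => ?_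
  rw [lapl_sub hcomp.contDiffAt hψ.contDiff.contDiffAt,
    lapl_comp_planeRefl hΩ.norm_eq hψ.contDiff]
  have h1 := hψ.eq _ (hΩ.planeRefl_mem ht hx)
  have h2 := hψ.eq _ hx.1
  have h3 := hψ.conv x (planeRefl e t x)
  linarith

lemma PosSol.planeRefl_nonneg_of_not_mem (hψ : PosSol Ω ψ c g) (hΩ : SymDomain Ω e) {t : ℝ}
    (ht : t ≤ 0) {x : Euc N} (hx : x ∈ closure (cap Ω e t)) (hx' : x ∉ cap Ω e t) :
    0 ≤ ψ (planeRefl e t x) - ψ x := by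
  rcases mem_or_mem_frontier hΩ.isOpen (closure_mono (cap_subset t) hx) with h | h
  · have : ⟪x, e⟫ = t := (inner_le_of_mem_closure_cap hx).antisymm
      (not_lt.1 fun h' => hx' ⟨h, h'⟩)
    simp [planeRefl, this]
  · rw [hψ.zero x h, sub_zero]
    exact hψ.nonneg hΩ _ (hΩ.planeRefl_mem_closure ht hx)

lemma isPreconnected_exit_segment (x : Euc N) (s₀ : ℝ) :
    IsPreconnected ((fun s : ℝ => x - s • e) '' Ico 0 s₀) :=
  isPreconnected_Ico.image _ (by fun_prop)

lemma PosSol.planeRefl_pos (hψ : PosSol Ω ψ c g) (hΩ : SymDomain Ω e) {t : ℝ} (ht : t < 0)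
    (hnn : ∀ x ∈ cap Ω e t, 0 ≤ ψ (planeRefl e t x) - ψ x) :
    ∀ x ∈ cap Ω e t, 0 < ψ (planeRefl e t x) - ψ x := by
  intro x hx
  refine (hnn x hx).lt_of_ne' fun h0 => ?_
  obtain ⟨s₀, hs₀, hb, hseg⟩ := exists_exit hΩ.isOpen hΩ.isBounded hΩ.norm_eq hx.1
  have hin : ∀ s : ℝ, ⟪x - s • e, e⟫ = ⟪x, e⟫ - s := fun s => by
    have := inner_add_smul_self hΩ.norm_eq x (-s)
    rw [neg_smul, ← sub_eq_add_neg] at this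
    rw [this, sub_eq_add_neg]
  have hsub : (fun s : ℝ => x - s • e) '' Ico 0 s₀ ⊆ cap Ω e t := by
    rintro _ ⟨s, hs, rfl⟩
    refine ⟨hseg s hs, ?_⟩
    have := hx.2
    have := hs.1
    simp only [hin]
    linarith
  have hz := (hψ.vsup_planeRefl hΩ ht.le).eq_zero_of_isPreconnected (isOpen_cap hΩ.isOpen t)
    (fun y _ => hψ.c_nonneg y) hnn (isPreconnected_exit_segment x s₀) hsub
    ⟨0, ⟨le_rfl, hs₀⟩, by simp⟩ h0
  set b := x - s₀ • e with hbdef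
  have hbz : ψ (planeRefl e t b) - ψ b = 0 := by
    have hcl : IsClosed {s : ℝ | ψ (planeRefl e t (x - s • e)) - ψ (x - s • e) = 0} := by
      have h1 := continuous_planeRefl (e := e) t
      have h2 := hψ.contDiff.continuous
      exact isClosed_eq (by fun_prop) continuous_const
    refine closure_minimal (fun s (hs : s ∈ Ico 0 s₀) => hz _ ⟨s, hs, rfl⟩) hcl
      (show s₀ ∈ closure (Ico 0 s₀) from ?_)
    rw [closure_Ico hs₀.ne]
    exact right_mem_Icc.2 hs₀.le
  rw [hψ.zero b hb, sub_zero] at hbz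
  refine (hψ.pos hΩ _ ?_).ne' hbz
  set η : ℝ := min s₀ (-2 * t) with hη
  have hη0 : 0 < η := lt_min hs₀ (by linarith)
  have h1 : η ≤ s₀ := min_le_left _ _
  have h2 : η ≤ -2 * t := min_le_right _ _
  have hy := hseg (s₀ - η) ⟨by linarith, by linarith⟩
  have hxt := hx.2
  have hst := hΩ.steiner _ hy (2 * (t - ⟪b, e⟫) - η) (by
    rw [hbdef, hin, hin, abs_of_neg (a := ⟪x, e⟫ - (s₀ - η)) (by linarith), abs_le]
    constructor <;> linarith)
  convert hst using 1
  rw [planeRefl, hbdef]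
  module

/-- The moving plane inequality. -/
theorem PosSol.planeRefl_nonneg (hψ : PosSol Ω ψ c g) (hΩ : SymDomain Ω e) {t : ℝ} (ht : t ≤ 0) :
    ∀ x ∈ cap Ω e t, 0 ≤ ψ (planeRefl e t x) - ψ x := by
  set T : Set ℝ := {t | t ≤ 0 ∧ ∃ x ∈ cap Ω e t, ψ (planeRefl e t x) - ψ x < 0} with hT
  suffices hTe : T = ∅ by
    intro x hx
    by_contra! h
    exact (hTe ▸ (show t ∈ T from ⟨ht, x, hx, h⟩) : t ∈ (∅ : Set ℝ))
  by_contra hTne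
  replace hTne := nonempty_iff_ne_empty.2 hTne
  have hbdd : BddBelow T := by
    obtain ⟨M, hM⟩ := hΩ.isBounded.subset_closedBall 0
    refine ⟨-M, fun s hs => ?_⟩
    obtain ⟨-, x, hx, -⟩ := hs
    have h1 : ‖x‖ ≤ M := by simpa using hM hx.1
    have h2 := abs_real_inner_le_norm x e
    rw [hΩ.norm_eq, mul_one] at h2
    have := (abs_le.1 h2).1
    linarith [hx.2]
  have hψc := hψ.contDiff.continuous
  have hjoint : Continuous fun q : ℝ × Euc N => ψ (planeRefl e q.1 q.2) - ψ q.2 := by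
    have : Continuous fun q : ℝ × Euc N => planeRefl e q.1 q.2 := by
      unfold planeRefl
      exact continuous_snd.add ((continuous_const.mul
        (continuous_fst.sub (continuous_snd.inner continuous_const))).smul continuous_const)
    fun_prop
  obtain ⟨tn, -, htn, htT⟩ := exists_seq_tendsto_sInf hTne hbdd
  set τ := sInf T with hτ
  have hτ0 : τ ≤ 0 := (csInf_le hbdd hTne.some_mem).trans hTne.some_mem.1
  have hτnn : ∀ x ∈ cap Ω e τ, 0 ≤ ψ (planeRefl e τ x) - ψ x := by
    intro x hx
    have hcl : IsClosed {s : ℝ | 0 ≤ ψ (planeRefl e s x) - ψ x} :=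
      isClosed_le continuous_const (hjoint.comp (by fun_prop : Continuous fun s : ℝ => (s, x)))
    refine closure_minimal (fun s (hs : s ∈ Ioo ⟪x, e⟫ τ) => ?_) hcl
      (show τ ∈ closure (Ioo ⟪x, e⟫ τ) from ?_)
    · by_contra h
      exact absurd (csInf_le hbdd (show s ∈ T from
        ⟨hs.2.le.trans hτ0, x, ⟨hx.1, hs.1⟩, not_le.1 h⟩)) (not_le.2 hs.2)
    · rw [closure_Ioo hx.2.ne]
      exact right_mem_Icc.2 hx.2.le
  have hτT : τ ∉ T := fun h => by
    obtain ⟨-, x, hx, hlt⟩ := h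
    exact absurd (hτnn x hx) (not_le.2 hlt)
  have hτneg : τ < 0 := by
    have h1 := csInf_le hbdd (htT 0)
    exact (h1.lt_of_ne fun h => hτT (by rw [hτ, h]; exact htT 0)).trans_le (htT 0).1
  obtain ⟨δ, hδ, hsmall⟩ := hΩ.exists_ball_subset hψ.c_cont hψ.c_nonneg
  have hex : ∀ n, ∃ x ∈ cap Ω e (tn n), ψ (planeRefl e (tn n) x) - ψ x < 0 ∧
      ball x δ ⊆ cap Ω e (tn n) := fun n => by
    obtain ⟨x, hx, hx1, -, hx2⟩ := hsmall (tn n) (htT n).1 _ Subset.rfl (isOpen_cap hΩ.isOpen _) _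
      (hψ.vsup_planeRefl hΩ (htT n).1)
      (hjoint.comp (by fun_prop : Continuous fun x : Euc N => (tn n, x))).continuousOn
      (fun x => hψ.planeRefl_nonneg_of_not_mem hΩ (htT n).1) (htT n).2
    exact ⟨x, hx, hx1, hx2⟩
  choose xn hxn hxneg hxball using hex
  obtain ⟨x, -, k, hk, hlim⟩ := hΩ.isBounded.isCompact_closure.tendsto_subseq
    fun n => subset_closure (cap_subset _ (hxn n))
  have htk := htn.comp hk.tendsto_atTop
  have hball : ∀ y ∈ ball x δ, y ∈ Ω ∧ ⟪y, e⟫ ≤ τ := fun y hy => by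
    have hev : ∀ᶠ n in atTop, y ∈ cap Ω e (tn (k n)) := by
      have h1 : Tendsto (fun n => dist y (xn (k n))) atTop (𝓝 (dist y x)) :=
        tendsto_const_nhds.dist hlim
      filter_upwards [h1.eventually_lt_const (mem_ball.1 hy)] with n hn
      exact hxball _ (mem_ball.2 hn)
    exact ⟨(hev.exists.choose_spec).1, ge_of_tendsto htk (hev.mono fun n hn => hn.2.le)⟩
  have hxΩ := (hball x (mem_ball_self hδ)).1
  have hxτ : ⟪x, e⟫ < τ := by
    have h := (hball (x + (δ / 2) • e) (by
      rw [mem_ball, dist_eq_norm, add_sub_cancel_left, norm_smul, hΩ.norm_eq, mul_one,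
        Real.norm_of_nonneg (by positivity)]
      linarith)).2
    rw [inner_add_smul_self hΩ.norm_eq] at h
    linarith
  have hpos := hψ.planeRefl_pos hΩ hτneg hτnn x ⟨hxΩ, hxτ⟩
  have hle : ψ (planeRefl e τ x) - ψ x ≤ 0 :=
    le_of_tendsto ((hjoint.tendsto (τ, x)).comp (htk.prodMk_nhds hlim))
      (Eventually.of_forall fun n => (hxneg (k n)).le)
  linarith

lemma PosSol.planeRefl_eq (hψ : PosSol Ω ψ c g) (hΩ : SymDomain Ω e) (hΩ' : SymDomain Ω (-e)) :
    ∀ x ∈ Ω, ψ (planeRefl e 0 x) = ψ x := by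
  have hneg : planeRefl (-e) 0 = planeRefl e 0 := by
    ext1 x
    simp [planeRefl, inner_neg_right]
  have key : ∀ x ∈ Ω, ⟪x, e⟫ < 0 → ψ (planeRefl e 0 x) = ψ x := fun x hx h => by
    have h1 := hψ.planeRefl_nonneg hΩ le_rfl x ⟨hx, h⟩
    have hm := hΩ.planeRefl_mem le_rfl ⟨hx, h⟩
    have h2 := hψ.planeRefl_nonneg hΩ' le_rfl (planeRefl e 0 x) ⟨hm, by
      rw [inner_neg_right, inner_planeRefl hΩ.norm_eq]
      linarith⟩
    rw [hneg, planeRefl_planeRefl hΩ.norm_eq] at h2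
    linarith
  intro x hx
  rcases lt_trichotomy ⟪x, e⟫ 0 with h | h | h
  · exact key x hx h
  · simp [planeRefl, h]
  · have hm := hΩ'.planeRefl_mem le_rfl ⟨hx, by rw [inner_neg_right]; linarith⟩
    rw [hneg] at hm
    have := key _ hm (by rw [inner_planeRefl hΩ.norm_eq]; linarith)
    rw [planeRefl_planeRefl hΩ.norm_eq] at this
    exact this.symm

/-- A directional derivative of a solution is a viscosity supersolution of the linearized
equation. -/
lemma PosSol.vsup_fderiv (hψ : PosSol Ω ψ c g) (hΩ : IsOpen Ω) (he : ‖e‖ = 1) :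
    VSup Ω c (fun x => fderiv ℝ ψ x e) := by
  have hfd : ContDiff ℝ 1 (fderiv ℝ ψ) := hψ.contDiff.fderiv_right (by norm_num)
  have hz : ContDiff ℝ 1 (fun x => fderiv ℝ ψ x e) := hfd.clm_apply contDiff_const
  refine VSup.of_tendsto
    (zn := fun n x => ((n : ℝ) + 1) * (ψ (x + (1 / ((n : ℝ) + 1)) • e) - ψ x))
    (fun x _ => hz.differentiable (by norm_num) x) (fun x _ => hψ.c_cont.continuousAt)
    fun x hx => ?_
  obtain ⟨r, hr, hrΩ⟩ := nhds_basis_closedBall.mem_iff.1 (hΩ.mem_nhds hx)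
  have hshift : ∀ y ∈ closedBall x (r / 2), ∀ s ∈ Icc (0 : ℝ) (r / 2),
      y + s • e ∈ closedBall x r := by
    intro y hy s hs
    rw [mem_closedBall, dist_eq_norm] at hy ⊢
    calc ‖y + s • e - x‖ = ‖(y - x) + s • e‖ := by congr 1; abel
      _ ≤ ‖y - x‖ + ‖s • e‖ := norm_add_le _ _
      _ ≤ r / 2 + r / 2 := by
        rw [norm_smul, he, mul_one, Real.norm_of_nonneg hs.1]
        exact add_le_add hy hs.2
      _ = r := by ring
  have hsn : Tendsto (fun n : ℕ => 1 / ((n : ℝ) + 1)) atTop (𝓝 0) :=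
    tendsto_one_div_add_atTop_nhds_zero_nat
  refine ⟨r / 2, half_pos hr, ?_, ?_⟩
  · rw [Metric.tendstoUniformlyOn_iff]
    intro ε hε
    have huc := (isCompact_closedBall x r).uniformContinuousOn_of_continuous
      hz.continuous.continuousOn
    obtain ⟨ρ, hρ, huc⟩ := Metric.uniformContinuousOn_iff.1 huc ε hε
    filter_upwards [hsn.eventually_lt_const (lt_min (half_pos hr) hρ)] with n hn y hy
    set s : ℝ := 1 / ((n : ℝ) + 1) with hs
    have hspos : 0 < s := by positivity
    have hns : (n : ℝ) + 1 = s⁻¹ := by rw [hs]; simp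
    have hderiv : ∀ u : ℝ,
        HasDerivAt (fun u : ℝ => ψ (y + u • e)) (fderiv ℝ ψ (y + u • e) e) u := by
      intro u
      have hl : HasDerivAt (fun t : ℝ => y + t • e) e u := by
        simpa using ((hasDerivAt_id u).smul_const e).const_add y
      exact ((hψ.contDiff.differentiable (by norm_num) _).hasFDerivAt).comp_hasDerivAt u hl
    obtain ⟨u, hu, hu'⟩ := exists_hasDerivAt_eq_slope (fun u : ℝ => ψ (y + u • e)) _ hspos
      (fun u _ => (hderiv u).continuousAt.continuousWithinAt) (fun u _ => hderiv u)
    have hval : ((n : ℝ) + 1) * (ψ (y + s • e) - ψ y) = fderiv ℝ ψ (y + u • e) e := by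
      rw [hu', hns]
      simp [div_eq_inv_mul]
    rw [hval]
    refine huc _ (closedBall_subset_closedBall (by linarith) hy) _
      (hshift y hy u ⟨hu.1.le, ?_⟩) ?_
    · exact hu.2.le.trans (hn.le.trans (min_le_left _ _))
    · rw [dist_eq_norm, sub_add_cancel_left, norm_neg, norm_smul, he, mul_one,
        Real.norm_of_nonneg hu.1.le]
      exact hu.2.trans (hn.trans_le (min_le_right _ _))
  · filter_upwards [hsn.eventually_lt_const (half_pos hr)] with n hn y hy
    set s : ℝ := 1 / ((n : ℝ) + 1) with hs
    have hspos : 0 < s := by positivity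
    have hcd : ContDiff ℝ 2 fun x => ψ (x + s • e) :=
      hψ.contDiff.comp (contDiff_id.add contDiff_const)
    have hsub : ContDiff ℝ 2 fun x => ψ (x + s • e) - ψ x := hcd.sub hψ.contDiff
    refine ⟨(contDiff_const.mul hsub).contDiffAt, ?_⟩
    rw [lapl_const_mul _ hsub.contDiffAt, lapl_sub hcd.contDiffAt hψ.contDiff.contDiffAt]
    have h1 : lapl (fun x => ψ (x + s • e)) y = lapl ψ (y + s • e) :=
      lapl_comp_isometry (LinearIsometryEquiv.refl ℝ (Euc N)) (s • e) y hψ.contDiff.contDiffAt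
    have h2 := hψ.eq y (hrΩ (closedBall_subset_closedBall (by linarith) hy))
    have h3 := hψ.eq _ (hrΩ (hshift y hy s ⟨hspos.le, hn.le⟩))
    have h4 := hψ.conv y (y + s • e)
    rw [h1]
    have h5 : lapl ψ (y + s • e) - lapl ψ y ≤ -(c y * (ψ (y + s • e) - ψ y)) := by linarith
    have := mul_le_mul_of_nonneg_left h5 (by positivity : 0 ≤ (n : ℝ) + 1)
    linarith

lemma PosSol.fderiv_nonneg (hψ : PosSol Ω ψ c g) (hΩ : SymDomain Ω e) :
    ∀ x ∈ cap Ω e 0, 0 ≤ fderiv ℝ ψ x e := by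
  intro x hx
  have hd := hψ.contDiff.differentiable (by norm_num) x
  have := le_fderiv_of_linear_growth (z := fun y => ψ y - ψ x) (b := x) (v := e) (k := 0)
    (δ := -⟪x, e⟫) (hd.sub_const _) (sub_self _) (by linarith [hx.2]) fun s hs => by
      rw [zero_mul]
      rcases hs.1.eq_or_lt with h | h
      · simp [← h]
      · have h1 := hψ.planeRefl_nonneg hΩ (t := ⟪x, e⟫ + s / 2) (by linarith [hs.2, hx.2]) x
          ⟨hx.1, by linarith⟩
        have h2 : planeRefl e (⟪x, e⟫ + s / 2) x = x + s • e := by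
          rw [planeRefl]
          congr 2
          ring
        rwa [h2] at h1
  rwa [fderiv_sub_const] at this

/-- A solution is strictly increasing along `e` in the half of the domain below the hyperplane. -/
theorem PosSol.fderiv_pos (hψ : PosSol Ω ψ c g) (hΩ : SymDomain Ω e) :
    ∀ x ∈ cap Ω e 0, 0 < fderiv ℝ ψ x e := by
  intro x hx
  refine (hψ.fderiv_nonneg hΩ x hx).lt_of_ne' fun h0 => ?_
  obtain ⟨s₀, hs₀, hb, hseg⟩ := exists_exit hΩ.isOpen hΩ.isBounded hΩ.norm_eq hx.1
  have hsub : (fun s : ℝ => x - s • e) '' Ico 0 s₀ ⊆ cap Ω e 0 := by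
    rintro _ ⟨s, hs, rfl⟩
    refine ⟨hseg s hs, ?_⟩
    have h1 := hx.2
    have h2 := hs.1
    have := inner_add_smul_self hΩ.norm_eq x (-s)
    rw [neg_smul, ← sub_eq_add_neg] at this
    simp only [this]
    linarith
  have hz := ((hψ.vsup_fderiv hΩ.isOpen hΩ.norm_eq).mono (cap_subset 0)).eq_zero_of_isPreconnected
    (isOpen_cap hΩ.isOpen 0) (fun y _ => hψ.c_nonneg y) (hψ.fderiv_nonneg hΩ)
    (isPreconnected_exit_segment x s₀) hsub ⟨0, ⟨le_rfl, hs₀⟩, by simp⟩ h0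
  have hconst := constant_of_has_deriv_right_zero (f := fun s : ℝ => ψ (x - s • e)) (a := 0)
    (b := s₀) (by have := hψ.contDiff.continuous; fun_prop) (fun s hs => by
      have hl : HasDerivAt (fun t : ℝ => x - t • e) (-e) s := by
        simpa using ((hasDerivAt_id s).smul_const e).const_sub x
      have h := ((hψ.contDiff.differentiable (by norm_num) (x - s • e)).hasFDerivAt).comp_hasDerivAt
        s hl
      rw [map_neg, hz _ ⟨s, hs, rfl⟩, neg_zero] at h
      exact h.hasDerivWithinAt) s₀ (right_mem_Icc.2 hs₀.le)
  simp only [zero_smul, sub_zero] at hconst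
  rw [hψ.zero _ hb] at hconst
  exact (hψ.pos hΩ x hx.1).ne hconst

end MovingPlanesMonotone

section HalfDomain

variable {N : ℕ} {Ω : Set (Euc N)} {e : Euc N} {ψ c g : Euc N → ℝ}

lemma PosSol.vsup_zero (hψ : PosSol Ω ψ c g) : VSup Ω 0 ψ :=
  VSup.of_lapl_le (fun x _ => hψ.contDiff.contDiffAt) fun x hxΩ => by
    have h1 := hψ.eq x hxΩ
    have h2 := hψ.g_nonneg x
    simp only [Pi.zero_apply, neg_zero, zero_mul]
    linarith

lemma PosSol.hopf (hψ : PosSol Ω ψ c g) (hΩ : SymDomain Ω e) {b x₀ : Euc N} {R : ℝ}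
    (hb : b ∈ frontier Ω) (hR : 0 < R) (hball : ball x₀ R ⊆ Ω) (hbR : ‖b - x₀‖ = R) :
    0 < fderiv ℝ ψ b (x₀ - b) :=
  hψ.vsup_zero.hopf_fderiv hR hball (fun _ _ => le_rfl) (fun x hx => hψ.pos hΩ x (hball hx))
    hψ.contDiff.continuous.continuousOn hbR
    (fun x hx => hψ.nonneg hΩ x (closure_mono hball (by rwa [closure_ball _ hR.ne'])))
    (hψ.zero b hb) (hψ.contDiff.differentiable (by norm_num) b)

lemma SymDomain.isPreconnected_cap (hΩ : SymDomain Ω e) : IsPreconnected (cap Ω e 0) := by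
  set fold : Euc N → Euc N := fun x => x + (-(⟪x, e⟫ + |⟪x, e⟫|)) • e with hfold
  set F : Euc N → Euc N := fun x => fold x - (infDist (fold x) Ωᶜ / 2) • e with hF
  have hinn := continuous_inner_right e
  have hfc : Continuous fold := by fun_prop
  have hFc : Continuous F := hfc.sub ((((continuous_infDist_pt _).comp hfc).div_const 2).smul
    continuous_const)
  have hne : (Ωᶜ).Nonempty := by
    obtain ⟨b, hb⟩ := hΩ.frontier_nonempty
    rw [hΩ.isOpen.frontier_eq] at hb
    exact ⟨b, hb.2⟩
  have hd : ∀ x ∈ Ω, 0 < infDist x Ωᶜ := fun x hx =>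
    (hΩ.isOpen.isClosed_compl.notMem_iff_infDist_pos hne).1 (not_not.2 hx)
  have hfin : ∀ x, ⟪fold x, e⟫ = -|⟪x, e⟫| := fun x => by
    rw [hfold]
    simp only [inner_add_smul_self hΩ.norm_eq]
    ring
  have hfm : ∀ x ∈ Ω, fold x ∈ Ω := fun x hx => hΩ.steiner x hx _ (by
    rw [show ⟪x, e⟫ + -(⟪x, e⟫ + |⟪x, e⟫|) = -|⟪x, e⟫| by ring, abs_neg, abs_abs])
  have hsub_in : ∀ (x : Euc N) (s : ℝ), ⟪x - s • e, e⟫ = ⟪x, e⟫ - s := fun x s => by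
    have := inner_add_smul_self hΩ.norm_eq x (-s)
    rwa [neg_smul, ← sub_eq_add_neg, ← sub_eq_add_neg] at this
  have hmove : ∀ x ∈ Ω, ∀ s ∈ Icc 0 (infDist x Ωᶜ / 2), x - s • e ∈ Ω := fun x hx s hs => by
    refine ball_infDist_compl_subset (x := x) ?_
    rw [mem_ball, dist_eq_norm, sub_sub_cancel_left, norm_neg, norm_smul, hΩ.norm_eq, mul_one,
      Real.norm_of_nonneg hs.1]
    linarith [hs.2, hd x hx]
  have hFm : ∀ x ∈ Ω, F x ∈ cap Ω e 0 := fun x hx => by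
    have hp := hd _ (hfm x hx)
    refine ⟨hmove _ (hfm x hx) _ ⟨by positivity, le_rfl⟩, ?_⟩
    simp only [hF, hsub_in, hfin]
    linarith [abs_nonneg ⟪x, e⟫]
  obtain ⟨x₀, hx₀⟩ := hΩ.isConnected.nonempty
  refine isPreconnected_of_forall (F x₀) fun y hy => ?_
  have hfy : fold y = y := by
    simp [hfold, abs_of_neg hy.2]
  refine ⟨F '' Ω ∪ (fun s : ℝ => y - s • e) '' Icc 0 (infDist y Ωᶜ / 2), ?_,
    Or.inl ⟨x₀, hx₀, rfl⟩, Or.inr ⟨0, ⟨le_rfl, by have := hd y hy.1; positivity⟩, by simp⟩, ?_⟩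
  · rintro _ (⟨x, hx, rfl⟩ | ⟨s, hs, rfl⟩)
    · exact hFm x hx
    · refine ⟨hmove y hy.1 s hs, ?_⟩
      simp only [hsub_in]
      linarith [hy.2, hs.1]
  · refine IsPreconnected.union (F y) ⟨y, hy.1, rfl⟩ ⟨infDist y Ωᶜ / 2, ⟨?_, le_rfl⟩, ?_⟩
      (hΩ.isConnected.isPreconnected.image _ hFc.continuousOn)
      (isPreconnected_Icc.image _ (by fun_prop))
    · have := hd y hy.1
      positivity
    · simp only [hF, hfy]

lemma isClosed_setOf_ball_subset (S : Set (Euc N)) (δ : ℝ) : IsClosed {x | ball x δ ⊆ S} := by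
  have : {x | ball x δ ⊆ S} = ⋂ y ∈ Sᶜ, (ball y δ)ᶜ := by
    ext x
    simp only [mem_ofPred_eq, mem_iInter, mem_compl_iff, mem_ball]
    refine ⟨fun h y hy hxy => hy (h (by rwa [mem_ball, dist_comm])), fun h y hy => ?_⟩
    by_contra hyS
    exact h y hyS (by rwa [dist_comm])
  rw [this]
  exact isClosed_biInter fun y _ => isOpen_ball.isClosed_compl

lemma PosSol.exists_fderiv_pos (hψ : PosSol Ω ψ c g) (hΩ : SymDomain Ω e)
    (hne : (cap Ω e 0).Nonempty) :
    ∃ b ∈ closure (cap Ω e 0), b ∉ Ω ∧ 0 < fderiv ℝ ψ b e := by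
  obtain ⟨b, hb, hmin⟩ := hΩ.isBounded.isCompact_closure.exists_isMinOn
    hΩ.isConnected.nonempty.closure (continuous_inner_right e).continuousOn
  have hbf : b ∈ frontier Ω := by
    rcases mem_or_mem_frontier hΩ.isOpen hb with h | h
    · obtain ⟨s₀, hs₀, hbs, -⟩ := exists_exit hΩ.isOpen hΩ.isBounded hΩ.norm_eq h
      have h1 : ⟪b, e⟫ ≤ ⟪b - s₀ • e, e⟫ := hmin (frontier_subset_closure hbs)
      have := inner_add_smul_self hΩ.norm_eq b (-s₀)
      rw [neg_smul, ← sub_eq_add_neg] at this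
      linarith
    · exact h
  obtain ⟨x, hx⟩ := hne
  have hbneg : ⟪b, e⟫ < 0 := lt_of_le_of_lt (hmin (subset_closure hx.1)) hx.2
  obtain ⟨x₀, R, hR, hball, hbR⟩ := hΩ.interior_ball b hbf
  have hcb : closedBall x₀ R ⊆ closure Ω := by
    rw [← closure_ball _ hR.ne']
    exact closure_mono hball
  have h1 : ⟪b, e⟫ ≤ ⟪x₀ + (-R) • e, e⟫ := hmin (hcb (by
    rw [mem_closedBall, dist_eq_norm, add_sub_cancel_left, norm_smul, hΩ.norm_eq, mul_one,
      norm_neg, Real.norm_of_nonneg hR.le]))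
  rw [inner_add_smul_self hΩ.norm_eq] at h1
  have h2 : x₀ - b = R • e := by
    rw [← sub_eq_zero, ← norm_eq_zero, ← sq_eq_zero_iff]
    refine le_antisymm ?_ (sq_nonneg _)
    rw [norm_sub_sq_real, real_inner_smul_right, norm_smul, hΩ.norm_eq, mul_one,
      Real.norm_of_nonneg hR.le, norm_sub_rev, hbR, inner_sub_left]
    nlinarith
  have h3 := hψ.hopf hΩ hbf hR hball hbR
  rw [h2, map_smul, smul_eq_mul] at h3
  refine ⟨b, ?_, ?_, (mul_pos_iff_of_pos_left hR).1 h3⟩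
  · have := (isOpen_lt (continuous_inner_right e) (continuous_const (y := (0 : ℝ)))).inter_closure
      ⟨hbneg, hb⟩
    rwa [inter_comm] at this
  · rw [hΩ.isOpen.frontier_eq] at hbf
    exact hbf.2

/-- The maximum principle for the linearized operator on subsets of half of the domain. -/
theorem PosSol.nonpos_of_lapl_eq (hψ : PosSol Ω ψ c g) (hΩ : SymDomain Ω e) {v : Euc N → ℝ}
    {D : Set (Euc N)} (hD : D ⊆ cap Ω e 0) (hDo : IsOpen D) (hv : ContDiff ℝ 2 v)
    (hveq : ∀ x ∈ D, lapl v x = -c x * v x) (hbd : ∀ x ∈ closure D, x ∉ D → v x ≤ 0) :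
    ∀ x ∈ D, v x ≤ 0 := by
  by_contra! hpos
  obtain ⟨x₁, hx₁, hvx₁⟩ := hpos
  set z : Euc N → ℝ := fun x => fderiv ℝ ψ x e with hzdef
  have hzc : Continuous z :=
    (hψ.contDiff.continuous_fderiv (by norm_num)).clm_apply continuous_const
  have hvc : Continuous v := hv.continuous
  have hzpos : ∀ x ∈ cap Ω e 0, 0 < z x := hψ.fderiv_pos hΩ
  have hznn : ∀ x ∈ closure (cap Ω e 0), 0 ≤ z x := fun x hx =>
    closure_minimal (fun y hy => (hzpos y hy).le) (isClosed_le continuous_const hzc) hx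
  have hsup : ∀ C : ℝ, 0 < C → VSup D c (fun x => C * z x - v x) := fun C hC =>
    ((hψ.vsup_fderiv hΩ.isOpen hΩ.norm_eq).mono (hD.trans (cap_subset 0))).const_mul_sub hC
      (fun x _ => hv.contDiffAt) hveq
  have hcont : ∀ C : ℝ, Continuous (fun x => C * z x - v x) := fun C => by fun_prop
  obtain ⟨δ, hδ, hsmall⟩ := hΩ.exists_ball_subset hψ.c_cont hψ.c_nonneg
  set K : Set (Euc N) := closure (cap Ω e 0) ∩ {x | ball x δ ⊆ cap Ω e 0} with hK
  have hKsub : K ⊆ cap Ω e 0 := fun x hx => hx.2 (mem_ball_self hδ)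
  have hKc : IsCompact K := (hΩ.isBounded.subset (cap_subset 0)).isCompact_closure.inter_right
    (isClosed_setOf_ball_subset _ _)
  have hmin : ∀ C : ℝ, 0 < C → (∃ x ∈ D, C * z x - v x < 0) →
      ∃ x ∈ D, x ∈ K ∧ C * z x - v x < 0 := fun C hC hex => by
    obtain ⟨x₀, hx₀, hneg, -, hball⟩ := hsmall 0 le_rfl D hD hDo _ (hsup C hC)
      (hcont C).continuousOn (fun x hx hxD => by
        have h1 := hznn x (closure_mono hD hx)
        have h2 := hbd x hx hxD
        have := mul_nonneg hC.le h1
        linarith) hex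
    exact ⟨x₀, hx₀, ⟨subset_closure (hD hx₀), hball⟩, hneg⟩
  set A : Set ℝ := {C | 0 < C ∧ ∀ x ∈ D, 0 ≤ C * z x - v x} with hA
  have hAne : A.Nonempty := by
    obtain ⟨κ, hκ, hκz⟩ := hKc.exists_forall_le' hzc.continuousOn (a := 0)
      fun x hx => hzpos x (hKsub hx)
    obtain ⟨B, hB⟩ := hKc.exists_bound_of_continuousOn hvc.continuousOn
    refine ⟨(|B| + 1) / κ, by positivity, ?_⟩
    by_contra! hex
    obtain ⟨x, -, hxK, hlt⟩ := hmin _ (by positivity) hex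
    have h1 : (|B| + 1) / κ * κ ≤ (|B| + 1) / κ * z x :=
      mul_le_mul_of_nonneg_left (hκz x hxK) (by positivity)
    rw [div_mul_cancel₀ _ hκ.ne'] at h1
    have h2 := (le_abs_self _).trans (hB x hxK)
    linarith [le_abs_self B]
  have hbdd : BddBelow A := ⟨0, fun C hC => hC.1.le⟩
  set Cs := sInf A with hCs
  have hCspos : 0 < Cs := by
    have hz1 := hzpos x₁ (hD hx₁)
    refine (div_pos hvx₁ hz1).trans_le (le_csInf hAne fun C hC => ?_)
    rw [div_le_iff₀ hz1]
    linarith [hC.2 x₁ hx₁]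
  have hCsA : ∀ x ∈ D, 0 ≤ Cs * z x - v x := fun x hx =>
    closure_minimal (fun C (hC : C ∈ A) => hC.2 x hx)
      (isClosed_le continuous_const (by fun_prop : Continuous fun C : ℝ => C * z x - v x))
      (csInf_mem_closure hAne hbdd)
  obtain ⟨x₂, hx₂, hux₂⟩ : ∃ x ∈ D, Cs * z x - v x = 0 := by
    by_contra! hne
    have hup : ∀ x ∈ K ∩ closure D, 0 < Cs * z x - v x := fun x hx => by
      by_cases hxD : x ∈ D
      · exact (hCsA x hxD).lt_of_ne' (hne x hxD)
      · have h1 := hbd x hx.2 hxD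
        have := mul_pos hCspos (hzpos x (hKsub hx.1))
        linarith
    have hKDc : IsCompact (K ∩ closure D) := hKc.inter_right isClosed_closure
    obtain ⟨μ, hμ, hμu⟩ := hKDc.exists_forall_le' (hcont Cs).continuousOn hup
    obtain ⟨Z, hZ⟩ := hKc.exists_bound_of_continuousOn hzc.continuousOn
    set ε : ℝ := min (Cs / 2) (μ / (2 * (|Z| + 1))) with hε
    have hε0 : 0 < ε := lt_min (by positivity) (by positivity)
    have hεC : ε ≤ Cs / 2 := min_le_left _ _
    have hεμ : ε * (|Z| + 1) ≤ μ / 2 := by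
      have := mul_le_mul_of_nonneg_right (min_le_right (Cs / 2) (μ / (2 * (|Z| + 1))))
        (by positivity : 0 ≤ |Z| + 1)
      calc ε * (|Z| + 1) ≤ μ / (2 * (|Z| + 1)) * (|Z| + 1) := this
        _ = μ / 2 := by field_simp
    have hmem : Cs - ε ∈ A := by
      refine ⟨by linarith, ?_⟩
      by_contra! hex
      obtain ⟨x, hxD, hxK, hlt⟩ := hmin _ (by linarith) hex
      have h1 := hμu x ⟨hxK, subset_closure hxD⟩
      have h2 : z x ≤ |Z| + 1 := ((le_abs_self _).trans (hZ x hxK)).trans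
        ((le_abs_self Z).trans (by linarith))
      have h3 := mul_le_mul_of_nonneg_left h2 hε0.le
      have h4 : (Cs - ε) * z x - v x = Cs * z x - v x - ε * z x := by ring
      linarith
    linarith [csInf_le hbdd hmem]
  set E : Set (Euc N) := {x | x ∈ D ∧ Cs * z x - v x = 0} with hE
  have hEo : IsOpen E := isOpen_iff_mem_nhds.2 fun x hx =>
    (hDo.eventually_mem hx.1).and ((hsup Cs hCspos).eventually_eq_zero hDo
      (fun y _ => hψ.c_nonneg y) hCsA hx.1 hx.2)
  have hcapE : cap Ω e 0 ⊆ E := by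
    refine hΩ.isPreconnected_cap.subset_of_closure_inter_subset hEo ⟨x₂, hD hx₂, hx₂, hux₂⟩ ?_
    rintro x ⟨hx, hxcap⟩
    have hux : Cs * z x - v x = 0 := closure_minimal (fun y (hy : y ∈ E) => hy.2)
      (isClosed_eq (hcont Cs) continuous_const) hx
    refine ⟨?_, hux⟩
    by_contra hxD
    have h1 := hbd x (closure_mono (fun y (hy : y ∈ E) => hy.1) hx) hxD
    have := mul_pos hCspos (hzpos x hxcap)
    linarith
  obtain ⟨b, hb, hbΩ, hzb⟩ := hψ.exists_fderiv_pos hΩ ⟨x₁, hD hx₁⟩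
  have hub : Cs * z b - v b = 0 := closure_minimal (fun y hy => (hcapE hy).2)
    (isClosed_eq (hcont Cs) continuous_const) hb
  have hvb := hbd b (closure_mono (fun y hy => (hcapE hy).1) hb) fun h => hbΩ (hD h).1
  have := mul_pos hCspos hzb
  linarith

end HalfDomain

section Boundary

variable {N : ℕ} {Ω : Set (Euc N)} {e : Euc N} {ψ c g : Euc N → ℝ}

/-- Near every boundary point, `Ω` is the sublevel set of a regular `C²` function. -/
def HasC2Chart (Ω : Set (Euc N)) : Prop :=
  ∀ b ∈ frontier Ω, ∃ (U : Set (Euc N)) (f : Euc N → ℝ), IsOpen U ∧ b ∈ U ∧ ContDiff ℝ 2 f ∧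
    (∀ y ∈ U, fderiv ℝ f y ≠ 0) ∧ Ω ∩ U = {y ∈ U | f y < 0}

lemma HasC2Chart.exists_interior_ball (h : HasC2Chart Ω) {b : Euc N}
    (hb : b ∈ frontier Ω) : ∃ x₀ R, 0 < R ∧ ball x₀ R ⊆ Ω ∧ ‖b - x₀‖ = R := by
  obtain ⟨U, f, hU, hbU, hf, hf', hΩU⟩ := h b hb
  have hfb : f b ≤ 0 := by
    by_contra! hpos
    have hbcl := frontier_subset_closure hb
    have hV : IsOpen (U ∩ {y | 0 < f y}) := hU.inter (isOpen_lt continuous_const hf.continuous)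
    obtain ⟨y, ⟨hyU, hyf⟩, hyΩ⟩ := mem_closure_iff.1 hbcl _ hV ⟨hbU, hpos⟩
    have : y ∈ Ω ∩ U := ⟨hyΩ, hyU⟩
    rw [hΩU] at this
    exact lt_asymm hyf this.2
  have hfd : ContDiff ℝ 1 (fderiv ℝ f) := hf.fderiv_right (by norm_num)
  obtain ⟨K, V, hV, hK⟩ := hfd.contDiffAt.exists_lipschitzOnWith (x := b)
  obtain ⟨r, hr, hrUV⟩ := nhds_basis_closedBall.mem_iff.1 (inter_mem (hU.mem_nhds hbU) hV)
  have htaylor : ∀ y ∈ closedBall b r, f y ≤ fderiv ℝ f b (y - b) + K * ‖y - b‖ ^ 2 := by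
    intro y hy
    have hsub : closedBall b ‖y - b‖ ⊆ closedBall b r :=
      closedBall_subset_closedBall (by rwa [mem_closedBall, dist_eq_norm] at hy)
    have := (convex_closedBall b ‖y - b‖).norm_image_sub_le_of_norm_hasFDerivWithin_le'
      (f := f) (f' := fderiv ℝ f) (φ := fderiv ℝ f b) (C := K * ‖y - b‖)
      (fun z _ => (hf.differentiable (by norm_num) z).hasFDerivAt.hasFDerivWithinAt)
      (fun z hz => by
        refine (hK.norm_sub_le (hrUV (hsub hz)).2 (mem_of_mem_nhds hV)).trans ?_
        gcongr
        rwa [mem_closedBall, dist_eq_norm] at hz)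
      (mem_closedBall_self (norm_nonneg _)) (x := b) (y := y) (by simp [dist_eq_norm])
    have h2 := (abs_le.1 (Real.norm_eq_abs _ ▸ this)).2
    nlinarith
  set n : Euc N := (InnerProductSpace.toDual ℝ (Euc N)).symm (fderiv ℝ f b) with hn
  have hnf : ∀ v, fderiv ℝ f b v = ⟪n, v⟫ := fun v => by
    rw [hn, InnerProductSpace.toDual_symm_apply]
  have hn0 : 0 < ‖n‖ := by
    rw [norm_pos_iff, hn]
    simpa using hf' b hbU
  set s : ℝ := min (1 / (2 * (K + 1))) (r / (2 * ‖n‖)) with hs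
  have hspos : 0 < s := lt_min (by positivity) (by positivity)
  have hs1 : s * (2 * (K + 1)) ≤ 1 := by
    have := min_le_left (1 / (2 * ((K : ℝ) + 1))) (r / (2 * ‖n‖))
    rwa [← hs, le_div_iff₀ (by positivity)] at this
  have hs2 : s * (2 * ‖n‖) ≤ r := by
    have := min_le_right (1 / (2 * ((K : ℝ) + 1))) (r / (2 * ‖n‖))
    rwa [← hs, le_div_iff₀ (by positivity)] at this
  refine ⟨b - s • n, s * ‖n‖, by positivity, fun y hy => ?_, ?_⟩
  · rw [mem_ball, dist_eq_norm] at hy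
    have hyb : ‖y - b‖ < s * (2 * ‖n‖) := by
      calc ‖y - b‖ = ‖(y - (b - s • n)) - s • n‖ := by congr 1; abel
        _ ≤ ‖y - (b - s • n)‖ + ‖s • n‖ := norm_sub_le _ _
        _ < s * ‖n‖ + s * ‖n‖ := by
          rw [norm_smul, Real.norm_of_nonneg hspos.le]
          linarith
        _ = s * (2 * ‖n‖) := by ring
    have hyr : y ∈ closedBall b r := by
      rw [mem_closedBall, dist_eq_norm]
      linarith
    have h1 := htaylor y hyr
    rw [hnf] at h1
    have h2 : ‖y - b‖ ^ 2 + 2 * (s * ⟪n, y - b⟫) < 0 := by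
      have h3 : ‖y - (b - s • n)‖ ^ 2 < (s * ‖n‖) ^ 2 :=
        pow_lt_pow_left₀ hy (norm_nonneg _) two_ne_zero
      have h4 : y - (b - s • n) = (y - b) + s • n := by abel
      rw [h4, norm_add_sq_real, real_inner_smul_right, norm_smul, Real.norm_of_nonneg hspos.le,
        real_inner_comm] at h3
      linarith
    have hyf : f y < 0 := by
      have h5 : s * f y ≤ s * ⟪n, y - b⟫ + s * (K * ‖y - b‖ ^ 2) := by
        have := mul_le_mul_of_nonneg_left h1 hspos.le
        linarith
      have h6 : s * (K * ‖y - b‖ ^ 2) ≤ ‖y - b‖ ^ 2 / 2 := by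
        have h7 : s * K ≤ 1 / 2 := by nlinarith
        have := mul_le_mul_of_nonneg_right h7 (sq_nonneg ‖y - b‖)
        linarith
      by_contra! hcon
      have := mul_nonneg hspos.le hcon
      linarith
    have : y ∈ Ω ∩ U := by
      rw [hΩU]
      exact ⟨(hrUV hyr).1, hyf⟩
    exact this.1
  · rw [sub_sub_cancel, norm_smul, Real.norm_of_nonneg hspos.le]

/-- The gradients at the boundary of two functions vanishing there are parallel. -/
lemma HasC2Chart.exists_fderiv_eq_smul (h : HasC2Chart Ω) (hΩ : IsOpen Ω) {b : Euc N}
    (hb : b ∈ frontier Ω) {u v : Euc N → ℝ} (hu : ContDiff ℝ 2 u) (hv : ContDiff ℝ 2 v)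
    (hu0 : ∀ x ∈ frontier Ω, u x = 0) (hv0 : ∀ x ∈ frontier Ω, v x = 0)
    (hub : fderiv ℝ u b ≠ 0) : ∃ k : ℝ, fderiv ℝ v b = k • fderiv ℝ u b := by
  obtain ⟨U, f, hU, hbU, hf, hf', hΩU⟩ := h b hb
  have hmem : ∀ y ∈ U, f y = 0 → y ∈ frontier Ω := fun y hy hfy => by
    rw [hΩ.frontier_eq]
    refine ⟨?_, fun hyΩ => ?_⟩
    · by_contra hcl
      have hmin : IsLocalMin f y := by
        filter_upwards [hU.mem_nhds hy, isClosed_closure.isOpen_compl.mem_nhds hcl] with w hwU hw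
        rw [hfy]
        by_contra! hneg
        have : w ∈ Ω ∩ U := by
          rw [hΩU]
          exact ⟨hwU, hneg⟩
        exact hw (subset_closure this.1)
      exact hf' y hy hmin.fderiv_eq_zero
    · have : y ∈ Ω ∩ U := ⟨hyΩ, hy⟩
      rw [hΩU] at this
      exact this.2.ne hfy
  have hfb : f b = 0 := by
    have hbΩ : b ∉ Ω := by
      rw [hΩ.frontier_eq] at hb
      exact hb.2
    refine le_antisymm ?_ (not_lt.1 fun hlt => hbΩ ?_)
    · by_contra! hpos
      obtain ⟨y, ⟨hyU, hyf⟩, hyΩ⟩ := mem_closure_iff.1 (frontier_subset_closure hb) _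
        (hU.inter (isOpen_lt continuous_const hf.continuous)) ⟨hbU, hpos⟩
      have : y ∈ Ω ∩ U := ⟨hyΩ, hyU⟩
      rw [hΩU] at this
      exact lt_asymm hyf this.2
    · have : b ∈ Ω ∩ U := by
        rw [hΩU]
        exact ⟨hbU, hlt⟩
      exact this.1
  have key : ∀ w : Euc N → ℝ, ContDiff ℝ 2 w → (∀ x ∈ frontier Ω, w x = 0) →
      ∃ k : ℝ, fderiv ℝ w b = k • fderiv ℝ f b := by
    intro w hw hw0
    have hext : IsLocalExtrOn w {x | f x = f b} b := by
      refine Or.inl ?_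
      filter_upwards [self_mem_nhdsWithin, mem_nhdsWithin_of_mem_nhds (hU.mem_nhds hbU)]
        with y hy hyU
      rw [hw0 b hb, hw0 y (hmem y hyU (hy.trans hfb))]
    obtain ⟨s, t, hst, heq⟩ := hext.exists_multipliers_of_hasStrictFDerivAt_1d
      (hf.contDiffAt.hasStrictFDerivAt (by norm_num))
      (hw.contDiffAt.hasStrictFDerivAt (by norm_num))
    have ht : t ≠ 0 := by
      rintro rfl
      rw [zero_smul, add_zero] at heq
      rcases smul_eq_zero.1 heq with h0 | h0
      · exact hst (by rw [h0, Prod.mk_zero_zero])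
      · exact hf' b hbU h0
    refine ⟨-(t⁻¹ * s), ?_⟩
    rw [add_comm, add_eq_zero_iff_eq_neg] at heq
    rw [neg_smul, mul_smul, ← smul_neg, ← heq, inv_smul_smul₀ ht]
  obtain ⟨k, hk⟩ := key u hu hu0
  obtain ⟨l, hl⟩ := key v hv hv0
  have hk0 : k ≠ 0 := by
    rintro rfl
    exact hub (by rw [hk, zero_smul])
  exact ⟨l * k⁻¹, by rw [hl, hk, mul_smul, inv_smul_smul₀ hk0]⟩

/-- A boundary satisfying an interior ball condition is a null set. -/
lemma volume_frontier_eq_zero (hΩ : IsOpen Ω) (hN : 0 < N)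
    (hball : ∀ b ∈ frontier Ω, ∃ x₀ R, 0 < R ∧ ball x₀ R ⊆ Ω ∧ ‖b - x₀‖ = R) :
    volume (frontier Ω) = 0 := by
  have : Nonempty (Fin N) := ⟨⟨0, hN⟩⟩
  by_contra hne
  have hae := IsUnifLocDoublingMeasure.ae_tendsto_measure_inter_div
    (volume : Measure (Euc N)) (frontier Ω) 1
  rw [ae_restrict_iff' isClosed_frontier.measurableSet] at hae
  obtain ⟨b, hb, hlim⟩ : ∃ b ∈ frontier Ω, ∀ {ι : Type} {l : Filter ι} (w : ι → Euc N) (δ : ι → ℝ)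
      (_ : Tendsto δ l (𝓝[>] 0)) (_ : ∀ᶠ j in l, b ∈ closedBall (w j) (1 * δ j)),
      Tendsto (fun j => volume (frontier Ω ∩ closedBall (w j) (δ j)) /
        volume (closedBall (w j) (δ j))) l (𝓝 1) := by
    by_contra! hcon
    refine hne (measure_mono_null (fun b hb => ?_) (ae_iff.1 hae))
    obtain ⟨ι, l, w, δ, h1, h2, h3⟩ := hcon b hb
    exact fun h => h3 (h hb w δ h1 h2)
  obtain ⟨x₀, R, hR, hsub, hbR⟩ := hball b hb
  set w : ℝ → Euc N := fun s => b + (s / R) • (x₀ - b) with hw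
  have hdist : ∀ s, 0 ≤ s → ‖b - w s‖ = s := fun s hs => by
    rw [hw]
    simp only [sub_add_cancel_left, norm_neg, norm_smul]
    rw [norm_sub_rev, hbR, Real.norm_of_nonneg (by positivity)]
    field_simp
  have hev : ∀ᶠ s in 𝓝[>] (0 : ℝ), s ∈ Ioo 0 R := Ioo_mem_nhdsGT hR
  have h1 := hlim (ι := ℝ) (l := 𝓝[>] (0 : ℝ)) w id tendsto_id (by
    filter_upwards [hev] with s hs
    rw [one_mul, mem_closedBall, dist_eq_norm, hdist s hs.1.le, id])
  have h2 : Tendsto (fun s : ℝ => volume (frontier Ω ∩ closedBall (w s) (id s)) /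
      volume (closedBall (w s) (id s))) (𝓝[>] (0 : ℝ)) (𝓝 0) := by
    refine tendsto_const_nhds.congr' ?_
    filter_upwards [hev] with s hs
    have hin : ball (w s) s ⊆ Ω := by
      refine Subset.trans (fun y hy => ?_) hsub
      rw [mem_ball, dist_eq_norm] at hy ⊢
      have h3 : ‖w s - x₀‖ = R - s := by
        have : w s - x₀ = (1 - s / R) • (b - x₀) := by
          rw [hw]
          module
        rw [this, norm_smul, hbR, Real.norm_of_nonneg (by
          rw [sub_nonneg, div_le_one hR]; exact hs.2.le)]
        field_simp
      calc ‖y - x₀‖ = ‖(y - w s) + (w s - x₀)‖ := by congr 1; abel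
        _ ≤ ‖y - w s‖ + ‖w s - x₀‖ := norm_add_le _ _
        _ < R := by linarith
    have h0 : volume (frontier Ω ∩ closedBall (w s) s) = 0 := by
      refine measure_mono_null (fun y hy => ?_) (Measure.addHaar_sphere volume (w s) s)
      rw [hΩ.frontier_eq] at hy
      refine le_antisymm hy.2 (not_lt.1 fun hlt => hy.1.2 (hin hlt))
    rw [id, h0, ENNReal.zero_div]
  exact zero_ne_one (tendsto_nhds_unique h2 h1)

end Boundary

section Divergence

variable {N : ℕ} {Ω : Set (Euc N)}

lemma contDiff_pd {f : Euc N → ℝ} (hf : ContDiff ℝ 2 f) (i : Fin N) : ContDiff ℝ 1 (pd i f) :=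
  (hf.fderiv_right (by norm_num)).clm_apply contDiff_const

lemma continuous_pd {f : Euc N → ℝ} (hf : ContDiff ℝ 1 f) (i : Fin N) : Continuous (pd i f) :=
  (hf.continuous_fderiv (by norm_num)).clm_apply continuous_const

lemma continuous_lapl {f : Euc N → ℝ} (hf : ContDiff ℝ 2 f) : Continuous (lapl f) :=
  continuous_finsetSum _ fun i _ => continuous_pd (contDiff_pd hf i) i

lemma pd_add {f g : Euc N → ℝ} {x : Euc N} (hf : DifferentiableAt ℝ f x)
    (hg : DifferentiableAt ℝ g x) (i : Fin N) :
    pd i (fun y => f y + g y) x = pd i f x + pd i g x := by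
  simp only [pd]
  rw [fderiv_fun_add hf hg]
  rfl

lemma pd_sub {f g : Euc N → ℝ} {x : Euc N} (hf : DifferentiableAt ℝ f x)
    (hg : DifferentiableAt ℝ g x) (i : Fin N) :
    pd i (fun y => f y - g y) x = pd i f x - pd i g x := by
  simp only [pd]
  rw [fderiv_fun_sub hf hg]
  rfl

lemma pd_mul {f g : Euc N → ℝ} {x : Euc N} (hf : DifferentiableAt ℝ f x)
    (hg : DifferentiableAt ℝ g x) (i : Fin N) :
    pd i (fun y => f y * g y) x = f x * pd i g x + g x * pd i f x := by
  simp only [pd]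
  rw [fderiv_fun_mul hf hg]
  rfl

lemma pd_const_mul {f : Euc N → ℝ} {x : Euc N} (hf : DifferentiableAt ℝ f x) (a : ℝ) (i : Fin N) :
    pd i (fun y => a * f y) x = a * pd i f x := by
  simp only [pd]
  rw [fderiv_const_mul hf]
  rfl

lemma pd_const (a : ℝ) (x : Euc N) (i : Fin N) : pd i (fun _ => a) x = 0 := by
  simp [pd]

lemma pd_exp {f : Euc N → ℝ} {x : Euc N} (hf : DifferentiableAt ℝ f x) (i : Fin N) :
    pd i (fun y => Real.exp (f y)) x = Real.exp (f x) * pd i f x := by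
  simp only [pd]
  rw [fderiv_exp hf]
  rfl

lemma pd_coord (x : Euc N) (i j : Fin N) : pd i (fun y => y j) x = if i = j then 1 else 0 := by
  have h : HasFDerivAt (fun y : Euc N => y j) (EuclideanSpace.proj j : Euc N →L[ℝ] ℝ) x :=
    (EuclideanSpace.proj j : Euc N →L[ℝ] ℝ).hasFDerivAt
  rw [pd, h.fderiv]
  simp [eq_comm]

lemma pd_comm {f : Euc N → ℝ} (hf : ContDiff ℝ 2 f) (i j : Fin N) (x : Euc N) :
    pd i (pd j f) x = pd j (pd i f) x := by
  have h := hf.contDiffAt.isSymmSndFDerivAt (x := x) (by simp)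
  change fderiv ℝ (fun y => fderiv ℝ f y _) x _ = fderiv ℝ (fun y => fderiv ℝ f y _) x _
  rw [fderiv_fderiv_apply hf.contDiffAt, fderiv_fderiv_apply hf.contDiffAt]
  exact h _ _

lemma integrableOn_of_continuous (hb : Bornology.IsBounded Ω) (hΩ : IsOpen Ω) {f : Euc N → ℝ}
    (hf : Continuous f) : IntegrableOn f Ω :=
  hf.continuousOn.integrableOn_of_subset_isCompact hb.isCompact_closure hΩ.measurableSet
    subset_closure hb.measure_lt_top.ne

lemma exists_mem_segment_frontier {x y : Euc N} (hx : x ∈ Ω) (hy : y ∉ Ω) :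
    ∃ w ∈ segment ℝ x y, w ∈ frontier Ω := by
  by_contra! hcon
  have hs : IsPreconnected (segment ℝ x y) := (convex_segment x y).isPreconnected
  obtain ⟨w, hw, h1, h2⟩ := hs (interior Ω) (closure Ω)ᶜ isOpen_interior
    isClosed_closure.isOpen_compl (fun w hw => by
      by_contra h
      simp only [mem_union, mem_compl_iff, not_or, not_not] at h
      exact hcon w hw ⟨h.2, h.1⟩)
    ⟨x, left_mem_segment ℝ x y, by
      by_contra h
      exact hcon x (left_mem_segment ℝ x y) ⟨subset_closure hx, h⟩⟩
    ⟨y, right_mem_segment ℝ x y, fun h => hcon y (right_mem_segment ℝ x y)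
      ⟨h, fun h' => hy (interior_subset h')⟩⟩
  exact h2 (subset_closure (interior_subset h1))

/-- The integral of a directional derivative of a function vanishing on the boundary. -/
lemma setIntegral_fderiv_eq_zero (hΩ : IsOpen Ω) (hb : Bornology.IsBounded Ω)
    (hnull : volume (frontier Ω) = 0) {g : Euc N → ℝ} (hg : ContDiff ℝ 1 g)
    (hg0 : ∀ x ∈ frontier Ω, g x = 0) (v : Euc N) : ∫ x in Ω, fderiv ℝ g x v = 0 := by
  obtain ⟨R, hR⟩ := hb.subset_closedBall 0
  obtain ⟨C, hC⟩ := (isCompact_closedBall (0 : Euc N) R).exists_bound_of_continuousOn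
    (hg.continuous_fderiv (by norm_num)).continuousOn
  have hdiff := hg.differentiable (by norm_num)
  have hlip0 : ∀ x ∈ closedBall (0 : Euc N) R, ∀ y ∈ closedBall (0 : Euc N) R,
      ‖g x - g y‖ ≤ |C| * ‖x - y‖ := fun x hx y hy =>
    (convex_closedBall (0 : Euc N) R).norm_image_sub_le_of_norm_fderiv_le
      (fun z _ => hdiff z) (fun z hz => (hC z hz).trans (le_abs_self C)) hy hx
  set G : Euc N → ℝ := Ω.indicator g with hG
  have key : ∀ x ∈ Ω, ∀ y ∉ Ω, ‖g x‖ ≤ |C| * ‖x - y‖ := fun x hx y hy => by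
    obtain ⟨w, hw, hwf⟩ := exists_mem_segment_frontier hx hy
    have hwR : w ∈ closedBall (0 : Euc N) R :=
      closure_minimal hR isClosed_closedBall (frontier_subset_closure hwf)
    have h1 := hlip0 x (hR hx) w hwR
    rw [hg0 w hwf, sub_zero] at h1
    refine h1.trans (mul_le_mul_of_nonneg_left ?_ (abs_nonneg C))
    obtain ⟨a, b, ha, hb', hab, rfl⟩ := hw
    have : x - (a • x + b • y) = b • (x - y) := by
      rw [show a = 1 - b by linarith]
      module
    rw [this, norm_smul, Real.norm_of_nonneg hb']
    exact mul_le_of_le_one_left (norm_nonneg _) (by linarith)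
  have hlip : LipschitzWith |C|.toNNReal G := by
    refine LipschitzWith.of_dist_le_mul fun x y => ?_
    rw [Real.coe_toNNReal _ (abs_nonneg C), dist_eq_norm, dist_eq_norm]
    by_cases hx : x ∈ Ω <;> by_cases hy : y ∈ Ω
    · simpa [hG, hx, hy] using hlip0 x (hR hx) y (hR hy)
    · simpa [hG, hx, hy] using key x hx y hy
    · simpa [hG, hx, hy, norm_sub_rev] using key y hy x hx
    · simpa [hG, hx, hy] using mul_nonneg (abs_nonneg C) (norm_nonneg (x - y))
  have hcs : HasCompactSupport G := HasCompactSupport.of_support_subset_isCompact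
    (isCompact_closedBall (0 : Euc N) R)
    ((Function.support_subset_iff'.2 fun x hx => indicator_of_notMem hx g).trans hR)
  have hint := LipschitzWith.integral_lineDeriv_mul_eq (μ := (volume : Measure (Euc N)))
    (LipschitzWith.const (1 : ℝ) (α := Euc N)) hlip hcs (-v)
  simp only [neg_neg, mul_one] at hint
  have h0 : ∀ x : Euc N, lineDeriv ℝ (fun _ : Euc N => (1 : ℝ)) x (-v) = 0 := fun x => by
    simp [lineDeriv]
  simp only [h0, zero_mul, integral_zero] at hint
  rw [hint, ← integral_indicator hΩ.measurableSet]
  refine integral_congr_ae ?_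
  filter_upwards [measure_eq_zero_iff_ae_notMem.1 hnull] with x hx
  by_cases hxΩ : x ∈ Ω
  · rw [indicator_of_mem hxΩ]
    have hev : G =ᶠ[𝓝 x] g := by
      filter_upwards [hΩ.mem_nhds hxΩ] with y hy
      exact indicator_of_mem hy g
    have hd : HasFDerivAt G (fderiv ℝ g x) x := (hdiff x).hasFDerivAt.congr_of_eventuallyEq hev
    rw [hd.differentiableAt.lineDeriv_eq_fderiv, hd.fderiv]
  · rw [indicator_of_notMem hxΩ]
    have hxcl : x ∉ closure Ω := fun h => by
      rcases mem_or_mem_frontier hΩ h with h | h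
      · exact hxΩ h
      · exact hx h
    have hev : G =ᶠ[𝓝 x] fun _ => (0 : ℝ) := by
      filter_upwards [isClosed_closure.isOpen_compl.mem_nhds hxcl] with y hy
      exact indicator_of_notMem (fun h => hy (subset_closure h)) g
    have hd : HasFDerivAt G (0 : Euc N →L[ℝ] ℝ) x :=
      (hasFDerivAt_const (0 : ℝ) x).congr_of_eventuallyEq hev
    rw [hd.differentiableAt.lineDeriv_eq_fderiv, hd.fderiv]
    rfl

/-- The divergence of a vector field. -/
def divergence (F : Fin N → Euc N → ℝ) (x : Euc N) : ℝ := ∑ i, pd i (F i) x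

lemma continuous_divergence {F : Fin N → Euc N → ℝ} (hF : ∀ i, ContDiff ℝ 1 (F i)) :
    Continuous (divergence F) :=
  continuous_finsetSum _ fun i _ => continuous_pd (hF i) i

lemma setIntegral_divergence_eq_zero (hΩ : IsOpen Ω) (hb : Bornology.IsBounded Ω)
    (hnull : volume (frontier Ω) = 0) {F : Fin N → Euc N → ℝ} (hF : ∀ i, ContDiff ℝ 1 (F i))
    (hF0 : ∀ x ∈ frontier Ω, ∀ i, F i x = 0) : ∫ x in Ω, divergence F x = 0 := by
  unfold divergence
  rw [integral_finsetSum _ fun i _ => integrableOn_of_continuous hb hΩ (continuous_pd (hF i) i)]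
  exact Finset.sum_eq_zero fun i _ =>
    setIntegral_fderiv_eq_zero hΩ hb hnull (hF i) (fun x hx => hF0 x hx i) _

lemma divergence_mul {f : Euc N → ℝ} {F : Fin N → Euc N → ℝ} {x : Euc N}
    (hf : DifferentiableAt ℝ f x) (hF : ∀ i, DifferentiableAt ℝ (F i) x) :
    divergence (fun i y => f y * F i y) x = f x * divergence F x + ∑ i, F i x * pd i f x := by
  simp only [divergence, pd_mul hf (hF _), Finset.sum_add_distrib, Finset.mul_sum]

lemma divergence_sub {F G : Fin N → Euc N → ℝ} {x : Euc N} (hF : ∀ i, DifferentiableAt ℝ (F i) x)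
    (hG : ∀ i, DifferentiableAt ℝ (G i) x) :
    divergence (fun i y => F i y - G i y) x = divergence F x - divergence G x := by
  simp only [divergence, pd_sub (hF _) (hG _), Finset.sum_sub_distrib]

lemma divergence_add {F G : Fin N → Euc N → ℝ} {x : Euc N} (hF : ∀ i, DifferentiableAt ℝ (F i) x)
    (hG : ∀ i, DifferentiableAt ℝ (G i) x) :
    divergence (fun i y => F i y + G i y) x = divergence F x + divergence G x := by
  simp only [divergence, pd_add (hF _) (hG _), Finset.sum_add_distrib]

lemma divergence_const_mul {F : Fin N → Euc N → ℝ} {x : Euc N}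
    (hF : ∀ i, DifferentiableAt ℝ (F i) x) (a : ℝ) :
    divergence (fun i y => a * F i y) x = a * divergence F x := by
  simp only [divergence, pd_const_mul (hF _), Finset.mul_sum]

end Divergence

section Flux

variable {N : ℕ} {Ω : Set (Euc N)} {ψ φ : Euc N → ℝ}

/-- A positive superharmonic function which vanishes on the boundary of the bounded open set `Ω`,
with nonzero boundary gradient. -/
structure BoundarySol (Ω : Set (Euc N)) (ψ : Euc N → ℝ) : Prop where
  isOpen : IsOpen Ω
  isBounded : Bornology.IsBounded Ω
  volume_frontier : volume (frontier Ω) = 0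
  contDiff : ContDiff ℝ 2 ψ
  pos : ∀ x ∈ Ω, 0 < ψ x
  zero : ∀ x ∈ frontier Ω, ψ x = 0
  lapl_nonpos : ∀ x ∈ Ω, lapl ψ x ≤ 0
  grad_pos : ∀ x ∈ frontier Ω, 0 < ∑ i, pd i ψ x ^ 2

lemma BoundarySol.nonneg (h : BoundarySol Ω ψ) : ∀ x ∈ closure Ω, 0 ≤ ψ x := fun x hx => by
  rcases mem_or_mem_frontier h.isOpen hx with hx | hx
  · exact (h.pos x hx).le
  · exact (h.zero x hx).ge

lemma BoundarySol.setIntegral_cutoff (h : BoundarySol Ω ψ) {F : Fin N → Euc N → ℝ}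
    (hF : ∀ i, ContDiff ℝ 1 (F i)) (s : ℝ) :
    ∫ x in Ω, (1 - Real.exp (-s * ψ x)) * divergence F x =
      -∫ x in Ω, s * Real.exp (-s * ψ x) * ∑ i, F i x * pd i ψ x := by
  have hψ1 : ContDiff ℝ 1 ψ := h.contDiff.of_le (by norm_num)
  have hψd : Differentiable ℝ ψ := hψ1.differentiable (by norm_num)
  have hE : ContDiff ℝ 1 fun x => 1 - Real.exp (-s * ψ x) := by fun_prop
  have hpd : ∀ i x, pd i (fun x => 1 - Real.exp (-s * ψ x)) x
      = s * Real.exp (-s * ψ x) * pd i ψ x := fun i x => by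
    rw [pd_sub (by fun_prop) (by fun_prop), pd_exp (by fun_prop), pd_const_mul (hψd x), pd_const]
    ring
  have h0 := setIntegral_divergence_eq_zero h.isOpen h.isBounded h.volume_frontier
    (F := fun i y => (1 - Real.exp (-s * ψ y)) * F i y) (fun i => hE.mul (hF i))
    (fun x hx i => by simp [h.zero x hx])
  have hFc : ∀ i, Continuous (F i) := fun i => (hF i).continuous
  have hψc := hψ1.continuous
  have hpc := fun i => continuous_pd hψ1 i
  have hdc := continuous_divergence hF
  rw [eq_neg_iff_add_eq_zero, ← integral_add
    (integrableOn_of_continuous h.isBounded h.isOpen (by fun_prop))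
    (integrableOn_of_continuous h.isBounded h.isOpen (by fun_prop)), ← h0]
  refine integral_congr_ae (Eventually.of_forall fun x => ?_)
  dsimp only
  rw [divergence_mul ((hE.differentiable (by norm_num)) x)
    (fun i => (hF i).differentiable (by norm_num) x)]
  congr 1
  simp only [hpd, Finset.mul_sum]
  exact Finset.sum_congr rfl fun i _ => by ring

lemma BoundarySol.exists_le (h : BoundarySol Ω ψ) {q : Euc N → ℝ} (hq : Continuous q)
    (hqpos : ∀ x ∈ frontier Ω, 0 < q x) : ∃ C : ℝ, 0 ≤ C ∧ ∀ x ∈ closure Ω, -q x ≤ C * ψ x := by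
  have hcpt := h.isBounded.isCompact_closure
  obtain ⟨M, hM⟩ := hcpt.exists_bound_of_continuousOn hq.continuousOn
  have hK : IsCompact (closure Ω ∩ {x | q x ≤ 0}) :=
    hcpt.inter_right (isClosed_le hq continuous_const)
  obtain ⟨κ, hκ, hκψ⟩ := hK.exists_forall_le' (f := ψ) (a := 0) h.contDiff.continuous.continuousOn
    (fun x hx => by
      rcases mem_or_mem_frontier h.isOpen hx.1 with hx' | hx'
      · exact h.pos x hx'
      · exact absurd (hqpos x hx') (not_lt.2 hx.2))
  refine ⟨|M| / κ, by positivity, fun x hx => ?_⟩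
  by_cases hqx : q x ≤ 0
  · have h1 := hκψ x ⟨hx, hqx⟩
    have h2 := hM x hx
    rw [Real.norm_eq_abs] at h2
    calc -q x ≤ |M| := (neg_le_abs _).trans (h2.trans (le_abs_self M))
      _ = |M| / κ * κ := by field_simp
      _ ≤ |M| / κ * ψ x := by gcongr
  · have := h.nonneg x hx
    have : 0 ≤ |M| / κ * ψ x := by positivity
    linarith

lemma BoundarySol.tendsto_exp (h : BoundarySol Ω ψ) {x : Euc N} (hx : x ∈ Ω) :
    Tendsto (fun n : ℕ => Real.exp (-(n : ℝ) * ψ x)) atTop (𝓝 0) := by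
  refine Real.tendsto_exp_atBot.comp ?_
  have := (tendsto_natCast_atTop_atTop (R := ℝ)).atTop_mul_const (h.pos x hx)
  simpa [Function.comp_def] using tendsto_neg_atTop_atBot.comp this

lemma mul_exp_neg_le_one (t : ℝ) : t * Real.exp (-t) ≤ 1 := by
  rw [Real.exp_neg, ← div_eq_mul_inv, div_le_one (Real.exp_pos t)]
  linarith [Real.add_one_le_exp t]

/-- A field which points inward along the boundary has nonpositive total divergence. -/
lemma BoundarySol.setIntegral_divergence_nonpos (h : BoundarySol Ω ψ) {F : Fin N → Euc N → ℝ}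
    (hF : ∀ i, ContDiff ℝ 1 (F i)) (hFψ : ∀ x ∈ frontier Ω, 0 ≤ ∑ i, F i x * pd i ψ x) :
    ∫ x in Ω, divergence F x ≤ 0 := by
  have hψ1 : ContDiff ℝ 1 ψ := h.contDiff.of_le (by norm_num)
  have hψc := hψ1.continuous
  have hFc : ∀ i, Continuous (F i) := fun i => (hF i).continuous
  have hpc := fun i => continuous_pd hψ1 i
  have hdc := continuous_divergence hF
  have hlc := continuous_lapl h.contDiff
  have hio : ∀ {f : Euc N → ℝ}, Continuous f → IntegrableOn f Ω := fun hf =>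
    integrableOn_of_continuous h.isBounded h.isOpen hf
  set G : ℝ := ∫ x in Ω, -lapl ψ x with hG
  have hG0 : 0 ≤ G := setIntegral_nonneg h.isOpen.measurableSet fun x hx => by
    linarith [h.lapl_nonpos x hx]
  have hgrad : ∀ s : ℝ, 0 ≤ s →
      ∫ x in Ω, s * Real.exp (-s * ψ x) * ∑ i, pd i ψ x * pd i ψ x ≤ G := fun s hs => by
    have h1 := h.setIntegral_cutoff (F := fun i => pd i ψ) (fun i => contDiff_pd h.contDiff i) s
    rw [eq_comm, neg_eq_iff_eq_neg, ← integral_neg] at h1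
    rw [h1]
    refine setIntegral_mono_on (hio (by
      have := continuous_divergence (F := fun i => pd i ψ) (fun i => contDiff_pd h.contDiff i)
      fun_prop)) (hio (by fun_prop)) h.isOpen.measurableSet fun x hx => ?_
    change -((1 - Real.exp (-s * ψ x)) * lapl ψ x) ≤ -lapl ψ x
    have := h.lapl_nonpos x hx
    nlinarith [mul_nonneg (Real.exp_pos (-s * ψ x)).le (neg_nonneg.2 this)]
  have hdelta : ∀ δ : ℝ, 0 < δ → ∫ x in Ω, divergence F x ≤ δ * G := fun δ hδ => by
    obtain ⟨C, hC0, hC⟩ := h.exists_le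
      (q := fun x => (∑ i, F i x * pd i ψ x) + δ * ∑ i, pd i ψ x * pd i ψ x) (by fun_prop)
      (fun x hx => by
        have h1 := hFψ x hx
        have h2 := mul_pos hδ (h.grad_pos x hx)
        simp only [sq] at h2
        linarith)
    have hn : ∀ n : ℕ, ∫ x in Ω, (1 - Real.exp (-(n : ℝ) * ψ x)) * divergence F x ≤
        δ * G + C * ∫ x in Ω, ((n : ℝ) * ψ x) * Real.exp (-((n : ℝ) * ψ x)) := fun n => by
      rw [h.setIntegral_cutoff hF]
      have h2 := mul_le_mul_of_nonneg_left (hgrad n n.cast_nonneg) hδ.le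
      rw [← integral_neg]
      refine le_trans ?_ (add_le_add_left h2 _)
      rw [← integral_const_mul, ← integral_const_mul,
        ← integral_add (hio (by fun_prop)) (hio (by fun_prop))]
      refine setIntegral_mono_on (hio (by fun_prop)) (hio (by fun_prop)) h.isOpen.measurableSet
        fun x hx => ?_
      have h3 := hC x (subset_closure hx)
      have h4 : 0 ≤ (n : ℝ) * Real.exp (-(n : ℝ) * ψ x) := by positivity
      have h5 := mul_le_mul_of_nonneg_left h3 h4
      rw [neg_mul] at *
      nlinarith
    have hl1 : Tendsto (fun n : ℕ => ∫ x in Ω, (1 - Real.exp (-(n : ℝ) * ψ x)) * divergence F x)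
        atTop (𝓝 (∫ x in Ω, divergence F x)) := by
      refine tendsto_integral_of_dominated_convergence (fun x => ‖divergence F x‖)
        (fun n => (hio (by fun_prop)).aestronglyMeasurable) (hio hdc).norm (fun n => ?_) ?_
      · filter_upwards [ae_restrict_mem h.isOpen.measurableSet] with x hx
        rw [norm_mul]
        refine mul_le_of_le_one_left (norm_nonneg _) ?_
        have h1 : Real.exp (-(n : ℝ) * ψ x) ≤ 1 := Real.exp_le_one_iff.2 (by
          have := h.pos x hx
          have : 0 ≤ (n : ℝ) * ψ x := by positivity
          linarith)
        rw [Real.norm_of_nonneg (by linarith)]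
        linarith [Real.exp_pos (-(n : ℝ) * ψ x)]
      · filter_upwards [ae_restrict_mem h.isOpen.measurableSet] with x hx
        simpa using ((h.tendsto_exp hx).const_sub 1).mul_const (divergence F x)
    have hl2 : Tendsto (fun n : ℕ => ∫ x in Ω, ((n : ℝ) * ψ x) * Real.exp (-((n : ℝ) * ψ x)))
        atTop (𝓝 (∫ _ in Ω, (0 : ℝ))) := by
      refine tendsto_integral_of_dominated_convergence (fun _ => (1 : ℝ))
        (fun n => (hio (by fun_prop)).aestronglyMeasurable) (hio continuous_const) (fun n => ?_) ?_
      · filter_upwards [ae_restrict_mem h.isOpen.measurableSet] with x hx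
        have := h.pos x hx
        rw [Real.norm_of_nonneg (by positivity)]
        exact mul_exp_neg_le_one _
      · filter_upwards [ae_restrict_mem h.isOpen.measurableSet] with x hx
        have h1 : Tendsto (fun n : ℕ => (n : ℝ) * ψ x) atTop atTop :=
          (tendsto_natCast_atTop_atTop (R := ℝ)).atTop_mul_const (h.pos x hx)
        have := (Real.tendsto_pow_mul_exp_neg_atTop_nhds_zero 1).comp h1
        simpa [Function.comp_def] using this
    have := le_of_tendsto_of_tendsto' hl1 ((hl2.const_mul C).const_add (δ * G)) hn
    simpa using this
  by_contra! hcon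
  have h1 := hdelta ((∫ x in Ω, divergence F x) / (2 * (G + 1))) (by positivity)
  have h2 : (∫ x in Ω, divergence F x) / (2 * (G + 1)) * G
      = (∫ x in Ω, divergence F x) * (G / (2 * (G + 1))) := by ring
  have h3 : G / (2 * (G + 1)) < 1 := by
    rw [div_lt_one (by positivity)]
    linarith
  nlinarith

lemma BoundarySol.setIntegral_divergence_eq_zero (h : BoundarySol Ω ψ) {F : Fin N → Euc N → ℝ}
    (hF : ∀ i, ContDiff ℝ 1 (F i)) (hFψ : ∀ x ∈ frontier Ω, ∑ i, F i x * pd i ψ x = 0) :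
    ∫ x in Ω, divergence F x = 0 := by
  refine le_antisymm (h.setIntegral_divergence_nonpos hF fun x hx => (hFψ x hx).ge) ?_
  have h1 := h.setIntegral_divergence_nonpos (F := fun i y => (-1) * F i y)
    (fun i => contDiff_const.mul (hF i))
    (fun x hx => by
      have : ∑ i, (-1) * F i x * pd i ψ x = -∑ i, F i x * pd i ψ x := by
        rw [← Finset.sum_neg_distrib]
        exact Finset.sum_congr rfl fun i _ => by ring
      rw [this, hFψ x hx, neg_zero])
  simp only [divergence_const_mul (fun i => (hF i).differentiable (by norm_num) _),
    integral_const_mul] at h1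
  linarith

/-- If the flux of `∇φ` through the boundary has one sign and total flux zero, all its moments
vanish. -/
lemma BoundarySol.setIntegral_divergence_mul_pd (h : BoundarySol Ω ψ) (hφ : ContDiff ℝ 2 φ)
    (hint : ∫ x in Ω, lapl φ x = 0)
    (hsign : ∀ x ∈ frontier Ω, 0 ≤ ∑ i, pd i φ x * pd i ψ x) {q : Euc N → ℝ}
    (hq : ContDiff ℝ 1 q) : ∫ x in Ω, divergence (fun i y => q y * pd i φ y) x = 0 := by
  obtain ⟨H, hH⟩ := h.isBounded.isCompact_closure.exists_bound_of_continuousOn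
    hq.continuous.continuousOn
  have hp : ∀ i, ContDiff ℝ 1 (pd i φ) := contDiff_pd hφ
  have key : ∀ a : ℝ, |a| ≤ 1 →
      a * ∫ x in Ω, divergence (fun i y => q y * pd i φ y) x ≤ 0 := fun a ha => by
    have h1 := h.setIntegral_divergence_nonpos
      (F := fun i y => H * pd i φ y + a * (q y * pd i φ y)) (fun i => by fun_prop)
      (fun x hx => by
        have : ∑ i, (H * pd i φ x + a * (q x * pd i φ x)) * pd i ψ x
            = (H + a * q x) * ∑ i, pd i φ x * pd i ψ x := by
          rw [Finset.mul_sum]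
          exact Finset.sum_congr rfl fun i _ => by ring
        rw [this]
        refine mul_nonneg ?_ (hsign x hx)
        have h2 : |a * q x| ≤ H := by
          rw [abs_mul]
          have := hH x (frontier_subset_closure hx)
          rw [Real.norm_eq_abs] at this
          nlinarith [abs_nonneg a, abs_nonneg (q x)]
        linarith [neg_abs_le (a * q x)])
    have hd1 : ∀ i, Differentiable ℝ (pd i φ) := fun i => (hp i).differentiable (by norm_num)
    have hd2 : Differentiable ℝ q := hq.differentiable (by norm_num)
    have hsplit : ∀ x, divergence (fun i y => H * pd i φ y + a * (q y * pd i φ y)) x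
        = H * lapl φ x + a * divergence (fun i y => q y * pd i φ y) x := fun x => by
      rw [divergence_add (by fun_prop) (by fun_prop), divergence_const_mul (by fun_prop),
        divergence_const_mul (by fun_prop)]
      rfl
    simp only [hsplit] at h1
    have hc1 := continuous_lapl hφ
    have hc2 := continuous_divergence (F := fun i y => q y * pd i φ y) (fun i => hq.mul (hp i))
    rw [integral_add (integrableOn_of_continuous h.isBounded h.isOpen (by fun_prop))
      (integrableOn_of_continuous h.isBounded h.isOpen (by fun_prop)), integral_const_mul,
      integral_const_mul, hint] at h1
    linarith
  have h1 := key 1 (by simp)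
  have h2 := key (-1) (by simp)
  linarith

end Flux

section Overdetermined

variable {N : ℕ} {Ω : Set (Euc N)} {ψ φ : Euc N → ℝ}

/-- Multiplication of `φ` by the exponential weight `exp (τ x_i)`. -/
def expWeight (τ : ℝ) (i : Fin N) (φ : Euc N → ℝ) (y : Euc N) : ℝ := Real.exp (τ * y i) * φ y

lemma contDiff_expWeight {n : WithTop ℕ∞} (τ : ℝ) (i : Fin N) (hφ : ContDiff ℝ n φ) :
    ContDiff ℝ n (expWeight τ i φ) := by
  unfold expWeight
  fun_prop

lemma pd_expWeight (τ : ℝ) (i j : Fin N) (hφ : Differentiable ℝ φ) :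
    pd j (expWeight τ i φ) =
      expWeight τ i fun y => pd j φ y + (if j = i then τ else 0) * φ y := by
  funext y
  unfold expWeight
  have hd : DifferentiableAt ℝ (fun y : Euc N => τ * y i) y := by fun_prop
  rw [pd_mul hd.exp (hφ y), pd_exp hd, pd_const_mul (by fun_prop), pd_coord]
  split_ifs <;> ring

lemma lapl_expWeight (τ : ℝ) (i : Fin N) (hφ : ContDiff ℝ 2 φ) (x : Euc N) :
    lapl (expWeight τ i φ) x =
      Real.exp (τ * x i) * (lapl φ x + 2 * τ * pd i φ x + τ ^ 2 * φ x) := by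
  have hd : Differentiable ℝ φ := hφ.differentiable (by norm_num)
  have hpd : ∀ j, Differentiable ℝ (pd j φ) := fun j =>
    (contDiff_pd hφ j).differentiable (by norm_num)
  have h1 : ∀ j, pd j (pd j (expWeight τ i φ)) x = Real.exp (τ * x i) * pd j (pd j φ) x +
      if j = i then Real.exp (τ * x i) * (2 * τ * pd j φ x + τ ^ 2 * φ x) else 0 := fun j => by
    rw [pd_expWeight τ i j hd, pd_expWeight τ i j (by fun_prop)]
    unfold expWeight
    dsimp only
    rw [pd_add (hpd j x) (by fun_prop), pd_const_mul (hd x)]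
    split_ifs <;> ring
  rw [lapl_eq_sum_pd, lapl_eq_sum_pd]
  simp only [h1, Finset.sum_add_distrib, Finset.sum_ite_eq', Finset.mem_univ, if_true]
  rw [← Finset.mul_sum]
  ring

lemma setIntegral_sq_le_of_eq_zero (hΩ : IsOpen Ω) (hb : Bornology.IsBounded Ω)
    (hnull : volume (frontier Ω) = 0) {v : Euc N → ℝ} (hv : ContDiff ℝ 2 v)
    (hv0 : ∀ x ∈ frontier Ω, v x = 0) (i : Fin N) {R : ℝ} (hR : Ω ⊆ closedBall 0 R) :
    ∫ x in Ω, v x ^ 2 ≤ 4 * R ^ 2 * ∫ x in Ω, pd i v x ^ 2 := by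
  have hv1 : ContDiff ℝ 1 v := hv.of_le (by norm_num)
  have hvd : Differentiable ℝ v := hv1.differentiable (by norm_num)
  have hvc := hv1.continuous
  have hpc := continuous_pd hv1 i
  have hio : ∀ {f : Euc N → ℝ}, Continuous f → IntegrableOn f Ω := fun hf =>
    integrableOn_of_continuous hb hΩ hf
  have h0 := setIntegral_fderiv_eq_zero hΩ hb hnull (g := fun y => y i * (v y * v y))
    (by fun_prop) (fun x hx => by simp [hv0 x hx]) (EuclideanSpace.single i 1)
  have h1 : ∀ x, fderiv ℝ (fun y => y i * (v y * v y)) x (EuclideanSpace.single i 1)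
      = v x ^ 2 + 2 * x i * (v x * pd i v x) := fun x => by
    change pd i (fun y => y i * (v y * v y)) x = _
    rw [pd_mul (by fun_prop) (by fun_prop), pd_mul (hvd x) (hvd x), pd_coord]
    simp only [if_true]
    ring
  simp only [h1] at h0
  have h2 : ∫ x in Ω, (v x ^ 2 + 2 * x i * (v x * pd i v x)) ≥
      ∫ x in Ω, (1 / 2 * v x ^ 2 - 2 * R ^ 2 * pd i v x ^ 2) := by
    refine setIntegral_mono_on (hio (by fun_prop)) (hio (by fun_prop)) hΩ.measurableSet
      fun x hx => ?_
    have h3 : |x i| ≤ R := by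
      have := hR hx
      rw [mem_closedBall_zero_iff] at this
      exact (PiLp.norm_apply_le x i).trans this
    have h4 : x i ^ 2 ≤ R ^ 2 := sq_le_sq' (neg_le_of_abs_le h3) (le_of_abs_le h3)
    nlinarith [sq_nonneg (v x + 2 * x i * pd i v x),
      mul_le_mul_of_nonneg_right h4 (sq_nonneg (pd i v x))]
  rw [h0, integral_sub (hio (by fun_prop)) (hio (by fun_prop)), integral_const_mul,
    integral_const_mul] at h2
  linarith

/-- A solution of a linear equation with zero boundary values and with a boundary gradient along
`∇ψ` of one sign and of total flux zero vanishes. -/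
lemma BoundarySol.eq_zero_of_overdetermined (h : BoundarySol Ω ψ) (i : Fin N)
    (hφ : ContDiff ℝ 2 φ) (hφ0 : ∀ x ∈ frontier Ω, φ x = 0)
    (hint : ∫ x in Ω, lapl φ x = 0)
    (hpar : ∀ x ∈ frontier Ω, ∃ k : ℝ, ∀ j, pd j φ x = k * pd j ψ x)
    (hsign : ∀ x ∈ frontier Ω, 0 ≤ ∑ j, pd j φ x * pd j ψ x) {M : ℝ}
    (hM : ∀ x ∈ Ω, |lapl φ x| ≤ M * |φ x|) : ∀ x ∈ Ω, φ x = 0 := by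
  obtain ⟨R, hR⟩ := h.isBounded.subset_closedBall (0 : Euc N)
  set τ : ℝ := (|M| * (4 * R ^ 2 + 1)) / 4 + 1 with hτ
  have hτ0 : 0 < τ := by positivity
  set v := expWeight τ i φ with hv
  have hvC : ContDiff ℝ 2 v := contDiff_expWeight τ i hφ
  have hv1 : ContDiff ℝ 1 v := hvC.of_le (by norm_num)
  have hvd : Differentiable ℝ v := hv1.differentiable (by norm_num)
  have hφd : Differentiable ℝ φ := hφ.differentiable (by norm_num)
  have hv0 : ∀ x ∈ frontier Ω, v x = 0 := fun x hx => by simp [hv, expWeight, hφ0 x hx]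
  have hp : ∀ j, ContDiff ℝ 1 (pd j v) := contDiff_pd hvC
  have hpφ : ∀ j, ContDiff ℝ 1 (pd j φ) := contDiff_pd hφ
  have hpd : ∀ j, Differentiable ℝ (pd j v) := fun j => (hp j).differentiable (by norm_num)
  have hvc := hvC.continuous
  have hpc : ∀ j, Continuous (pd j v) := fun j => (hp j).continuous
  have hlc := continuous_lapl hvC
  have hlφ := continuous_lapl hφ
  have hio : ∀ {f : Euc N → ℝ}, Continuous f → IntegrableOn f Ω := fun hf =>
    integrableOn_of_continuous h.isBounded h.isOpen hf
  have hpar' : ∀ x ∈ frontier Ω, ∃ k : ℝ, ∀ j, pd j v x = k * pd j ψ x ∧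
      Real.exp (τ * x i) * pd j φ x = k * pd j ψ x := fun x hx => by
    obtain ⟨k, hk⟩ := hpar x hx
    refine ⟨Real.exp (τ * x i) * k, fun j => ?_⟩
    rw [hv, pd_expWeight τ i j hφd]
    simp only [expWeight, hφ0 x hx, hk j]
    constructor <;> ring
  -- the Rellich identity
  set q : Euc N → ℝ := fun y => Real.exp (τ * y i) * pd i v y with hq
  have hqC : ContDiff ℝ 1 q := by
    have := hp i
    fun_prop
  have hqd : Differentiable ℝ q := hqC.differentiable (by norm_num)
  have hmom := h.setIntegral_divergence_mul_pd hφ hint hsign hqC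
  have hpφd : ∀ j, Differentiable ℝ (pd j φ) := fun j => (hpφ j).differentiable (by norm_num)
  set S : Euc N → ℝ := fun y => ∑ k, pd k v y * pd k v y with hS
  have hSC : ContDiff ℝ 1 S := by fun_prop
  have hSd : Differentiable ℝ S := hSC.differentiable (by norm_num)
  set δ : Fin N → ℝ := fun j => if j = i then 1 else 0 with hδ
  have hrel := h.setIntegral_divergence_eq_zero
    (F := fun j y => pd i v y * pd j v y -
      ((1 / 2 * δ j) * S y + 1 / 2 * (q y * pd j φ y)))
    (fun j => by fun_prop)
    (fun x hx => by
      obtain ⟨k, hk⟩ := hpar' x hx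
      have h1 : ∀ j, (pd i v x * pd j v x - ((1 / 2 * δ j) * S x + 1 / 2 * (q x * pd j φ x)))
          * pd j ψ x = 1 / 2 * k ^ 2 * pd i ψ x * (pd j ψ x * pd j ψ x)
            - if j = i then 1 / 2 * S x * pd j ψ x else 0 := fun j => by
        have h2 : q x * pd j φ x = k * pd i ψ x * (k * pd j ψ x) := by
          rw [← (hk j).2, ← (hk i).1]
          simp only [hq]
          ring
        rw [h2, (hk i).1, (hk j).1, hδ]
        dsimp only
        split_ifs <;> ring
      simp only [h1, Finset.sum_sub_distrib, Finset.sum_ite_eq', Finset.mem_univ, if_true]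
      rw [← Finset.mul_sum]
      have h3 : S x = k ^ 2 * ∑ k, pd k ψ x * pd k ψ x := by
        rw [hS, Finset.mul_sum]
        exact Finset.sum_congr rfl fun j _ => by rw [(hk j).1]; ring
      rw [h3]
      ring)
  have hdiv : ∀ x, divergence (fun j y => pd i v y * pd j v y -
      ((1 / 2 * δ j) * S y + 1 / 2 * (q y * pd j φ y))) x = pd i v x * lapl v x
        - 1 / 2 * divergence (fun j y => q y * pd j φ y) x := fun x => by
    rw [divergence_sub (by fun_prop) (by fun_prop), divergence_add (by fun_prop) (by fun_prop),
      divergence_const_mul (by fun_prop), divergence_mul (hpd i x) (by fun_prop)]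
    have h1 : divergence (fun j y => 1 / 2 * δ j * S y) x = 1 / 2 * pd i S x := by
      simp only [divergence, pd_const_mul (hSd x)]
      simp [hδ]
    have h2 : pd i S x = 2 * ∑ j, pd j v x * pd j (pd i v) x := by
      have : pd i S x = ∑ j, pd i (fun y => pd j v y * pd j v y) x := by
        simp only [pd, hS]
        rw [fderiv_fun_sum fun j _ => by fun_prop]
        simp
      rw [this, Finset.mul_sum]
      refine Finset.sum_congr rfl fun j _ => ?_
      rw [pd_mul (hpd j x) (hpd j x), pd_comm hvC i j]
      ring
    rw [h1, h2]
    change pd i v x * lapl v x + _ - _ = _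
    ring
  simp only [hdiv] at hrel
  have hdc := continuous_divergence (F := fun j y => q y * pd j φ y) (fun j => hqC.mul (hpφ j))
  rw [integral_sub (hio (by fun_prop)) (hio (by fun_prop)), integral_const_mul, hmom, mul_zero,
    sub_zero] at hrel
  have hvv := setIntegral_fderiv_eq_zero h.isOpen h.isBounded h.volume_frontier
    (g := fun y => v y * v y) (by fun_prop) (fun x hx => by simp [hv0 x hx])
    (EuclideanSpace.single i 1)
  have h1 : ∀ x, fderiv ℝ (fun y => v y * v y) x (EuclideanSpace.single i 1)
      = 2 * (v x * pd i v x) := fun x => by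
    change pd i (fun y => v y * v y) x = _
    rw [pd_mul (hvd x) (hvd x)]
    ring
  simp only [h1, integral_const_mul] at hvv
  have hpoin := setIntegral_sq_le_of_eq_zero h.isOpen h.isBounded h.volume_frontier hvC hv0 i hR
  have hsplit : ∀ x, pd i v x * lapl v x = pd i v x * (Real.exp (τ * x i) * lapl φ x)
      + (2 * τ * pd i v x ^ 2 - τ ^ 2 * (v x * pd i v x)) := fun x => by
    rw [hv, lapl_expWeight τ i hφ, pd_expWeight τ i i hφd]
    simp only [expWeight, if_true]
    ring
  simp only [hsplit] at hrel
  rw [integral_add (hio (by fun_prop)) (hio (by fun_prop)),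
    integral_sub (hio (by fun_prop)) (hio (by fun_prop)), integral_const_mul,
    integral_const_mul] at hrel
  have hlow : ∫ x in Ω, (-(|M| / 2) * v x ^ 2 - |M| / 2 * pd i v x ^ 2) ≤
      ∫ x in Ω, pd i v x * (Real.exp (τ * x i) * lapl φ x) := by
    refine setIntegral_mono_on (hio (by fun_prop)) (hio (by fun_prop)) h.isOpen.measurableSet
      fun x hx => ?_
    have h2 : |Real.exp (τ * x i) * lapl φ x| ≤ |M| * |v x| := by
      rw [hv, expWeight, abs_mul, abs_mul, Real.abs_exp]
      have h3 := (hM x hx).trans (mul_le_mul_of_nonneg_right (le_abs_self M) (abs_nonneg (φ x)))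
      nlinarith [mul_le_mul_of_nonneg_left h3 (Real.exp_pos (τ * x i)).le]
    have h4 : |pd i v x * (Real.exp (τ * x i) * lapl φ x)| ≤ |pd i v x| * (|M| * |v x|) := by
      rw [abs_mul]
      exact mul_le_mul_of_nonneg_left h2 (abs_nonneg _)
    have h5 := neg_abs_le (pd i v x * (Real.exp (τ * x i) * lapl φ x))
    rw [← sq_abs (v x), ← sq_abs (pd i v x)]
    nlinarith [mul_nonneg (abs_nonneg M) (sq_nonneg (|v x| - |pd i v x|))]
  rw [integral_sub (hio (by fun_prop)) (hio (by fun_prop)), integral_const_mul,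
    integral_const_mul] at hlow
  set D := ∫ x in Ω, pd i v x ^ 2 with hD
  set W := ∫ x in Ω, v x ^ 2 with hW
  have hvv' : ∫ x in Ω, v x * pd i v x = 0 := by linarith
  rw [hvv', mul_zero, sub_zero] at hrel
  have hD0 : 0 ≤ D := setIntegral_nonneg h.isOpen.measurableSet fun x _ => sq_nonneg _
  have hW0 : 0 ≤ W := setIntegral_nonneg h.isOpen.measurableSet fun x _ => sq_nonneg _
  have hMW : |M| / 2 * W ≤ |M| / 2 * (4 * R ^ 2 * D) :=
    mul_le_mul_of_nonneg_left hpoin (by positivity)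
  have hDle : D ≤ 0 := by
    have : 2 * τ * D = |M| / 2 * (4 * R ^ 2 * D) + |M| / 2 * D + 2 * D := by
      rw [hτ]
      ring
    linarith
  have hD' : D = 0 := le_antisymm hDle hD0
  have hW' : W = 0 := by
    rw [hD', mul_zero] at hpoin
    exact le_antisymm hpoin hW0
  have hae := (setIntegral_eq_zero_iff_of_nonneg_ae (Eventually.of_forall fun x => sq_nonneg (v x))
    (hio (f := fun x => v x ^ 2) (by fun_prop))).1 hW'
  have heq := Measure.eqOn_open_of_ae_eq hae h.isOpen (by fun_prop) continuousOn_const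
  intro x hx
  have h2 : v x ^ 2 = 0 := heq hx
  have h3 : Real.exp (τ * x i) * φ x = 0 := pow_eq_zero_iff (two_ne_zero) |>.1 h2
  exact (mul_eq_zero.1 h3).resolve_left (Real.exp_pos _).ne'

end Overdetermined

section Kernel

variable {N : ℕ} {Ω : Set (Euc N)} {e : Euc N} {ψ φ c g : Euc N → ℝ}

lemma SymDomain.planeRefl_zero_mem (hΩ : SymDomain Ω e) {x : Euc N} (hx : x ∈ Ω) :
    planeRefl e 0 x ∈ Ω :=
  hΩ.steiner x hx _ (by rw [show ⟪x, e⟫ + 2 * (0 - ⟪x, e⟫) = -⟪x, e⟫ by ring, abs_neg])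

lemma SymDomain.planeRefl_zero_mem_closure (hΩ : SymDomain Ω e) {x : Euc N}
    (hx : x ∈ closure Ω) : planeRefl e 0 x ∈ closure Ω :=
  map_mem_closure (continuous_planeRefl 0) hx fun _ h => hΩ.planeRefl_zero_mem h

lemma SymDomain.planeRefl_zero_mem_frontier (hΩ : SymDomain Ω e) {x : Euc N}
    (hx : x ∈ frontier Ω) : planeRefl e 0 x ∈ frontier Ω := by
  rw [hΩ.isOpen.frontier_eq] at hx ⊢
  refine ⟨hΩ.planeRefl_zero_mem_closure hx.1, fun h => hx.2 ?_⟩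
  simpa [planeRefl_planeRefl hΩ.norm_eq] using hΩ.planeRefl_zero_mem h

lemma planeRefl_zero_of_inner_eq_zero {x : Euc N} (h : ⟪x, e⟫ = 0) : planeRefl e 0 x = x := by
  simp [planeRefl, h]

/-- Solutions of the linearized equation inherit the symmetries of the domain. -/
lemma PosSol.planeRefl_eq_of_lapl_eq (hψ : PosSol Ω ψ c g) (hΩ : SymDomain Ω e)
    (hc : ∀ x ∈ Ω, c (planeRefl e 0 x) = c x) (hφ : ContDiff ℝ 2 φ)
    (hφ0 : ∀ x ∈ frontier Ω, φ x = 0) (hφeq : ∀ x ∈ Ω, lapl φ x = -c x * φ x) :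
    ∀ x ∈ closure Ω, φ (planeRefl e 0 x) = φ x := by
  have hcomp : ContDiff ℝ 2 fun x => φ (planeRefl e 0 x) := hφ.comp (contDiff_planeRefl 0)
  have hv : ContDiff ℝ 2 fun x => φ x - φ (planeRefl e 0 x) := hφ.sub hcomp
  have hveq : ∀ x ∈ cap Ω e 0, lapl (fun x => φ x - φ (planeRefl e 0 x)) x =
      -c x * (φ x - φ (planeRefl e 0 x)) := fun x hx => by
    rw [lapl_sub hφ.contDiffAt hcomp.contDiffAt, lapl_comp_planeRefl hΩ.norm_eq hφ, hφeq x hx.1,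
      hφeq _ (hΩ.planeRefl_zero_mem hx.1), hc x hx.1]
    ring
  have hbd : ∀ x ∈ closure (cap Ω e 0), x ∉ cap Ω e 0 → φ x - φ (planeRefl e 0 x) = 0 :=
    fun x hx hxn => by
    rcases mem_or_mem_frontier hΩ.isOpen (closure_mono (cap_subset 0) hx) with h | h
    · have h1 := inner_le_of_mem_closure_cap hx
      have h2 : ⟪x, e⟫ = 0 := le_antisymm h1 (not_lt.1 fun h3 => hxn ⟨h, h3⟩)
      rw [planeRefl_zero_of_inner_eq_zero h2, sub_self]
    · rw [hφ0 x h, hφ0 _ (hΩ.planeRefl_zero_mem_frontier h), sub_self]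
  have hle := hψ.nonpos_of_lapl_eq hΩ Subset.rfl (isOpen_cap hΩ.isOpen 0) hv hveq
    fun x hx hxn => (hbd x hx hxn).le
  have hge := hψ.nonpos_of_lapl_eq hΩ Subset.rfl (isOpen_cap hΩ.isOpen 0) hv.neg
    (fun x hx => by
      rw [lapl_neg hv.contDiffAt, hveq x hx]
      ring)
    fun x hx hxn => by rw [hbd x hx hxn, neg_zero]
  have hcap : ∀ x ∈ cap Ω e 0, φ (planeRefl e 0 x) = φ x := fun x hx => by
    have h1 := hle x hx
    have h2 := hge x hx
    linarith
  have hcl : IsClosed {x | φ (planeRefl e 0 x) = φ x} :=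
    isClosed_eq hcomp.continuous hφ.continuous
  refine fun x hx => closure_minimal (fun y hy => ?_) hcl hx
  rcases lt_trichotomy ⟪y, e⟫ 0 with h | h | h
  · exact hcap y ⟨hy, h⟩
  · exact congrArg φ (planeRefl_zero_of_inner_eq_zero h)
  · have := hcap _ ⟨hΩ.planeRefl_zero_mem hy, by rw [inner_planeRefl hΩ.norm_eq]; linarith⟩
    rw [planeRefl_planeRefl hΩ.norm_eq] at this
    exact this.symm

lemma PosSol.fderiv_ne_zero (hψ : PosSol Ω ψ c g) (hΩ : SymDomain Ω e) {b : Euc N}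
    (hb : b ∈ frontier Ω) : fderiv ℝ ψ b ≠ 0 := fun h => by
  obtain ⟨x₀, R, hR, hball, hbR⟩ := hΩ.interior_ball b hb
  have := hψ.hopf hΩ hb hR hball hbR
  simp [h] at this

lemma sum_pd_sq_pos {f : Euc N → ℝ} {x : Euc N} (h : fderiv ℝ f x ≠ 0) :
    0 < ∑ i, pd i f x ^ 2 := by
  refine (Finset.sum_nonneg fun i _ => sq_nonneg _).lt_of_ne fun h0 => h ?_
  have h1 := (Finset.sum_eq_zero_iff_of_nonneg fun i _ => sq_nonneg (pd i f x)).1 h0.symm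
  ext v
  rw [fderiv_apply_eq_sum_pd]
  exact Finset.sum_eq_zero fun i hi => by rw [pow_eq_zero_iff two_ne_zero |>.1 (h1 i hi), mul_zero]

lemma PosSol.boundarySol (hψ : PosSol Ω ψ c g) (hΩ : SymDomain Ω e) (hN : 0 < N) :
    BoundarySol Ω ψ where
  isOpen := hΩ.isOpen
  isBounded := hΩ.isBounded
  volume_frontier := volume_frontier_eq_zero hΩ.isOpen hN hΩ.interior_ball
  contDiff := hψ.contDiff
  pos := hψ.pos hΩ
  zero := hψ.zero
  lapl_nonpos x hx := by linarith [hψ.eq x hx, hψ.g_nonneg x]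
  grad_pos x hx := sum_pd_sq_pos (hψ.fderiv_ne_zero hΩ hx)

lemma PosSol.eq_zero_of_boundary_sign (hψ : PosSol Ω ψ c g) (hΩ : SymDomain Ω e)
    (hchart : HasC2Chart Ω) (hN : 0 < N) (hφ : ContDiff ℝ 2 φ)
    (hφ0 : ∀ x ∈ frontier Ω, φ x = 0) (hφeq : ∀ x ∈ Ω, lapl φ x = -c x * φ x)
    (hint : ∫ x in Ω, lapl φ x = 0)
    (hsign : ∀ b ∈ frontier Ω, ∀ k : ℝ, fderiv ℝ φ b = k • fderiv ℝ ψ b → 0 ≤ k) :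
    ∀ x ∈ Ω, φ x = 0 := by
  obtain ⟨M, hM⟩ := hΩ.isBounded.isCompact_closure.exists_bound_of_continuousOn
    hψ.c_cont.continuousOn
  have hpar : ∀ b ∈ frontier Ω, ∃ k : ℝ, 0 ≤ k ∧ ∀ j, pd j φ b = k * pd j ψ b := fun b hb => by
    obtain ⟨k, hk⟩ := hchart.exists_fderiv_eq_smul hΩ.isOpen hb hψ.contDiff hφ hψ.zero hφ0
      (hψ.fderiv_ne_zero hΩ hb)
    exact ⟨k, hsign b hb k hk, fun j => by simp [pd, hk]⟩
  refine (hψ.boundarySol hΩ hN).eq_zero_of_overdetermined ⟨0, hN⟩ hφ hφ0 hint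
    (fun b hb => ?_) (fun b hb => ?_) (M := M) fun x hx => ?_
  · obtain ⟨k, -, hk⟩ := hpar b hb
    exact ⟨k, hk⟩
  · obtain ⟨k, hk0, hk⟩ := hpar b hb
    refine Finset.sum_nonneg fun j _ => ?_
    rw [hk j, mul_assoc]
    exact mul_nonneg hk0 (mul_self_nonneg _)
  · rw [hφeq x hx, abs_mul, abs_neg]
    exact mul_le_mul_of_nonneg_right (hM x (subset_closure hx)) (abs_nonneg _)

/-- A solution of the linearized equation of zero mean and with a normal derivative of one sign
vanishes. -/
lemma PosSol.eq_zero_of_boundary_sign_or (hψ : PosSol Ω ψ c g) (hΩ : SymDomain Ω e)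
    (hchart : HasC2Chart Ω) (hN : 0 < N) (hφ : ContDiff ℝ 2 φ)
    (hφ0 : ∀ x ∈ frontier Ω, φ x = 0) (hφeq : ∀ x ∈ Ω, lapl φ x = -c x * φ x)
    (hint : ∫ x in Ω, lapl φ x = 0)
    (hsign : (∀ b ∈ frontier Ω, ∀ k : ℝ, fderiv ℝ φ b = k • fderiv ℝ ψ b → 0 ≤ k) ∨
      ∀ b ∈ frontier Ω, ∀ k : ℝ, fderiv ℝ φ b = k • fderiv ℝ ψ b → k ≤ 0) :
    ∀ x ∈ closure Ω, φ x = 0 := by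
  suffices h : ∀ x ∈ Ω, φ x = 0 from
    fun x hx => closure_minimal h (isClosed_eq hφ.continuous continuous_const) hx
  rcases hsign with hsign | hsign
  · exact hψ.eq_zero_of_boundary_sign hΩ hchart hN hφ hφ0 hφeq hint hsign
  · have hl : ∀ x, lapl (fun y => -φ y) x = -lapl φ x := fun x => lapl_neg hφ.contDiffAt
    have h := hψ.eq_zero_of_boundary_sign hΩ hchart hN hφ.neg
      (fun x hx => by rw [hφ0 x hx, neg_zero]) (fun x hx => by rw [hl, hφeq x hx]; ring)
      (by simp only [hl, integral_neg, hint, neg_zero])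
      (fun b hb k hk => by
        have := hsign b hb (-k) (by
          rw [neg_smul, ← hk, fderiv_fun_neg, neg_neg])
        linarith)
    exact fun x hx => neg_eq_zero.1 (h x hx)

end Kernel

section Ball

variable {N : ℕ} {e : Euc N} {ψ φ c g : Euc N → ℝ} {R : ℝ}

lemma convex_cap {Ω : Set (Euc N)} (hΩ : Convex ℝ Ω) (e : Euc N) (t : ℝ) :
    Convex ℝ (cap Ω e t) := by
  have h : IsLinearMap ℝ fun x : Euc N => ⟪x, e⟫ :=
    ⟨fun x y => inner_add_left x y e, fun a x => real_inner_smul_left x e a⟩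
  exact hΩ.inter (convex_halfSpace_lt h t)

lemma symDomain_ball (hR : 0 < R) (he : ‖e‖ = 1) : SymDomain (ball (0 : Euc N) R) e where
  isOpen := isOpen_ball
  isBounded := isBounded_ball
  isConnected := (convex_ball 0 R).isConnected (nonempty_ball.2 hR)
  norm_eq := he
  steiner x hx s hs := by
    rw [mem_ball_zero_iff] at hx ⊢
    refine lt_of_le_of_lt ?_ hx
    rw [← sq_le_sq₀ (norm_nonneg _) (norm_nonneg _), norm_add_sq_real, norm_smul, he,
      real_inner_smul_right, mul_one, Real.norm_eq_abs, sq_abs]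
    have := sq_le_sq.2 hs
    nlinarith
  barrier r hr := by
    have hN : (0 : ℝ) ≤ N := N.cast_nonneg
    exact ⟨r / (2 * N + 2), by positivity, div_le_self hr.le (by linarith), fun t _ =>
      hasBarrier_of_convex (convex_cap (convex_ball 0 R) e t) (isOpen_cap isOpen_ball t) hr⟩
  interior_ball b hb := by
    rw [frontier_ball _ hR.ne', mem_sphere_iff_norm] at hb
    exact ⟨0, R, hR, Subset.rfl, hb⟩

lemma hasC2Chart_ball (hR : 0 < R) : HasC2Chart (ball (0 : Euc N) R) := by
  intro b hb
  rw [frontier_ball _ hR.ne', mem_sphere_zero_iff_norm] at hb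
  refine ⟨{0}ᶜ, fun x => ‖x‖ ^ 2 - R ^ 2, isOpen_compl_singleton, fun h => ?_, ?_,
    fun y hy h => ?_, ?_⟩
  · rw [mem_singleton_iff.1 h, norm_zero] at hb
    exact hR.ne hb
  · exact (contDiff_norm_sq ℝ).sub contDiff_const
  · have h1 : HasFDerivAt (fun x : Euc N => ‖x‖ ^ 2 - R ^ 2) (2 • innerSL ℝ y) y :=
      (hasStrictFDerivAt_norm_sq y).hasFDerivAt.sub_const _
    rw [h1.fderiv] at h
    have h2 := DFunLike.congr_fun h y
    simp only [smul_apply, innerSL_apply_apply, real_inner_self_eq_norm_sq,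
      zero_apply, nsmul_eq_mul, Nat.cast_ofNat] at h2
    have : ‖y‖ ≠ 0 := norm_ne_zero_iff.2 hy
    have := pow_pos (lt_of_le_of_ne (norm_nonneg y) this.symm) 2
    linarith
  · ext x
    simp only [mem_inter_iff, mem_ball_zero_iff, mem_compl_iff, mem_singleton_iff]
    have : ‖x‖ < R ↔ ‖x‖ ^ 2 - R ^ 2 < 0 := by
      rw [sub_neg, sq_lt_sq₀ (norm_nonneg x) hR.le]
    rw [this]
    exact and_comm

lemma exists_planeRefl_eq {b b' : Euc N} (hne : b ≠ b') (h : ‖b‖ = ‖b'‖) :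
    ∃ e : Euc N, ‖e‖ = 1 ∧ ∀ t : ℝ, planeRefl e 0 (t • b) = t • b' := by
  have hd : ‖b - b'‖ ≠ 0 := norm_ne_zero_iff.2 (sub_ne_zero.2 hne)
  refine ⟨‖b - b'‖⁻¹ • (b - b'), by
    rw [norm_smul, norm_inv, norm_norm, inv_mul_cancel₀ hd], fun t => ?_⟩
  have h1 : ⟪b, b - b'⟫ = ‖b - b'‖ ^ 2 / 2 := by
    rw [norm_sub_sq_real, inner_sub_right, real_inner_self_eq_norm_sq, h]
    ring
  rw [planeRefl, real_inner_smul_left, real_inner_smul_right, h1, smul_smul]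
  have h2 : 2 * (0 - t * (‖b - b'‖⁻¹ * (‖b - b'‖ ^ 2 / 2))) * ‖b - b'‖⁻¹ = -t := by
    field_simp
    ring
  rw [h2]
  module

lemma fderiv_apply_self_eq_of_radial (hφ : Differentiable ℝ φ) {b b' : Euc N}
    (h : ∀ t ∈ Icc (0 : ℝ) 1, φ (t • b) = φ (t • b')) : fderiv ℝ φ b b = fderiv ℝ φ b' b' := by
  have hd : ∀ b : Euc N, HasDerivWithinAt (fun t : ℝ => φ (t • b)) (fderiv ℝ φ b b) (Icc 0 1) 1 :=
    fun b => by
    have h1 : HasDerivAt (fun t : ℝ => t • b) b 1 := by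
      simpa using (hasDerivAt_id (1 : ℝ)).smul_const b
    have h2 : HasFDerivAt φ (fderiv ℝ φ b) ((1 : ℝ) • b) := by
      rw [one_smul]
      exact (hφ b).hasFDerivAt
    exact (h2.comp_hasDerivAt 1 h1).hasDerivWithinAt
  have h1 : (1 : ℝ) ∈ Icc (0 : ℝ) 1 := right_mem_Icc.2 zero_le_one
  exact (uniqueDiffOn_Icc zero_lt_one 1 h1).eq_deriv _ (hd b)
    ((hd b').congr h (h 1 h1))

lemma PosSol.eq_zero_of_ball (hR : 0 < R) (hψ : PosSol (ball 0 R) ψ c g) (hN : 0 < N)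
    (hc : ∀ x y, ψ x = ψ y → c x = c y) (hφ : ContDiff ℝ 2 φ)
    (hφ0 : ∀ x ∈ frontier (ball (0 : Euc N) R), φ x = 0)
    (hφeq : ∀ x ∈ ball (0 : Euc N) R, lapl φ x = -c x * φ x)
    (hint : ∫ x in ball (0 : Euc N) R, lapl φ x = 0) :
    ∀ x ∈ closure (ball (0 : Euc N) R), φ x = 0 := by
  have hdom : ∀ {e : Euc N}, ‖e‖ = 1 → SymDomain (ball (0 : Euc N) R) e := symDomain_ball hR
  have he : ‖(EuclideanSpace.single ⟨0, hN⟩ 1 : Euc N)‖ = 1 := by simp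
  have hfr : ∀ b : Euc N, b ∈ frontier (ball (0 : Euc N) R) ↔ ‖b‖ = R := fun b => by
    rw [frontier_ball _ hR.ne', mem_sphere_zero_iff_norm]
  have hconst : ∀ b ∈ frontier (ball (0 : Euc N) R), ∀ b' ∈ frontier (ball (0 : Euc N) R),
      fderiv ℝ φ b b = fderiv ℝ φ b' b' := fun b hb b' hb' => by
    rcases eq_or_ne b b' with rfl | hne
    · rfl
    rw [hfr] at hb hb'
    obtain ⟨e, he, hrefl⟩ := exists_planeRefl_eq hne (hb.trans hb'.symm)
    refine fderiv_apply_self_eq_of_radial (hφ.differentiable (by norm_num)) fun t ht => ?_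
    have hmem : t • b ∈ closure (ball (0 : Euc N) R) := by
      rw [closure_ball _ hR.ne', mem_closedBall_zero_iff, norm_smul, hb,
        Real.norm_of_nonneg ht.1]
      exact mul_le_of_le_one_left hR.le ht.2
    rw [← hψ.planeRefl_eq_of_lapl_eq (hdom he) (fun x hx => hc _ _
      (hψ.planeRefl_eq (hdom he) (hdom (by rwa [norm_neg])) x hx)) hφ hφ0 hφeq _ hmem, hrefl]
  have hopf : ∀ b ∈ frontier (ball (0 : Euc N) R), fderiv ℝ ψ b b < 0 := fun b hb => by
    have := hψ.hopf (hdom he) hb hR Subset.rfl (by rw [sub_zero, ← hfr]; exact hb)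
    rw [zero_sub, map_neg] at this
    linarith
  obtain ⟨b₀, hb₀⟩ := (hdom he).frontier_nonempty
  refine hψ.eq_zero_of_boundary_sign_or (hdom he) (hasC2Chart_ball hR) hN hφ hφ0 hφeq hint ?_
  rcases le_total (fderiv ℝ φ b₀ b₀) 0 with h | h
  · refine Or.inl fun b hb k hk => ?_
    have h1 := hconst b hb b₀ hb₀
    rw [hk, smul_apply, smul_eq_mul] at h1
    by_contra! hneg
    have := mul_pos_of_neg_of_neg hneg (hopf b hb)
    linarith
  · refine Or.inr fun b hb k hk => ?_
    have h1 := hconst b hb b₀ hb₀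
    rw [hk, smul_apply, smul_eq_mul] at h1
    by_contra! hpos
    have := mul_neg_of_pos_of_neg hpos (hopf b hb)
    linarith

end Ball

section Crossing

lemma exists_continuous_arg {F : ℝ × ℝ → ℂ} (hF : Continuous F) (hF0 : ∀ z, F z ≠ 0) :
    ∃ θ : ℝ × ℝ → ℝ, Continuous θ ∧ θ 0 = (F 0).arg ∧ ∀ z, 0 < ‖F z‖ ∧
      (F z).re = ‖F z‖ * Real.cos (θ z) ∧ (F z).im = ‖F z‖ * Real.sin (θ z) := by
  obtain ⟨L, ⟨hL0, hL⟩, -⟩ := Complex.isCoveringMap_exp.existsUnique_continuousMap_lifts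
    (⟨fun z => ⟨F z, hF0 z⟩, by fun_prop⟩ : C(ℝ × ℝ, {z : ℂ // z ≠ 0})) 0 (Complex.log (F 0))
    (Subtype.ext (Complex.exp_log (hF0 0)))
  have hexp : ∀ z, Complex.exp (L z) = F z := fun z =>
    congrArg Subtype.val (congrFun hL z)
  have hnorm : ∀ z, ‖F z‖ = Real.exp (L z).re := fun z => by rw [← hexp, Complex.norm_exp]
  refine ⟨fun z => (L z).im, by fun_prop, ?_, fun z => ⟨norm_pos_iff.2 (hF0 z), ?_, ?_⟩⟩
  · dsimp only
    rw [hL0, Complex.log_im]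
  · rw [hnorm, ← hexp, Complex.exp_re]
  · rw [hnorm, ← hexp, Complex.exp_im]

lemma mem_Icc_of_avoid {θ : ℝ → ℝ} (hθ : Continuous θ) {a a' b b' : ℝ} (ha : a' < a) (hb : b < b')
    (h0 : θ 0 ∈ Icc a b) (hlo : ∀ t, θ t ∉ Ioo a' a) (hup : ∀ t, θ t ∉ Ioo b b') (t : ℝ) :
    θ t ∈ Icc a b := by
  constructor
  · by_contra! h
    obtain ⟨t', ht'⟩ := mem_range_of_exists_le_of_exists_ge hθ (c := max (θ t) ((a' + a) / 2))
      ⟨t, le_max_left _ _⟩ ⟨0, (max_lt h (by linarith)).le.trans h0.1⟩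
    refine hlo t' ⟨?_, ?_⟩ <;> rw [ht']
    · exact lt_max_of_lt_right (by linarith)
    · exact max_lt h (by linarith)
  · by_contra! h
    obtain ⟨t', ht'⟩ := mem_range_of_exists_le_of_exists_ge hθ (c := min (θ t) ((b + b') / 2))
      ⟨0, h0.2.trans (lt_min h (by linarith)).le⟩ ⟨t, min_le_left _ _⟩
    refine hup t' ⟨?_, ?_⟩ <;> rw [ht']
    · exact lt_min h (by linarith)
    · exact min_lt_of_right_lt (by linarith)

lemma arg_mem_of_re_nonneg_of_im_nonpos {z : ℂ} (hre : 0 ≤ z.re) (him : z.im ≤ 0) :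
    z.arg ∈ Icc (-(Real.pi / 2)) 0 := by
  refine ⟨neg_le_of_abs_le (Complex.abs_arg_le_pi_div_two_iff.2 hre), ?_⟩
  rcases him.lt_or_eq with h | h
  · exact (Complex.arg_neg_iff.2 h).le
  · exact (Complex.arg_eq_zero_iff.2 ⟨hre, h⟩).le

open Real in
/-- Two curves in the closed quadrant, one ending on each axis, which start in crossed position
and do not dominate each other's starting points must meet. -/
lemma exists_crossing {x₁ y₁ x₂ y₂ : ℝ → ℝ} (hx₁ : Continuous x₁) (hy₁ : Continuous y₁)
    (hx₂ : Continuous x₂) (hy₂ : Continuous y₂) (hx0 : x₂ 0 ≤ x₁ 0) (hy0 : y₁ 0 ≤ y₂ 0)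
    (hx₁1 : x₁ 1 = 0) (hy₂1 : y₂ 1 = 0) (hx₂nn : ∀ t, 0 ≤ x₂ t) (hy₁nn : ∀ t, 0 ≤ y₁ t)
    (hdom₁ : ∀ t, x₁ 0 < x₂ t → y₁ 0 < y₂ t → False)
    (hdom₂ : ∀ s, x₂ 0 < x₁ s → y₂ 0 < y₁ s → False) :
    ∃ s t, x₁ s = x₂ t ∧ y₁ s = y₂ t := by
  by_contra! hne
  set F : ℝ × ℝ → ℂ := fun z => ⟨x₁ z.1 - x₂ z.2, y₁ z.1 - y₂ z.2⟩ with hF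
  have hFc : Continuous F := by
    have : F = fun z => ((x₁ z.1 - x₂ z.2 : ℝ) : ℂ) + ((y₁ z.1 - y₂ z.2 : ℝ) : ℂ) * Complex.I := by
      funext z
      rw [hF, ← Complex.mk_eq_add_mul_I]
    rw [this]
    fun_prop
  have hF0 : ∀ z, F z ≠ 0 := fun z h => by
    have h1 := congrArg Complex.re h
    have h2 := congrArg Complex.im h
    exact hne z.1 z.2 (sub_eq_zero.1 h1) (sub_eq_zero.1 h2)
  obtain ⟨θ, hθc, hθ0, hθ⟩ := exists_continuous_arg hFc hF0
  have hre : ∀ s t, x₁ s - x₂ t = ‖F (s, t)‖ * cos (θ (s, t)) := fun s t => (hθ (s, t)).2.1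
  have him : ∀ s t, y₁ s - y₂ t = ‖F (s, t)‖ * sin (θ (s, t)) := fun s t => (hθ (s, t)).2.2
  have hpos : ∀ s t, 0 < ‖F (s, t)‖ := fun s t => (hθ (s, t)).1
  have hcos_pos : ∀ s t, 0 < x₁ s - x₂ t ↔ 0 < cos (θ (s, t)) := fun s t => by
    rw [hre, mul_pos_iff_of_pos_left (hpos s t)]
  have hcos_neg : ∀ s t, x₁ s - x₂ t < 0 ↔ cos (θ (s, t)) < 0 := fun s t => by
    rw [hre, ← neg_pos, ← mul_neg, mul_pos_iff_of_pos_left (hpos s t), neg_pos]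
  have hsin_pos : ∀ s t, 0 < y₁ s - y₂ t ↔ 0 < sin (θ (s, t)) := fun s t => by
    rw [him, mul_pos_iff_of_pos_left (hpos s t)]
  have hsin_neg : ∀ s t, y₁ s - y₂ t < 0 ↔ sin (θ (s, t)) < 0 := fun s t => by
    rw [him, ← neg_pos, ← mul_neg, mul_pos_iff_of_pos_left (hpos s t), neg_pos]
  have hpi := Real.pi_pos
  have hstart : θ (0, 0) ∈ Icc (-(π / 2)) 0 := by
    change θ 0 ∈ _
    rw [hθ0]
    exact arg_mem_of_re_nonneg_of_im_nonpos (sub_nonneg.2 hx0) (sub_nonpos.2 hy0)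
  have cos_neg' : ∀ a : ℝ, -(3 * π / 2) < a → a < -(π / 2) → cos a < 0 := fun a h1 h2 => by
    rw [← cos_neg]
    exact cos_neg_of_pi_div_two_lt_of_lt (by linarith) (by linarith)
  have sin_pos' : ∀ a : ℝ, -(2 * π) < a → a < -π → 0 < sin a := fun a h1 h2 => by
    rw [← sin_add_two_pi]
    exact sin_pos_of_pos_of_lt_pi (by linarith) (by linarith)
  have sin_neg' : ∀ a : ℝ, π < a → a < 2 * π → sin a < 0 := fun a h1 h2 => by
    rw [← sin_sub_two_pi]
    exact sin_neg_of_neg_of_neg_pi_lt (by linarith) (by linarith)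
  have hleft : ∀ t, θ (0, t) ∈ Icc (-(π / 2)) π := by
    refine mem_Icc_of_avoid (by fun_prop) (a' := -π) (b' := 3 * π / 2) (by linarith) (by linarith)
      ⟨hstart.1, hstart.2.trans hpi.le⟩ (fun t ht => ?_) fun t ht => ?_
    · refine hdom₁ t (sub_neg.1 ((hcos_neg 0 t).2 (cos_neg' _ (by linarith [ht.1]) ht.2)))
        (sub_neg.1 ((hsin_neg 0 t).2 (sin_neg_of_neg_of_neg_pi_lt (by linarith [ht.2]) ht.1)))
    · refine hdom₁ t (sub_neg.1 ((hcos_neg 0 t).2 (cos_neg_of_pi_div_two_lt_of_lt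
        (by linarith [ht.1]) (by linarith [ht.2]))))
        (sub_neg.1 ((hsin_neg 0 t).2 (sin_neg' _ ht.1 (by linarith [ht.2]))))
  have hbot : ∀ s, θ (s, 0) ∈ Icc (-(3 * π / 2)) 0 := by
    refine mem_Icc_of_avoid (by fun_prop) (a' := -(2 * π)) (b' := π / 2) (by linarith)
      (by linarith) ⟨by linarith [hstart.1], hstart.2⟩ (fun s hs => ?_) fun s hs => ?_
    · refine hdom₂ s (sub_pos.1 ((hcos_pos s 0).2 ?_))
        (sub_pos.1 ((hsin_pos s 0).2 (sin_pos' _ hs.1 (by linarith [hs.2]))))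
      rw [← cos_add_two_pi]
      exact cos_pos_of_mem_Ioo ⟨by linarith [hs.1], by linarith [hs.2]⟩
    · exact hdom₂ s (sub_pos.1 ((hcos_pos s 0).2 (cos_pos_of_mem_Ioo ⟨by linarith [hs.1], hs.2⟩)))
        (sub_pos.1 ((hsin_pos s 0).2 (sin_pos_of_pos_of_lt_pi hs.1 (by linarith [hs.2]))))
  have htopsin : ∀ s, ¬sin (θ (s, 1)) < 0 := fun s h => by
    have := (hsin_neg s 1).2 h
    linarith [hy₁nn s]
  have hrightcos : ∀ t, ¬0 < cos (θ (1, t)) := fun t h => by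
    have := (hcos_pos 1 t).2 h
    linarith [hx₂nn t]
  have htop : ∀ s, θ (s, 1) ∈ Icc 0 π := by
    refine mem_Icc_of_avoid (by fun_prop) (a' := -π) (b' := 2 * π) (by linarith) (by linarith)
      ⟨?_, (hleft 1).2⟩ (fun s hs => ?_) fun s hs => ?_
    · by_contra! h
      exact htopsin 0 (sin_neg_of_neg_of_neg_pi_lt h (by linarith [(hleft 1).1]))
    · exact htopsin s (sin_neg_of_neg_of_neg_pi_lt hs.2 hs.1)
    · exact htopsin s (sin_neg' _ hs.1 hs.2)
  have hright : ∀ t, θ (1, t) ∈ Icc (-(3 * π / 2)) (-(π / 2)) := by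
    refine mem_Icc_of_avoid (by fun_prop) (a' := -(2 * π)) (b' := 0) (by linarith) (by linarith)
      ⟨(hbot 1).1, ?_⟩ (fun t ht => ?_) fun t ht => ?_
    · by_contra! h
      exact hrightcos 0 (cos_pos_of_mem_Ioo ⟨h, by linarith [(hbot 1).2]⟩)
    · refine hrightcos t ?_
      rw [← cos_add_two_pi]
      exact cos_pos_of_mem_Ioo ⟨by linarith [ht.1], by linarith [ht.2]⟩
    · exact hrightcos t (cos_pos_of_mem_Ioo ⟨ht.1, by linarith [ht.2]⟩)
  linarith [(htop 1).1, (hright 1).2]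

end Crossing

section Planar

variable {Ω : Set (Euc 2)} {ψ φ c g : Euc 2 → ℝ}

lemma inner_single_one {N : ℕ} (x : Euc N) (i : Fin N) :
    ⟪x, EuclideanSpace.single i (1 : ℝ)⟫ = x i := by
  simp [EuclideanSpace.inner_single_right]

lemma reflect_eq {N : ℕ} (i : Fin N) (x : Euc N) :
    reflect i x = x + (-2 * x i) • EuclideanSpace.single i (1 : ℝ) := by
  ext j
  rcases eq_or_ne j i with rfl | h
  · simp [reflect]
    ring
  · simp [reflect, h]

lemma steiner_of_reflect {N : ℕ} {Ω : Set (Euc N)}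
    (hrefl : ∀ (i : Fin N), ∀ x ∈ Ω, reflect i x ∈ Ω)
    (hconv : ∀ (i : Fin N), ∀ x ∈ Ω, ∀ y ∈ Ω,
      (∀ j : Fin N, j ≠ i → x j = y j) → segment ℝ x y ⊆ Ω) (i : Fin N) :
    ∀ x ∈ Ω, ∀ s : ℝ, |x i + s| ≤ |x i| → x + s • EuclideanSpace.single i (1 : ℝ) ∈ Ω := by
  intro x hx s hs
  have hsub := hconv i x hx _ (hrefl i x hx) fun j hj => by simp [reflect, hj]
  rw [← sq_le_sq] at hs
  rcases eq_or_ne (x i) 0 with h0 | h0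
  · have : s = 0 := by
      rw [h0] at hs
      nlinarith
    rwa [this, zero_smul, add_zero]
  refine hsub ?_
  rw [segment_eq_image, reflect_eq]
  refine ⟨-s / (2 * x i), ⟨?_, ?_⟩, ?_⟩
  · have : -s / (2 * x i) = (-s * (2 * x i)) / (2 * x i) ^ 2 := by field_simp
    rw [this]
    exact div_nonneg (by nlinarith) (sq_nonneg _)
  · have : 1 - -s / (2 * x i) = ((2 * x i + s) * (2 * x i)) / (2 * x i) ^ 2 := by
      field_simp
      ring
    have h2 : 0 ≤ 1 - -s / (2 * x i) := by
      rw [this]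
      refine div_nonneg ?_ (sq_nonneg _)
      have h3 : s * (2 * x i + s) ≤ 0 := by nlinarith
      nlinarith [sq_nonneg (2 * x i + s)]
    linarith
  · have : s = -s / (2 * x i) * (-2 * x i) := by field_simp
    nth_rewrite 2 [this]
    dsimp only
    module

lemma symDomain_of_steiner {e : Euc 2} (hchart : HasC2Chart Ω) (ho : IsOpen Ω)
    (hb : Bornology.IsBounded Ω) (hconn : IsConnected Ω) (he : ‖e‖ = 1)
    (hst : ∀ x ∈ Ω, ∀ s : ℝ, |⟪x, e⟫ + s| ≤ |⟪x, e⟫| → x + s • e ∈ Ω) : SymDomain Ω e where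
  isOpen := ho
  isBounded := hb
  isConnected := hconn
  norm_eq := he
  steiner := hst
  barrier r hr := by
    refine ⟨r / 64, by positivity, by linarith, fun t ht => hasBarrier_of_ray (fun y hy => ?_) hr⟩
    have hin : ∀ s : ℝ, ⟪y + s • e, e⟫ = ⟪y, e⟫ + s := fun s => by
      rw [inner_add_left, real_inner_smul_left, real_inner_self_eq_norm_sq, he]
      ring
    by_cases hyt : ⟪y, e⟫ < t
    · refine ⟨-e, by rwa [norm_neg], fun s hs hmem => hy ⟨?_, hyt⟩⟩
      rw [smul_neg, ← neg_smul] at hmem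
      have h1 := hin (-s)
      have h2 := hst _ hmem.1 s (by
        rw [h1, abs_of_neg, abs_of_neg] <;> linarith)
      rwa [neg_smul, neg_add_cancel_right] at h2
    · refine ⟨e, he, fun s hs hmem => hyt ?_⟩
      have := hmem.2
      rw [hin] at this
      linarith
  interior_ball b hb := hchart.exists_interior_ball hb

lemma IsC3Domain.hasC2Chart {N : ℕ} {Ω : Set (Euc N)} (h : IsC3Domain Ω) : HasC2Chart Ω :=
  fun b hb => by
    obtain ⟨U, f, hU, hbU, hf, hf', hΩU⟩ := h.2.2.2 b hb
    exact ⟨U, f, hU, hbU, hf.of_le (by norm_num), hf', hΩU⟩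

/-- Invariance of the geometry under both coordinate reflections. -/
def CoordSym (Ω : Set (Euc 2)) : Prop :=
  ∀ i : Fin 2, SymDomain Ω (EuclideanSpace.single i 1) ∧ SymDomain Ω (-EuclideanSpace.single i 1)

lemma IsC3Domain.coordSym (h : IsC3Domain Ω)
    (hrefl : ∀ (i : Fin 2), ∀ x ∈ Ω, reflect i x ∈ Ω)
    (hconv : ∀ (i : Fin 2), ∀ x ∈ Ω, ∀ y ∈ Ω,
      (∀ j : Fin 2, j ≠ i → x j = y j) → segment ℝ x y ⊆ Ω) : CoordSym Ω := by
  intro i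
  have he : ‖(EuclideanSpace.single i 1 : Euc 2)‖ = 1 := by simp
  have hst := steiner_of_reflect hrefl hconv i
  refine ⟨symDomain_of_steiner h.hasC2Chart h.1 h.2.2.1 h.2.1 he fun x hx s hs => ?_,
    symDomain_of_steiner h.hasC2Chart h.1 h.2.2.1 h.2.1 (by rwa [norm_neg]) fun x hx s hs => ?_⟩
  · rw [inner_single_one] at hs
    exact hst x hx s hs
  · rw [inner_neg_right, inner_single_one, abs_neg, ← abs_neg] at hs
    rw [smul_neg, ← neg_smul]
    refine hst x hx (-s) ?_
    convert hs using 2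
    ring

lemma CoordSym.mem_of_abs_le (hΩ : CoordSym Ω) {x y : Euc 2} (hx : x ∈ Ω)
    (h : ∀ i, |y i| ≤ |x i|) : y ∈ Ω := by
  have h0 := (hΩ 0).1.steiner x hx (y 0 - x 0) (by simpa [inner_single_one] using h 0)
  have h1 := (hΩ 1).1.steiner _ h0 (y 1 - x 1) (by simpa [inner_single_one] using h 1)
  convert h1 using 1
  ext i
  fin_cases i <;> simp

lemma CoordSym.not_abs_lt (hΩ : CoordSym Ω) {x b : Euc 2} (hx : x ∈ closure Ω)
    (hb : b ∈ frontier Ω) (h0 : |b 0| < |x 0|) (h1 : |b 1| < |x 1|) : False := by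
  have hlt : ∀ i, IsOpen {y : Euc 2 | |b i| < |y i|} := fun i =>
    isOpen_lt continuous_const (by fun_prop)
  have hU : IsOpen {y : Euc 2 | |b 0| < |y 0| ∧ |b 1| < |y 1|} := (hlt 0).inter (hlt 1)
  obtain ⟨y, hy, hyΩ⟩ := mem_closure_iff.1 hx _ hU ⟨h0, h1⟩
  rw [(hΩ 0).1.isOpen.frontier_eq] at hb
  refine hb.2 (hΩ.mem_of_abs_le hyΩ fun i => ?_)
  fin_cases i
  · exact hy.1.le
  · exact hy.2.le

lemma eq_of_abs_eq (hcl : ∀ i, ∀ x ∈ closure Ω, φ (planeRefl (EuclideanSpace.single i 1) 0 x) = φ x)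
    (hΩ : CoordSym Ω) {x y : Euc 2} (hx : x ∈ closure Ω) (h : ∀ i, |x i| = |y i|) : φ y = φ x := by
  have hr : ∀ i, planeRefl (EuclideanSpace.single i 1) 0 x ∈ closure Ω := fun i =>
    (hΩ i).1.planeRefl_zero_mem_closure hx
  rcases abs_eq_abs.1 (h 0) with h0 | h0 <;> rcases abs_eq_abs.1 (h 1) with h1 | h1
  · congr 1
    ext i
    fin_cases i <;> simp [h0, h1]
  · rw [← hcl 1 x hx]
    congr 1
    ext i
    fin_cases i <;> simp [h0, h1, planeRefl, inner_single_one]; ring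
  · rw [← hcl 0 x hx]
    congr 1
    ext i
    fin_cases i <;> simp [h0, h1, planeRefl, inner_single_one]; ring
  · rw [← hcl 0 x hx, ← hcl 1 _ (hr 0)]
    congr 1
    ext i
    fin_cases i <;> simp [h0, h1, planeRefl, inner_single_one] <;> ring

/-- From `b` one can move inside `F` to each of the two coordinate axes. -/
def ReachesAxes (F : Set (Euc 2)) (b : Euc 2) : Prop :=
  ∀ i : Fin 2, ∃ w ∈ F, w i = 0 ∧ JoinedIn F b w

lemma CoordSym.exists_abs_eq_of_le (hΩ : CoordSym Ω) {F G : Set (Euc 2)} {b b' : Euc 2}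
    (hb : b ∈ frontier Ω) (hb' : b' ∈ frontier Ω) (hF : F ⊆ closure Ω) (hG : G ⊆ closure Ω)
    (hFb : ReachesAxes F b) (hGb : ReachesAxes G b') (h0 : |b' 0| ≤ |b 0|) (h1 : |b 1| ≤ |b' 1|) :
    ∃ x ∈ F, ∃ y ∈ G, ∀ i, |x i| = |y i| := by
  obtain ⟨w, -, hw, γ, hγ⟩ := hFb 0
  obtain ⟨w', -, hw', γ', hγ'⟩ := hGb 1
  have hγc := γ.continuous_extend
  have hγc' := γ'.continuous_extend
  have hmem : ∀ t, γ.extend t ∈ F := fun t => by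
    obtain ⟨s, hs⟩ := γ.extend_range ▸ mem_range_self (f := γ.extend) t
    exact hs ▸ hγ s
  have hmem' : ∀ t, γ'.extend t ∈ G := fun t => by
    obtain ⟨s, hs⟩ := γ'.extend_range ▸ mem_range_self (f := γ'.extend) t
    exact hs ▸ hγ' s
  obtain ⟨s, t, hst⟩ := exists_crossing (x₁ := fun t => |γ.extend t 0|)
    (y₁ := fun t => |γ.extend t 1|) (x₂ := fun t => |γ'.extend t 0|)
    (y₂ := fun t => |γ'.extend t 1|) (by fun_prop) (by fun_prop) (by fun_prop) (by fun_prop)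
    (by simpa using h0) (by simpa using h1) (by simpa using hw) (by simpa using hw')
    (fun _ => abs_nonneg _) (fun _ => abs_nonneg _)
    (fun t ht0 ht1 => hΩ.not_abs_lt (hG (hmem' t)) hb (by simpa using ht0) (by simpa using ht1))
    fun t ht0 ht1 => hΩ.not_abs_lt (hF (hmem t)) hb' (by simpa using ht0) (by simpa using ht1)
  refine ⟨_, hmem s, _, hmem' t, fun i => ?_⟩
  fin_cases i
  · exact hst.1
  · exact hst.2

lemma CoordSym.exists_abs_eq (hΩ : CoordSym Ω) {F G : Set (Euc 2)} {b b' : Euc 2}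
    (hb : b ∈ frontier Ω) (hb' : b' ∈ frontier Ω) (hF : F ⊆ closure Ω) (hG : G ⊆ closure Ω)
    (hFb : ReachesAxes F b) (hGb : ReachesAxes G b') :
    ∃ x ∈ F, ∃ y ∈ G, ∀ i, |x i| = |y i| := by
  have hcases : (|b' 0| ≤ |b 0| ∧ |b 1| ≤ |b' 1|) ∨ (|b 0| ≤ |b' 0| ∧ |b' 1| ≤ |b 1|) := by
    have h1 := hΩ.not_abs_lt (frontier_subset_closure hb) hb'
    have h2 := hΩ.not_abs_lt (frontier_subset_closure hb') hb
    grind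
  rcases hcases with h | h
  · exact hΩ.exists_abs_eq_of_le hb hb' hF hG hFb hGb h.1 h.2
  · obtain ⟨y, hy, x, hx, hxy⟩ := hΩ.exists_abs_eq_of_le hb' hb hG hF hGb hFb h.1 h.2
    exact ⟨x, hx, y, hy, fun i => (hxy i).symm⟩

/-- A nodal domain of a solution of the linearized equation meets both axes. -/
lemma PosSol.exists_mem_connectedComponentIn (hψ : PosSol Ω ψ c g) (hΩ : CoordSym Ω)
    (hφ : ContDiff ℝ 2 φ) (hφ0 : ∀ x ∈ frontier Ω, φ x = 0)
    (hφeq : ∀ x ∈ Ω, lapl φ x = -c x * φ x) {z : Euc 2} (hz : z ∈ Ω) (hφz : 0 < φ z) (i : Fin 2) :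
    ∃ w ∈ {x | x ∈ Ω ∧ 0 < φ x}, w i = 0 ∧ JoinedIn {x | x ∈ Ω ∧ 0 < φ x} z w := by
  set P : Set (Euc 2) := {x | x ∈ Ω ∧ 0 < φ x} with hP
  have hPo : IsOpen P := (hΩ 0).1.isOpen.inter (isOpen_lt continuous_const hφ.continuous)
  have hzP : z ∈ P := ⟨hz, hφz⟩
  set D := connectedComponentIn P z with hDdef
  have hDo : IsOpen D := hPo.connectedComponentIn
  have hDP : D ⊆ P := connectedComponentIn_subset P z
  have hzD : z ∈ D := mem_connectedComponentIn hzP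
  have hDc : IsConnected D := isConnected_connectedComponentIn_iff.2 hzP
  have hbd : ∀ x ∈ closure D, x ∉ D → φ x ≤ 0 := fun x hx hxD => by
    by_contra! hpos
    have hxΩ : x ∈ Ω := (mem_or_mem_frontier (hΩ 0).1.isOpen
      (closure_mono (fun _ h => (hDP h).1) hx)).resolve_right fun h => hpos.ne' (hφ0 x h)
    have hxP : x ∈ P := ⟨hxΩ, hpos⟩
    have hpre : IsPreconnected (insert x D) :=
      hDc.isPreconnected.subset_closure (subset_insert _ _)
        (insert_subset hx subset_closure)
    exact hxD (hpre.subset_connectedComponentIn (mem_insert_of_mem _ hzD)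
      (insert_subset hxP hDP) (mem_insert _ _))
  obtain ⟨w, hwD, hwi⟩ : ∃ w ∈ D, w i = 0 := by
    by_contra! hne
    have hcont : Continuous fun x : Euc 2 => x i := by fun_prop
    have hsign : (∀ x ∈ D, x i < 0) ∨ ∀ x ∈ D, 0 < x i := by
      by_contra! h
      obtain ⟨⟨x, hx, hx0⟩, y, hy, hy0⟩ := h
      obtain ⟨w, hw, hw0⟩ := hDc.isPreconnected.intermediate_value hy hx hcont.continuousOn
        ⟨hy0, hx0⟩
      exact hne w hw hw0
    have key : ∀ e, SymDomain Ω e → (∀ x ∈ D, ⟪x, e⟫ < 0) → False := fun e he hlt =>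
      (hψ.nonpos_of_lapl_eq he (fun x hx => ⟨(hDP hx).1, hlt x hx⟩) hDo hφ
        (fun x hx => hφeq x (hDP hx).1) hbd z hzD).not_gt hφz
    rcases hsign with h | h
    · exact key _ (hΩ i).1 fun x hx => by
        rw [inner_single_one]
        exact h x hx
    · exact key _ (hΩ i).2 fun x hx => by
        rw [inner_neg_right, inner_single_one]
        linarith [h x hx]
  exact ⟨w, hDP hwD, hwi,
    ((hDo.isConnected_iff_isPathConnected.1 hDc).joinedIn z hzD w hwD).mono hDP⟩

lemma PosSol.reachesAxes (hψ : PosSol Ω ψ c g) (hΩ : CoordSym Ω)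
    (hφ : ContDiff ℝ 2 φ) (hφ0 : ∀ x ∈ frontier Ω, φ x = 0)
    (hφeq : ∀ x ∈ Ω, lapl φ x = -c x * φ x) {b : Euc 2} (hb : b ∈ frontier Ω)
    {x₀ : Euc 2} {R : ℝ} (hball : ball x₀ R ⊆ Ω) (hbR : ‖b - x₀‖ = R) (hR : 0 < R)
    (hd : 0 < fderiv ℝ φ b (x₀ - b)) :
    ReachesAxes (insert b {x | x ∈ Ω ∧ 0 < φ x}) b := by
  have h1 : HasDerivAt (fun t : ℝ => φ (b + t • (x₀ - b))) (fderiv ℝ φ b (x₀ - b)) 0 := by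
    have h2 : HasDerivAt (fun t : ℝ => b + t • (x₀ - b)) (x₀ - b) 0 := by
      simpa using ((hasDerivAt_id (0 : ℝ)).smul_const (x₀ - b)).const_add b
    have h3 : HasFDerivAt φ (fderiv ℝ φ b) (b + (0 : ℝ) • (x₀ - b)) := by
      rw [zero_smul, add_zero]
      exact (hφ.differentiable (by norm_num) b).hasFDerivAt
    exact h3.comp_hasDerivAt 0 h2
  have h2 : ∀ᶠ t in 𝓝[>] (0 : ℝ), 0 < φ (b + t • (x₀ - b)) := by
    have h3 := (hasDerivAt_iff_tendsto_slope.1 h1).mono_left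
      (nhdsWithin_mono 0 fun t (ht : 0 < t) => ht.ne')
    filter_upwards [h3.eventually (lt_mem_nhds hd), self_mem_nhdsWithin] with t ht ht0
    simp only [slope_def_field, zero_smul, add_zero, hφ0 b hb, sub_zero] at ht
    exact (div_pos_iff_of_pos_right ht0).1 ht
  obtain ⟨δ, hδ, hpos⟩ := mem_nhdsGT_iff_exists_Ioo_subset.1 h2
  set τ : ℝ := min (δ / 2) 1 with hτ
  have hδ' : 0 < δ := hδ
  have hτ0 : 0 < τ := lt_min (by linarith) one_pos
  have hmem : ∀ t ∈ Ioc 0 τ, b + t • (x₀ - b) ∈ Ω ∧ 0 < φ (b + t • (x₀ - b)) := fun t ht => by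
    refine ⟨hball ?_, hpos ⟨ht.1, ?_⟩⟩
    · have h3 : b + t • (x₀ - b) - x₀ = (1 - t) • (b - x₀) := by module
      rw [mem_ball_iff_norm, h3, norm_smul, hbR, Real.norm_of_nonneg]
      · nlinarith [ht.1]
      · linarith [ht.2, min_le_right (δ / 2) 1]
    · linarith [ht.2, min_le_left (δ / 2) 1]
  intro i
  have hz := hmem τ ⟨hτ0, le_rfl⟩
  obtain ⟨w, hw, hwi, hj⟩ := hψ.exists_mem_connectedComponentIn hΩ hφ hφ0 hφeq hz.1 hz.2 i
  refine ⟨w, mem_insert_of_mem _ hw, hwi, JoinedIn.trans ?_ (hj.mono (subset_insert _ _))⟩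
  refine JoinedIn.of_segment_subset fun y hy => ?_
  rw [segment_eq_image'] at hy
  obtain ⟨θ, hθ, rfl⟩ := hy
  dsimp only
  rw [add_sub_cancel_left, smul_smul]
  rcases hθ.1.eq_or_lt with h | h
  · simp [← h]
  · exact mem_insert_of_mem _ (hmem _ ⟨by positivity, by nlinarith [hθ.2]⟩)

lemma fderiv_apply_eq_of_ray {N : ℕ} {f : Euc N → ℝ} (hf : Differentiable ℝ f) {b b' v v' : Euc N}
    (h : ∀ t ∈ Icc (0 : ℝ) 1, f (b + t • v) = f (b' + t • v')) :
    fderiv ℝ f b v = fderiv ℝ f b' v' := by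
  have hd : ∀ b v : Euc N,
      HasDerivWithinAt (fun t : ℝ => f (b + t • v)) (fderiv ℝ f b v) (Icc 0 1) 0 := fun b v => by
    have h1 : HasDerivAt (fun t : ℝ => b + t • v) v 0 := by
      simpa using ((hasDerivAt_id (0 : ℝ)).smul_const v).const_add b
    have h2 : HasFDerivAt f (fderiv ℝ f b) (b + (0 : ℝ) • v) := by
      rw [zero_smul, add_zero]
      exact (hf b).hasFDerivAt
    exact (h2.comp_hasDerivAt 0 h1).hasDerivWithinAt
  have h1 : (0 : ℝ) ∈ Icc (0 : ℝ) 1 := left_mem_Icc.2 zero_le_one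
  exact (uniqueDiffOn_Icc zero_lt_one 0 h1).eq_deriv _ (hd b v)
    ((hd b' v').congr h (h 0 h1))

lemma exists_signs {b b' : Euc 2} (h : ∀ i, |b i| = |b' i|) :
    ∃ ε : Fin 2 → ℝ, ∀ i, |ε i| = 1 ∧ b' i = ε i * b i := by
  have : ∀ i, ∃ ε : ℝ, |ε| = 1 ∧ b' i = ε * b i := fun i => by
    rcases abs_eq_abs.1 (h i) with h | h
    · exact ⟨1, by simp, by simp [h]⟩
    · exact ⟨-1, by simp, by simp [h]⟩
  choose ε hε using this
  exact ⟨ε, hε⟩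

lemma PosSol.boundary_sign (hψ : PosSol Ω ψ c g) (hΩ : CoordSym Ω)
    (hc : ∀ x y, ψ x = ψ y → c x = c y) (hφ : ContDiff ℝ 2 φ)
    (hφ0 : ∀ x ∈ frontier Ω, φ x = 0) (hφeq : ∀ x ∈ Ω, lapl φ x = -c x * φ x) {b b' : Euc 2}
    (hb : b ∈ frontier Ω) (hb' : b' ∈ frontier Ω) {k k' : ℝ} (hk : fderiv ℝ φ b = k • fderiv ℝ ψ b)
    (hk' : fderiv ℝ φ b' = k' • fderiv ℝ ψ b') (hpos : 0 < k) (hneg : k' < 0) : False := by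
  have hψs : ∀ i, ∀ x ∈ Ω, ψ (planeRefl (EuclideanSpace.single i 1) 0 x) = ψ x := fun i =>
    hψ.planeRefl_eq (hΩ i).1 (hΩ i).2
  have hψs' : ∀ i, ∀ x ∈ closure Ω, ψ (planeRefl (EuclideanSpace.single i 1) 0 x) = ψ x :=
    fun i x hx => closure_minimal (t := {x | ψ (planeRefl (EuclideanSpace.single i 1) 0 x) = ψ x})
      (hψs i) (isClosed_eq (hψ.contDiff.continuous.comp (continuous_planeRefl 0))
        hψ.contDiff.continuous) hx
  have hφs : ∀ i, ∀ x ∈ closure Ω, φ (planeRefl (EuclideanSpace.single i 1) 0 x) = φ x := fun i =>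
    hψ.planeRefl_eq_of_lapl_eq (hΩ i).1 (fun x hx => hc _ _ (hψs i x hx)) hφ hφ0 hφeq
  obtain ⟨x₀, R, hR, hball, hbR⟩ := (hΩ 0).1.interior_ball b hb
  obtain ⟨x₀', R', hR', hball', hbR'⟩ := (hΩ 0).1.interior_ball b' hb'
  have hopf := hψ.hopf (hΩ 0).1 hb hR hball hbR
  have hopf' := hψ.hopf (hΩ 0).1 hb' hR' hball' hbR'
  have hreach := hψ.reachesAxes hΩ hφ hφ0 hφeq hb hball hbR hR (by
    rw [hk]
    exact mul_pos hpos hopf)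
  have hreach' := hψ.reachesAxes (φ := fun x => -φ x) hΩ hφ.neg (fun x hx => by simp [hφ0 x hx])
    (fun x hx => by rw [lapl_neg hφ.contDiffAt, hφeq x hx]; ring) hb' hball' hbR' hR' (by
    rw [fderiv_fun_neg, hk']
    exact neg_pos.2 (mul_neg_of_neg_of_pos hneg hopf'))
  have hsub : ∀ {f : Euc 2 → ℝ} {b}, b ∈ frontier Ω →
      insert b {x | x ∈ Ω ∧ 0 < f x} ⊆ closure Ω := fun hb =>
    insert_subset (frontier_subset_closure hb) fun x hx => subset_closure hx.1
  obtain ⟨x, hx, y, hy, hxy⟩ := hΩ.exists_abs_eq hb hb' (hsub hb) (hsub hb') hreach hreach'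
  have hφxy := eq_of_abs_eq hφs hΩ (hsub hb hx) hxy
  have hzero := hφ0 b hb
  have hzero' := hφ0 b' hb'
  have habs : ∀ i, |b i| = |b' i| := by
    rcases hx with rfl | hx <;> rcases hy with rfl | hy
    · exact hxy
    · linarith [hy.2]
    · linarith [hx.2]
    · linarith [hy.2, hx.2]
  obtain ⟨ε, hε⟩ := exists_signs habs
  set v' : Euc 2 := WithLp.toLp 2 fun i => ε i * (x₀ - b) i with hv'
  have hray : ∀ f : Euc 2 → ℝ, Differentiable ℝ f →
      (∀ i, ∀ x ∈ closure Ω, f (planeRefl (EuclideanSpace.single i 1) 0 x) = f x) →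
      fderiv ℝ f b (x₀ - b) = fderiv ℝ f b' v' := fun f hf hfs =>
    fderiv_apply_eq_of_ray hf fun t ht => by
      refine (eq_of_abs_eq hfs hΩ ?_ fun i => ?_).symm
      · refine closure_mono hball ?_
        rw [closure_ball _ hR.ne', mem_closedBall_iff_norm,
          show b + t • (x₀ - b) - x₀ = (1 - t) • (b - x₀) by module, norm_smul, hbR,
          Real.norm_of_nonneg (by linarith [ht.2])]
        nlinarith [ht.1]
      · have : (b' + t • v') i = ε i * (b + t • (x₀ - b)) i := by
          simp only [PiLp.add_apply, PiLp.smul_apply, (hε i).2, hv', smul_eq_mul]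
          ring
        rw [this, abs_mul, (hε i).1, one_mul]
  have h1 := hray φ (hφ.differentiable (by norm_num)) hφs
  have h2 := hray ψ (hψ.contDiff.differentiable (by norm_num)) hψs'
  rw [hk, hk', smul_apply, smul_apply, ← h2] at h1
  have h3 := mul_pos hpos hopf
  have h4 := mul_neg_of_neg_of_pos hneg hopf
  simp only [smul_eq_mul] at h1
  linarith

lemma PosSol.eq_zero_of_coordSym (hψ : PosSol Ω ψ c g) (hΩ : CoordSym Ω) (hchart : HasC2Chart Ω)
    (hc : ∀ x y, ψ x = ψ y → c x = c y) (hφ : ContDiff ℝ 2 φ)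
    (hφ0 : ∀ x ∈ frontier Ω, φ x = 0) (hφeq : ∀ x ∈ Ω, lapl φ x = -c x * φ x)
    (hint : ∫ x in Ω, lapl φ x = 0) : ∀ x ∈ closure Ω, φ x = 0 := by
  refine hψ.eq_zero_of_boundary_sign_or (hΩ 0).1 hchart two_pos hφ hφ0 hφeq hint ?_
  by_contra! h
  obtain ⟨⟨b', hb', k', hk', hneg⟩, b, hb, k, hk, hpos⟩ := h
  exact hψ.boundary_sign hΩ hc hφ hφ0 hφeq hb hb' hk hk' hpos hneg

end Planar

section Concrete

lemma rpow_tangent_le {p A B : ℝ} (hp : 1 < p) (hA : 0 ≤ A) (hB : 0 ≤ B) :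
    p * A ^ (p - 1) * (B - A) ≤ B ^ p - A ^ p := by
  rcases hA.eq_or_lt with rfl | hA
  · rw [Real.zero_rpow (by linarith), Real.zero_rpow (by linarith)]
    simpa using Real.rpow_nonneg hB p
  have h1 : -1 ≤ B / A - 1 := by linarith [div_nonneg hB hA.le]
  have h2 := one_add_mul_self_le_rpow_one_add h1 hp.le
  rw [add_sub_cancel, Real.div_rpow hB hA.le, le_div_iff₀ (Real.rpow_pos_of_pos hA p)] at h2
  have h3 : A ^ p = A ^ (p - 1) * A := by
    rw [← Real.rpow_add_one hA.ne', sub_add_cancel]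
  have h4 : p * (B / A - 1) * A ^ p = p * A ^ (p - 1) * (B - A) := by
    rw [h3]
    field_simp
  linarith

lemma IsSol.posSol {N : ℕ} {Ω : Set (Euc N)} {p lam α : ℝ} {ψ : Euc N → ℝ} (hp : 1 < p)
    (hlam : 0 < lam) (h : IsSol Ω p lam α ψ) :
    PosSol Ω ψ (fun x => p * lam * Vfun p lam α ψ x) (fun x => (max (α + lam * ψ x) 0) ^ p) where
  contDiff := h.1
  eq := h.2.1
  g_nonneg x := Real.rpow_nonneg (le_max_right _ _) p
  g_ne := by
    by_contra! hne
    have := h.2.2.2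
    rw [setIntegral_eq_zero_of_forall_eq_zero hne] at this
    exact zero_ne_one this
  conv x y := by
    refine le_trans ?_ (rpow_tangent_le hp (le_max_right _ _) (le_max_right _ _))
    have h1 : (α + lam * ψ y) - (α + lam * ψ x) = lam * (ψ y - ψ x) := by ring
    rw [Vfun, show ∀ a b c d : ℝ, a * b * c * d = a * c * (b * d) by intros; ring, ← h1]
    rcases le_total (α + lam * ψ x) 0 with h0 | h0
    · rw [max_eq_right h0, Real.zero_rpow (by linarith)]
      simp
    · rw [max_eq_left h0]
      have := Real.rpow_nonneg h0 (p - 1)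
      gcongr
      exact le_max_left _ _
  c_cont := by
    have := h.1.continuous
    refine continuous_const.mul (Continuous.rpow_const (by fun_prop) fun x => Or.inr (by linarith))
  c_nonneg x := mul_nonneg (by positivity) (Real.rpow_nonneg (le_max_right _ _) _)
  zero := h.2.2.1

end Concrete

theorem stmt12 (N : ℕ) (hN : 2 ≤ N) (p : ℝ) (hp1 : 1 < p)
    (hpN : N = 2 ∨ p < (N : ℝ) / ((N : ℝ) - 2)) (lam : ℝ) (hlam : 0 < lam)
    (Ω : Set (EuclideanSpace ℝ (Fin N)))
    (hΩ : (∃ R : ℝ, 0 < R ∧ Ω = ball (0 : EuclideanSpace ℝ (Fin N)) R) ∨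
      (N = 2 ∧ IsC3Domain Ω ∧
        (∀ (i : Fin N), ∀ x ∈ Ω, reflect i x ∈ Ω) ∧
        (∀ (i : Fin N), ∀ x ∈ Ω, ∀ y ∈ Ω,
          (∀ j : Fin N, j ≠ i → x j = y j) → segment ℝ x y ⊆ Ω)))
    (α : ℝ) (ψ φ : EuclideanSpace ℝ (Fin N) → ℝ)
    (hsol : IsSol Ω p lam α ψ)
    (hφreg : ContDiff ℝ 2 φ) (hφne : ∃ x ∈ closure Ω, φ x ≠ 0)
    (hφbd : ∀ x ∈ frontier Ω, φ x = 0)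
    (hφeq : ∀ x ∈ Ω,
      -lapl φ x = p * lam * (Vfun p lam α ψ x * (φ x - avgV Ω p lam α ψ φ))) :
    (∫ x in Ω, Vfun p lam α ψ x * φ x) ≠ 0 := by
  intro hzero
  have hψ := hsol.posSol hp1 hlam
  have havg : avgV Ω p lam α ψ φ = 0 := by rw [avgV, hzero, zero_div]
  have heq : ∀ x ∈ Ω, lapl φ x = -(p * lam * Vfun p lam α ψ x) * φ x := fun x hx => by
    have := hφeq x hx
    rw [havg] at this
    linarith
  have hc : ∀ x y, ψ x = ψ y →
      p * lam * Vfun p lam α ψ x = p * lam * Vfun p lam α ψ y := fun x y h => by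
    simp only [Vfun, h]
  have hΩo : IsOpen Ω := by
    rcases hΩ with ⟨R, -, rfl⟩ | ⟨-, h, -⟩
    · exact isOpen_ball
    · exact h.1
  have hint : ∫ x in Ω, lapl φ x = 0 := by
    rw [setIntegral_congr_fun (g := fun x => -(p * lam) * (Vfun p lam α ψ x * φ x))
      hΩo.measurableSet fun x hx => (heq x hx).trans (by ring), integral_const_mul, hzero, mul_zero]
  obtain ⟨x, hx, hne⟩ := hφne
  refine hne ?_
  rcases hΩ with ⟨R, hR, rfl⟩ | ⟨rfl, hC3, hrefl, hconv⟩
  · exact hψ.eq_zero_of_ball hR (by omega) hc hφreg hφbd heq hint x hx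
  · exact hψ.eq_zero_of_coordSym (hC3.coordSym hrefl hconv) hC3.hasC2Chart hc hφreg hφbd heq hint
      x hx
end
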